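/- Assume Conditions (C). There exists a constant A > 0 such that for any sequences 1 ≤ l ≤ m and y for which (√(m(m−l)), y) verifies Conditions (C2), m − l → ∞, and y = O(m − l), one has P( sup_{l ≤ i ≤ j ≤ m} | Σ_{k=i}^{j} w_{v(k)} − E[Σ_{k=i}^{j} w_{v(k)}] | ≥ y ) ≤ A·exp(−y²/(A(y·n^{1/3} + (m − l)))). -/

import Mathlib

open MeasureTheory Filter Asymptotics
open scoped Classical ENNReal Topology

noncomputable section

/-- `ℓ_n`: the total weight. -/
def ell (w : ∀ n : ℕ, Fin n → ℝ) (n : ℕ) : ℝ := ∑ i, w n i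

/-- Conditions (C) on the triangular array of weights, relative to the law `μ` of the
limiting random variable `W`. -/
structure CondC (w : ∀ n : ℕ, Fin n → ℝ) (μ : Measure ℝ) : Prop where
  isProb : IsProbabilityMeasure μ
  pos : ∀ᵐ x ∂μ, 0 < x
  w_pos : ∀ n, ∀ i : Fin n, 0 < w n i
  w_anti : ∀ n, ∀ i j : Fin n, i ≤ j → w n j ≤ w n i
  int3 : Integrable (fun x => x ^ 3) μ
  moment_eq : ∫ x, x ^ 2 ∂μ = ∫ x, x ∂μ
  weak : ∀ g : BoundedContinuousFunction ℝ ℝ,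
    Tendsto (fun n : ℕ => (∑ i : Fin n, g (w n i)) / (n : ℝ)) atTop (𝓝 (∫ x, g x ∂μ))
  ell_asymp : (fun n : ℕ => ell w n - (∫ x, x ∂μ) * (n : ℝ)) =o[atTop]
      fun n : ℕ => (n : ℝ) ^ ((2 : ℝ) / 3)
  sq_asymp : (fun n : ℕ => (∑ i : Fin n, (w n i) ^ 2) - (∫ x, x ^ 2 ∂μ) * (n : ℝ)) =o[atTop]
      fun n : ℕ => (n : ℝ) ^ ((2 : ℝ) / 3)
  cube_asymp : (fun n : ℕ => (∑ i : Fin n, (w n i) ^ 3) - (∫ x, x ^ 3 ∂μ) * (n : ℝ)) =o[atTop]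
      fun _ : ℕ => (1 : ℝ)
  max_asymp : (fun n : ℕ => ⨆ i : Fin n, w n i) =o[atTop] fun n : ℕ => (n : ℝ) ^ ((1 : ℝ) / 3)

/-- The constant `C = E[W³]/E[W]`. -/
def Cconst (μ : Measure ℝ) : ℝ := (∫ x, x ^ 3 ∂μ) / (∫ x, x ∂μ)

/-- The critical percolation parameter `p_f = (ℓ_n^{1/3} + f_n)/ℓ_n^{4/3}`. -/
def pf (w : ∀ n : ℕ, Fin n → ℝ) (f : ℕ → ℝ) (n : ℕ) : ℝ :=
  (ell w n ^ ((1 : ℝ) / 3) + f n) / ell w n ^ ((4 : ℝ) / 3)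

/-- A Bernoulli-type measure on `Bool` with parameter `p`. -/
def bern (p : ℝ) : Measure Bool :=
  ENNReal.ofReal (1 - p) • Measure.dirac false + ENNReal.ofReal p • Measure.dirac true

/-- The law of the independent edge indicators of the rank-1 inhomogeneous random graph
`G(W,p)`: the indicator attached to the (ordered) pair `(i,j)` is Bernoulli with success
probability `1 - exp (- w i * w j * p)`, all independent. -/
def graphMeasure (n : ℕ) (wn : Fin n → ℝ) (p : ℝ) : Measure (Fin n → Fin n → Bool) :=
  Measure.pi fun i => Measure.pi fun j => bern (1 - Real.exp (-(wn i * wn j * p)))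

/-- The simple graph built from a sample of edge indicators: `i ~ j` iff `i ≠ j` and the
indicator of the pair `(min i j, max i j)` is `true`. -/
def graphOf {n : ℕ} (ω : Fin n → Fin n → Bool) : SimpleGraph (Fin n) :=
  SimpleGraph.fromRel fun i j => ω (min i j) (max i j) = true

/-- The size (number of vertices) of a connected component. -/
def csize {n : ℕ} (G : SimpleGraph (Fin n)) (c : G.ConnectedComponent) : ℕ :=
  Nat.card {v : Fin n // G.connectedComponentMk v = c}

/-- The weight of a connected component: sum of the weights of its vertices. -/
def cweight {n : ℕ} (wn : Fin n → ℝ) (G : SimpleGraph (Fin n)) (c : G.ConnectedComponent) : ℝ :=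
  ∑ v : Fin n, if G.connectedComponentMk v = c then wn v else 0

/-- The number of edges of a connected component. -/
def cedges {n : ℕ} (G : SimpleGraph (Fin n)) (c : G.ConnectedComponent) : ℕ :=
  Nat.card {e : Sym2 (Fin n) // e ∈ G.edgeSet ∧ ∀ v ∈ e, G.connectedComponentMk v = c}

/-- The surplus (excess) of a connected component: edges − vertices + 1. -/
def csurplus {n : ℕ} (G : SimpleGraph (Fin n)) (c : G.ConnectedComponent) : ℤ :=
  (cedges G c : ℤ) - (csize G c : ℤ) + 1

/-- `c` is a largest connected component. -/
def isLargest {n : ℕ} (G : SimpleGraph (Fin n)) (c : G.ConnectedComponent) : Prop :=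
  ∀ c', csize G c' ≤ csize G c

/-- The finset of connected components of a graph on `Fin n`. -/
def comps {n : ℕ} (G : SimpleGraph (Fin n)) : Finset G.ConnectedComponent :=
  Finset.univ.image G.connectedComponentMk

/-- The law of the size-biased random order without replacement `(v(1),…,v(n))`, seen as a
measure on functions `Fin n → Fin n` (supported on permutations `σ`, with
`P(v = σ) = ∏_i w (σ i) / (ℓ_n − ∑_{k<i} w (σ k))`). -/
def sbMeasure (n : ℕ) (wn : Fin n → ℝ) : Measure (Fin n → Fin n) :=
  Measure.sum fun σ : Equiv.Perm (Fin n) =>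
    ENNReal.ofReal (∏ i : Fin n,
        wn (σ i) / ((∑ k, wn k) - ∑ k ∈ Finset.univ.filter fun k => k < i, wn (σ k))) •
      Measure.dirac ⇑σ

/-- The joint law of (edge indicators of `G(W,p)`, size-biased order), the two being
independent. -/
def expMeasure' (n : ℕ) (wn : Fin n → ℝ) (p : ℝ) :
    Measure ((Fin n → Fin n → Bool) × (Fin n → Fin n)) :=
  Measure.sum fun σ : Equiv.Perm (Fin n) =>
    ENNReal.ofReal (∏ i : Fin n,
        wn (σ i) / ((∑ k, wn k) - ∑ k ∈ Finset.univ.filter fun k => k < i, wn (σ k))) •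
      (graphMeasure n wn p).map fun g => (g, ⇑σ)

/-- `sbW wn vord k` is `w_{v(k)}` (1-based), with the conventions `w_{v(0)} = 0` and
`w_{v(k)} = 0` for `k > n`. -/
def sbW {n : ℕ} (wn : Fin n → ℝ) (vord : Fin n → Fin n) (k : ℕ) : ℝ :=
  if h : k - 1 < n then (if k = 0 then 0 else wn (vord ⟨k - 1, h⟩)) else 0

/-- The (0-based) first position, in the order `vord`, of a vertex of the component `c`;
this governs the order in which components are discovered by the breadth-first walk. -/
def firstIdx {n : ℕ} (G : SimpleGraph (Fin n)) (vord : Fin n → Fin n)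
    (c : G.ConnectedComponent) : ℕ :=
  sInf {i : ℕ | ∃ h : i < n, G.connectedComponentMk (vord ⟨i, h⟩) = c}

/-- The number of vertices explored strictly before the exploration of the component `c`
starts: components are explored in the order of their first appearance in `vord`, and the
exploration of `c` occupies the steps `startT c + 1, …, startT c + csize c`. -/
def startT {n : ℕ} (G : SimpleGraph (Fin n)) (vord : Fin n → Fin n)
    (c : G.ConnectedComponent) : ℕ :=
  ∑ v : Fin n, if firstIdx G vord (G.connectedComponentMk v) < firstIdx G vord c then 1 else 0

/-- The state (explored vertices, queue of discovered-but-unexplored vertices) of the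
breadth-first walk after `i` steps; roots are chosen as the first undiscovered vertex in the
order `vord`, and children are queued in the order `vord`. -/
def bfwQueue {n : ℕ} (G : SimpleGraph (Fin n)) (vord : Fin n → Fin n) :
    ℕ → Finset (Fin n) × List (Fin n)
  | 0 => (∅, [])
  | i + 1 =>
    let s := bfwQueue G vord i
    let q : List (Fin n) :=
      if s.2.isEmpty then ((List.ofFn vord).filter fun v => decide (v ∉ s.1)).take 1 else s.2
    match q with
    | [] => (s.1, [])
    | v :: rest =>
      (insert v s.1,
        rest ++ (List.ofFn vord).filter fun u => decide (G.Adj v u ∧ u ∉ s.1 ∧ u ∉ q))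

/-- The reflected exploration process `L` of the breadth-first walk:
`L_0 = 1`, `L_{i+1} = max (L_i + c(i+1) - 1) 1`. -/
def Lproc {n : ℕ} (G : SimpleGraph (Fin n)) (vord : Fin n → Fin n) (i : ℕ) : ℕ :=
  max (bfwQueue G vord i).2.length 1

/-- `discNbrs G vord i` is the number of neighbours of `v(i+1)` (0-based: `vord i`) outside
`{v(1),…,v(i+1)}`, i.e. the increment `X⁰_{i+1} + 1` of the process `L⁰`. -/
def discNbrs {n : ℕ} (G : SimpleGraph (Fin n)) (vord : Fin n → Fin n) (i : ℕ) : ℕ :=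
  Nat.card {j : Fin n // (∃ h : i < n, G.Adj (vord ⟨i, h⟩) j) ∧
    ∀ k : ℕ, ∀ hk : k < n, k ≤ i → vord ⟨k, hk⟩ ≠ j}

/-- The process `L⁰`: `L⁰_0 = 1`, `L⁰_{i+1} = L⁰_i + X⁰_{i+1}` where
`X⁰_{i+1} = ∑_{j ∉ {v(1),…,v(i+1)}} Y(v(i+1), j) − 1`. -/
def L0 {n : ℕ} (G : SimpleGraph (Fin n)) (vord : Fin n → Fin n) (m : ℕ) : ℤ :=
  1 - (m : ℤ) + ∑ i ∈ Finset.range m, (discNbrs G vord i : ℤ)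

/-- The deterministic-drift process `L̃^h`, defined by
`L̃^h_m + m − 1 = ∑_{i=1}^m ∑_{k > i+h} (1 − exp (−w_{v(i)} w_{v(k)} p))`,
the inner sum being over positions `k ≤ n` in the size-biased order. -/
def Ltilde {n : ℕ} (wn : Fin n → ℝ) (p : ℝ) (vord : Fin n → Fin n) (h m : ℕ) : ℝ :=
  1 - (m : ℝ) + ∑ i ∈ Finset.range m,
    if hi : i < n then
      ∑ k : Fin n, if i + h < (k : ℕ) then
        1 - Real.exp (-(wn (vord ⟨i, hi⟩) * wn (vord k) * p)) else 0
    else 0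

/-- The law of the independent exponential clocks `(T_k)_{k ≤ n}`, `T_k` of rate `w_k / ℓ_n`. -/
def clocksMeasure (n : ℕ) (wn : Fin n → ℝ) : Measure (Fin n → ℝ) :=
  Measure.pi fun k => ProbabilityTheory.expMeasure (wn k / ∑ i, wn i)

/-- `N(x)`: the number of clocks that have rung by time `x`. -/
def Nclock {n : ℕ} (x : ℝ) (ω : Fin n → ℝ) : ℕ :=
  ∑ k : Fin n, if ω k ≤ x then 1 else 0

/-- `X(x)`: the total weight of the clocks that have rung by time `x`. -/
def Xclock {n : ℕ} (wn : Fin n → ℝ) (x : ℝ) (ω : Fin n → ℝ) : ℝ :=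
  ∑ k : Fin n, if ω k ≤ x then wn k else 0

/-- Conditions (C2) on a pair of sequences `(a, b)`, relative to the constant `Ā`. -/
structure Cond2 (w : ∀ n : ℕ, Fin n → ℝ) (Abar : ℝ) (a b : ℕ → ℝ) : Prop where
  exp_lt : ∀ᶠ n : ℕ in atTop,
    Real.exp (-(b n) ^ 2 / (Abar * (b n * (n : ℝ) ^ ((1 : ℝ) / 3) + a n))) < 1 / 4
  a_top : Tendsto a atTop atTop
  b_top : Tendsto b atTop atTop
  a_lito : a =o[atTop] fun n : ℕ => (n : ℝ)
  b_bigO : b =O[atTop] a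
  a_bigO : a =O[atTop] fun n => b n * ell w n ^ ((1 : ℝ) / 3)
  a_sq_bigO : (fun n => a n ^ 2) =O[atTop] fun n => b n * ell w n

/-- Conditions (C3) on a quadruple of sequences `(a, b, c, d)`. -/
structure Cond3 (w : ∀ n : ℕ, Fin n → ℝ) (Abar : ℝ) (a b c d : ℕ → ℝ) : Prop where
  sum_lito : (fun n => a n + c n) =o[atTop] fun n : ℕ => (n : ℝ)
  diff_top : Tendsto (fun n => a n - b n) atTop atTop
  d_bigO : d =O[atTop] fun n => a n - b n
  c2 : Cond2 w Abar (fun n => Real.sqrt ((a n - b n) * (a n + c n))) d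

/-- The list of component sizes, sorted in decreasing order. -/
def sizesList {n : ℕ} (G : SimpleGraph (Fin n)) : List ℕ :=
  (((comps G).val.map fun c => csize G c).sort (· ≤ ·)).reverse

/-- `kthSize G k` is the size of the `(k+1)`-st largest connected component of `G`
(`0` if there is no such component). -/
def kthSize {n : ℕ} (G : SimpleGraph (Fin n)) (k : ℕ) : ℕ := (sizesList G).getD k 0

end

namespace SB

/-- Sum of `h` over the positions `≥ k` of the order `σ`. -/
noncomputable def Rs {n : ℕ} (h : Fin n → ℝ) (k : ℕ) (σ : Equiv.Perm (Fin n)) : ℝ :=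
  ∑ p : Fin n, if k ≤ p.1 then h (σ p) else 0

/-- Value of `h` at position `j` of the order. -/
noncomputable def val {n : ℕ} (h : Fin n → ℝ) (j : ℕ) (σ : Equiv.Perm (Fin n)) : ℝ :=
  if hj : j < n then h (σ ⟨j, hj⟩) else 0

/-- Partial product of the step probabilities. -/
noncomputable def prk {n : ℕ} (w : Fin n → ℝ) (k : ℕ) (σ : Equiv.Perm (Fin n)) : ℝ :=
  ∏ i ∈ Finset.range k, val w i σ / Rs w i σ

/-- Expectation of functions of the first `k` positions. -/
noncomputable def Ek {n : ℕ} (w : Fin n → ℝ) (k : ℕ) (F : Equiv.Perm (Fin n) → ℝ) : ℝ :=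
  ((n - k).factorial : ℝ)⁻¹ * ∑ σ, prk w k σ * F σ

/-- Expectation. -/
noncomputable def Ex {n : ℕ} (w : Fin n → ℝ) (F : Equiv.Perm (Fin n) → ℝ) : ℝ :=
  ∑ σ, prk w n σ * F σ

/-- Probability. -/
noncomputable def Pr {n : ℕ} (w : Fin n → ℝ) (s : Set (Equiv.Perm (Fin n))) : ℝ :=
  Ex w (s.indicator fun _ => 1)

/-- `H` only depends on the first `k` positions. -/
def DepOn {n : ℕ} (k : ℕ) (H : Equiv.Perm (Fin n) → ℝ) : Prop :=
  ∀ σ τ : Equiv.Perm (Fin n), (∀ i : Fin n, i.1 < k → σ i = τ i) → H σ = H τ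

/-- One step conditional expectation. -/
noncomputable def cnd {n : ℕ} (w : Fin n → ℝ) (k : ℕ) (hk : k < n)
    (H : Equiv.Perm (Fin n) → ℝ) (σ : Equiv.Perm (Fin n)) : ℝ :=
  ∑ p : Fin n, if k ≤ p.1 then w (σ p) / Rs w k σ * H (σ * Equiv.swap ⟨k, hk⟩ p) else 0

/-- compensator of `h` at step `j` -/
noncomputable def Dr {n : ℕ} (w h : Fin n → ℝ) (j : ℕ) (σ : Equiv.Perm (Fin n)) : ℝ :=
  Rs (fun i => w i * h i) j σ / Rs w j σ

section basic
variable {n : ℕ}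

lemma Rs_add_pre (h : Fin n → ℝ) (k : ℕ) (hk : k ≤ n) (σ : Equiv.Perm (Fin n)) :
    (∑ j ∈ Finset.range k, val h j σ) + Rs h k σ = ∑ i, h i := by
  have h1 : (∑ j ∈ Finset.range k, val h j σ) = ∑ p : Fin n, if k ≤ p.1 then 0 else h (σ p) := by
    have : ∀ p : Fin n, (if k ≤ p.1 then 0 else h (σ p)) =
        (fun j : ℕ => if k ≤ j then 0 else val h j σ) p.1 := by
      intro p; simp [val]
    rw [Finset.sum_congr rfl (fun p _ => this p), Fin.sum_univ_eq_sum_range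
      (fun j : ℕ => if k ≤ j then 0 else val h j σ) n]
    rw [← Finset.sum_subset (Finset.range_subset_range.2 hk)]
    · apply Finset.sum_congr rfl
      intro j hj
      have := Finset.mem_range.1 hj
      rw [if_neg (by omega)]
    · intro j _ hj
      have : k ≤ j := by simpa using hj
      rw [if_pos this]
  rw [h1, Rs, ← Finset.sum_add_distrib, ← Equiv.sum_comp σ h]
  apply Finset.sum_congr rfl
  intro p _
  split_ifs <;> simp

lemma val_dep (h : Fin n → ℝ) (j : ℕ) : DepOn (j + 1) (val h j) := by
  intro σ τ hst
  unfold val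
  split_ifs with hj
  · rw [hst ⟨j, hj⟩ (by simp)]
  · rfl

lemma DepOn.mono {k l : ℕ} (hkl : k ≤ l) {H : Equiv.Perm (Fin n) → ℝ} (h : DepOn k H) :
    DepOn l H := fun σ τ hst => h σ τ fun i hi => hst i (by omega)

lemma Rs_dep (h : Fin n → ℝ) (k : ℕ) : DepOn k (Rs h k) := by
  intro σ τ hst
  by_cases hk : k ≤ n
  · have h1 := Rs_add_pre h k hk σ
    have h2 := Rs_add_pre h k hk τ
    have h3 : (∑ j ∈ Finset.range k, val h j σ) = ∑ j ∈ Finset.range k, val h j τ := by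
      apply Finset.sum_congr rfl
      intro j hj
      exact val_dep h j σ τ fun i hi => hst i (by have := Finset.mem_range.1 hj; omega)
    linarith
  · unfold Rs
    apply Finset.sum_congr rfl
    intro p _
    rw [if_neg (by omega), if_neg (by omega)]

lemma Rs_succ (h : Fin n → ℝ) (k : ℕ) (hk : k < n) (σ : Equiv.Perm (Fin n)) :
    Rs h k σ = val h k σ + Rs h (k + 1) σ := by
  have h1 := Rs_add_pre h k hk.le σ
  have h2 := Rs_add_pre h (k + 1) hk σ
  rw [Finset.sum_range_succ] at h2
  linarith

lemma Rs_nonneg {h : Fin n → ℝ} (hh : ∀ i, 0 ≤ h i) (k : ℕ) (σ : Equiv.Perm (Fin n)) :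
    0 ≤ Rs h k σ := by
  unfold Rs
  apply Finset.sum_nonneg
  intro p _
  split_ifs
  · exact hh _
  · exact le_rfl

lemma Rs_mono {h g : Fin n → ℝ} (hh : ∀ i, h i ≤ g i) (k : ℕ) (σ : Equiv.Perm (Fin n)) :
    Rs h k σ ≤ Rs g k σ := by
  unfold Rs
  apply Finset.sum_le_sum
  intro p _
  split_ifs
  · exact hh _
  · exact le_rfl

lemma Rs_le_sum {h : Fin n → ℝ} (hh : ∀ i, 0 ≤ h i) (k : ℕ) (σ : Equiv.Perm (Fin n)) :
    Rs h k σ ≤ ∑ i, h i := by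
  rw [← Equiv.sum_comp σ h]
  unfold Rs
  apply Finset.sum_le_sum
  intro p _
  split_ifs
  · exact le_rfl
  · exact hh _

lemma Rs_mul (c : ℝ) (h : Fin n → ℝ) (k : ℕ) (σ : Equiv.Perm (Fin n)) :
    Rs (fun i => c * h i) k σ = c * Rs h k σ := by
  unfold Rs
  rw [Finset.mul_sum]
  apply Finset.sum_congr rfl
  intro p _
  split_ifs <;> simp

lemma Rs_add (h g : Fin n → ℝ) (k : ℕ) (σ : Equiv.Perm (Fin n)) :
    Rs (fun i => h i + g i) k σ = Rs h k σ + Rs g k σ := by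
  unfold Rs
  rw [← Finset.sum_add_distrib]
  apply Finset.sum_congr rfl
  intro p _
  split_ifs <;> simp

lemma Rs_pos {w : Fin n → ℝ} (hw : ∀ i, 0 < w i) {k : ℕ} (hk : k < n) (σ : Equiv.Perm (Fin n)) :
    0 < Rs w k σ := by
  rw [Rs_succ w k hk]
  have := Rs_nonneg (fun i => (hw i).le) (k + 1) σ
  have : 0 < val w k σ := by simp [val, hk, hw]
  linarith

lemma val_nonneg {h : Fin n → ℝ} (hh : ∀ i, 0 ≤ h i) (k : ℕ) (σ : Equiv.Perm (Fin n)) :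
    0 ≤ val h k σ := by
  unfold val; split_ifs
  · exact hh _
  · exact le_rfl

lemma val_mono {h g : Fin n → ℝ} (hh : ∀ i, h i ≤ g i) (k : ℕ) (σ : Equiv.Perm (Fin n)) :
    val h k σ ≤ val g k σ := by
  unfold val; split_ifs
  · exact hh _
  · exact le_rfl

lemma val_le {h : Fin n → ℝ} {c : ℝ} (hc : 0 ≤ c) (hh : ∀ i, h i ≤ c) (k : ℕ)
    (σ : Equiv.Perm (Fin n)) : val h k σ ≤ c := by
  unfold val; split_ifs
  · exact hh _
  · exact hc

lemma val_mul (c : ℝ) (h : Fin n → ℝ) (k : ℕ) (σ : Equiv.Perm (Fin n)) :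
    val (fun i => c * h i) k σ = c * val h k σ := by
  unfold val; split_ifs <;> simp

lemma val_add (h g : Fin n → ℝ) (k : ℕ) (σ : Equiv.Perm (Fin n)) :
    val (fun i => h i + g i) k σ = val h k σ + val g k σ := by
  unfold val; split_ifs <;> simp

lemma prk_nonneg {w : Fin n → ℝ} (hw : ∀ i, 0 < w i) (k : ℕ) (σ : Equiv.Perm (Fin n)) :
    0 ≤ prk w k σ := by
  unfold prk
  apply Finset.prod_nonneg
  intro i _
  exact div_nonneg (val_nonneg (fun i => (hw i).le) _ _) (Rs_nonneg (fun i => (hw i).le) _ _)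

lemma swap_pre (k : ℕ) (hk : k < n) (p : Fin n) (hp : k ≤ p.1) (σ : Equiv.Perm (Fin n))
    (i : Fin n) (hi : i.1 < k) : (σ * Equiv.swap ⟨k, hk⟩ p) i = σ i := by
  rw [Equiv.Perm.mul_apply, Equiv.swap_apply_of_ne_of_ne]
  · intro h; rw [h] at hi; simp at hi
  · intro h; rw [h] at hi; omega

lemma cnd_eq_of_dep (w : Fin n → ℝ) (hw : ∀ i, 0 < w i) (k : ℕ) (hk : k < n)
    (H : Equiv.Perm (Fin n) → ℝ) (hH : DepOn k H) (σ : Equiv.Perm (Fin n)) :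
    cnd w k hk H σ = H σ := by
  unfold cnd
  have h1 : ∀ p : Fin n, (if k ≤ p.1 then w (σ p) / Rs w k σ * H (σ * Equiv.swap ⟨k, hk⟩ p) else 0)
      = (if k ≤ p.1 then w (σ p) else 0) * (H σ / Rs w k σ) := by
    intro p
    split_ifs with hp
    · rw [hH _ σ (fun i hi => swap_pre k hk p hp σ i hi)]; ring
    · simp
  rw [Finset.sum_congr rfl fun p _ => h1 p, ← Finset.sum_mul]
  change Rs w k σ * _ = _
  have := Rs_pos hw hk σ
  field_simp

lemma prk_dep (w : Fin n → ℝ) (k : ℕ) : DepOn k (prk w k) := by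
  intro σ τ hst
  unfold prk
  apply Finset.prod_congr rfl
  intro i hi
  have := Finset.mem_range.1 hi
  rw [val_dep w i σ τ fun j hj => hst j (by omega), Rs_dep w i σ τ fun j hj => hst j (by omega)]

lemma Ek_succ (w : Fin n → ℝ) (k : ℕ) (hk : k < n) (H : Equiv.Perm (Fin n) → ℝ) :
    Ek w (k + 1) H = Ek w k (cnd w k hk H) := by
  have key : ∀ p : Fin n, k ≤ p.1 → ∑ σ, prk w (k + 1) σ * H σ =
      ∑ σ : Equiv.Perm (Fin n), prk w k σ * (w (σ p) / Rs w k σ * H (σ * Equiv.swap ⟨k, hk⟩ p)) := by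
    intro p hp
    rw [← Equiv.sum_comp (Equiv.mulRight (Equiv.swap (⟨k, hk⟩ : Fin n) p))]
    apply Finset.sum_congr rfl
    intro σ _
    simp only [Equiv.coe_mulRight]
    have hpre := fun i hi => swap_pre k hk p hp σ i hi
    unfold prk
    rw [Finset.prod_range_succ]
    have e1 := prk_dep w k _ _ hpre
    unfold prk at e1
    rw [e1, Rs_dep w k _ _ hpre]
    have e2 : val w k (σ * Equiv.swap ⟨k, hk⟩ p) = w (σ p) := by
      simp [val, hk]
    rw [e2]; ring
  have hcard : ((Finset.univ.filter fun p : Fin n => k ≤ p.1).card : ℝ) = (n - k : ℕ) := by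
    congr 1
    have : (Finset.univ.filter fun p : Fin n => k ≤ p.1) = Finset.Ici ⟨k, hk⟩ := by
      ext p; simp [Fin.le_def]
    rw [this, Fin.card_Ici]
  unfold Ek cnd
  have h2 : ∑ σ : Equiv.Perm (Fin n), prk w k σ * ∑ p : Fin n,
      (if k ≤ p.1 then w (σ p) / Rs w k σ * H (σ * Equiv.swap ⟨k, hk⟩ p) else 0)
      = (n - k : ℕ) * ∑ σ, prk w (k + 1) σ * H σ := by
    simp_rw [Finset.mul_sum, mul_ite, mul_zero]
    rw [Finset.sum_comm]
    simp_rw [← Finset.mul_sum]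
    rw [← hcard, ← nsmul_eq_mul, ← Finset.sum_const, Finset.sum_filter]
    apply Finset.sum_congr rfl
    intro p _
    split_ifs with hp
    · exact (key p hp).symm
    · simp
  rw [h2]
  have h3 : n - k = (n - (k + 1)) + 1 := by omega
  rw [h3, Nat.factorial_succ, ← mul_assoc]
  congr 1
  push_cast
  have : ((n - (k+1)).factorial : ℝ) ≠ 0 := by positivity
  field_simp

lemma Ex_eq_Ek_n (w : Fin n → ℝ) (F : Equiv.Perm (Fin n) → ℝ) : Ex w F = Ek w n F := by
  simp [Ex, Ek]

lemma Ek_mono {w : Fin n → ℝ} (hw : ∀ i, 0 < w i) (k : ℕ) {F G : Equiv.Perm (Fin n) → ℝ}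
    (h : ∀ σ, F σ ≤ G σ) : Ek w k F ≤ Ek w k G := by
  unfold Ek
  apply mul_le_mul_of_nonneg_left _ (by positivity)
  apply Finset.sum_le_sum
  intro σ _
  exact mul_le_mul_of_nonneg_left (h σ) (prk_nonneg hw _ _)

lemma Ex_mono {w : Fin n → ℝ} (hw : ∀ i, 0 < w i) {F G : Equiv.Perm (Fin n) → ℝ}
    (h : ∀ σ, F σ ≤ G σ) : Ex w F ≤ Ex w G := by
  rw [Ex_eq_Ek_n, Ex_eq_Ek_n]; exact Ek_mono hw _ h

lemma Ek_step_dep (w : Fin n → ℝ) (hw : ∀ i, 0 < w i) (k : ℕ) (hk : k ≤ n)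
    (H : Equiv.Perm (Fin n) → ℝ) (hH : DepOn k H) (j : ℕ) (hkj : k ≤ j) (hj : j ≤ n) :
    Ek w j H = Ek w k H := by
  induction j, hkj using Nat.le_induction with
  | base => rfl
  | succ j hkj ih =>
    rw [Ek_succ w j (by omega), ← ih (by omega)]
    congr 1
    funext σ
    exact cnd_eq_of_dep w hw j _ H (hH.mono hkj) σ

lemma Ex_dep (w : Fin n → ℝ) (hw : ∀ i, 0 < w i) (k : ℕ) (hk : k ≤ n)
    (H : Equiv.Perm (Fin n) → ℝ) (hH : DepOn k H) : Ex w H = Ek w k H := by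
  rw [Ex_eq_Ek_n]; exact Ek_step_dep w hw k hk H hH n hk le_rfl

lemma Ek_zero_const (w : Fin n → ℝ) (c : ℝ) : Ek w 0 (fun _ => c) = c := by
  unfold Ek prk
  simp [Finset.card_univ, Fintype.card_perm]
  have : (n.factorial : ℝ) ≠ 0 := by positivity
  field_simp

lemma Ex_const (w : Fin n → ℝ) (hw : ∀ i, 0 < w i) (c : ℝ) : Ex w (fun _ => c) = c := by
  rw [Ex_dep w hw 0 (Nat.zero_le _) _ (fun _ _ _ => rfl), Ek_zero_const]

lemma Ex_add (w : Fin n → ℝ) (F G : Equiv.Perm (Fin n) → ℝ) :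
    Ex w (fun σ => F σ + G σ) = Ex w F + Ex w G := by
  simp [Ex, mul_add, Finset.sum_add_distrib]

lemma Ex_sub (w : Fin n → ℝ) (F G : Equiv.Perm (Fin n) → ℝ) :
    Ex w (fun σ => F σ - G σ) = Ex w F - Ex w G := by
  simp [Ex, mul_sub, Finset.sum_sub_distrib]

lemma Ex_mul (w : Fin n → ℝ) (c : ℝ) (F : Equiv.Perm (Fin n) → ℝ) :
    Ex w (fun σ => c * F σ) = c * Ex w F := by
  simp only [Ex, Finset.mul_sum]
  apply Finset.sum_congr rfl
  intros; ring

lemma Ex_sum (w : Fin n → ℝ) {ι : Type*} (s : Finset ι) (F : ι → Equiv.Perm (Fin n) → ℝ) :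
    Ex w (fun σ => ∑ i ∈ s, F i σ) = ∑ i ∈ s, Ex w (F i) := by
  simp only [Ex, Finset.mul_sum]
  rw [Finset.sum_comm]

lemma Ex_abs_le {w : Fin n → ℝ} (hw : ∀ i, 0 < w i) (F : Equiv.Perm (Fin n) → ℝ) :
    |Ex w F| ≤ Ex w (fun σ => |F σ|) := by
  unfold Ex
  refine (Finset.abs_sum_le_sum_abs _ _).trans (Finset.sum_le_sum fun σ _ => ?_)
  rw [abs_mul, abs_of_nonneg (prk_nonneg hw _ _)]

lemma Dr_dep (w h : Fin n → ℝ) (j : ℕ) : DepOn j (Dr w h j) := by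
  intro σ τ hst
  unfold Dr
  rw [Rs_dep w j σ τ hst, Rs_dep _ j σ τ hst]

lemma Ex_val (w : Fin n → ℝ) (hw : ∀ i, 0 < w i) (h : Fin n → ℝ) (j : ℕ) (hj : j < n) :
    Ex w (val h j) = Ex w (Dr w h j) := by
  rw [Ex_dep w hw (j + 1) hj _ (val_dep h j), Ek_succ w j hj,
    Ex_dep w hw j hj.le _ (Dr_dep w h j)]
  congr 1
  funext σ
  unfold cnd Dr
  rw [show Rs (fun i => w i * h i) j σ = ∑ p : Fin n, if j ≤ p.1 then w (σ p) * h (σ p) else 0 from rfl,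
    Finset.sum_div]
  apply Finset.sum_congr rfl
  intro p _
  split_ifs with hp
  · simp [val, hj]; ring
  · simp

lemma Pr_mono {w : Fin n → ℝ} (hw : ∀ i, 0 < w i) {s t : Set (Equiv.Perm (Fin n))}
    (h : s ⊆ t) : Pr w s ≤ Pr w t := by
  apply Ex_mono hw
  intro σ
  exact Set.indicator_le_indicator_of_subset h (fun _ => zero_le_one) σ

lemma Pr_nonneg {w : Fin n → ℝ} (hw : ∀ i, 0 < w i) (s : Set (Equiv.Perm (Fin n))) :
    0 ≤ Pr w s := by
  have := Pr_mono hw (Set.empty_subset s)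
  simpa [Pr, Ex] using this

lemma Pr_union {w : Fin n → ℝ} (hw : ∀ i, 0 < w i) (s t : Set (Equiv.Perm (Fin n))) :
    Pr w (s ∪ t) ≤ Pr w s + Pr w t := by
  unfold Pr
  rw [← Ex_add]
  apply Ex_mono hw
  intro σ
  by_cases h1 : σ ∈ s <;> by_cases h2 : σ ∈ t <;> simp [Set.indicator, h1, h2]

lemma Pr_le_one {w : Fin n → ℝ} (hw : ∀ i, 0 < w i) (s : Set (Equiv.Perm (Fin n))) :
    Pr w s ≤ 1 := by
  rw [← Ex_const w hw 1]
  apply Ex_mono hw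
  intro σ
  by_cases h1 : σ ∈ s <;> simp [Set.indicator, h1]

/-- splitting an expectation along a bad event -/
lemma Ex_le_of_bad {w : Fin n → ℝ} (hw : ∀ i, 0 < w i) (s : Set (Equiv.Perm (Fin n)))
    (F : Equiv.Perm (Fin n) → ℝ) (a b : ℝ) (ha : 0 ≤ a) (h1 : ∀ σ ∉ s, F σ ≤ a) (h2 : ∀ σ, F σ ≤ b) :
    Ex w F ≤ a + b * Pr w s := by
  unfold Pr
  rw [← Ex_mul]
  have : Ex w (fun σ => a + b * s.indicator (fun _ => 1) σ) =
      a + Ex w (fun σ => b * s.indicator (fun _ => 1) σ) := by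
    rw [Ex_add, Ex_const w hw]
  rw [← this]
  apply Ex_mono hw
  intro σ
  by_cases h : σ ∈ s
  · simp [h]; linarith [h2 σ]
  · simp [h, h1 σ h]

lemma markov_exp {w : Fin n → ℝ} (hw : ∀ i, 0 < w i) (s : Set (Equiv.Perm (Fin n)))
    (F : Equiv.Perm (Fin n) → ℝ) (x : ℝ) (h : ∀ σ ∈ s, x ≤ F σ)
    (hE : Ex w (fun σ => Real.exp (F σ)) ≤ 1) : Pr w s ≤ Real.exp (-x) := by
  have : Real.exp x * Pr w s ≤ 1 := by
    refine le_trans ?_ hE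
    unfold Pr
    rw [← Ex_mul]
    apply Ex_mono hw
    intro σ
    by_cases hs : σ ∈ s
    · simp [hs, h σ hs]
    · simp [hs, Real.exp_nonneg]
  rw [Real.exp_neg, ← one_div, le_div_iff₀ (Real.exp_pos x)]
  linarith

end basic
end SB

namespace SB
section mart
variable {n : ℕ}

lemma DepOn.comp₂ {k : ℕ} {F G : Equiv.Perm (Fin n) → ℝ} (hF : DepOn k F) (hG : DepOn k G)
    (φ : ℝ → ℝ → ℝ) : DepOn k (fun σ => φ (F σ) (G σ)) := by
  intro σ τ h
  simp only [hF σ τ h, hG σ τ h]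

lemma DepOn.sum {ι : Type*} {k : ℕ} (s : Finset ι) {F : ι → Equiv.Perm (Fin n) → ℝ}
    (hF : ∀ i ∈ s, DepOn k (F i)) : DepOn k (fun σ => ∑ i ∈ s, F i σ) := by
  intro σ τ h
  exact Finset.sum_congr rfl fun i hi => hF i hi σ τ h

lemma exp_supermart {w : Fin n → ℝ} (hw : ∀ i, 0 < w i) (G : ℕ → Equiv.Perm (Fin n) → ℝ)
    (hdep : ∀ j, DepOn (j + 1) (G j))
    (hc : ∀ j (hj : j < n) σ, cnd w j hj (fun τ => Real.exp (G j τ)) σ ≤ 1)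
    (K : ℕ) (hK : K ≤ n) :
    Ex w (fun σ => Real.exp (∑ j ∈ Finset.range K, G j σ)) ≤ 1 := by
  have hd : ∀ K, DepOn K (fun σ => Real.exp (∑ j ∈ Finset.range K, G j σ)) := by
    intro K σ τ h
    have := DepOn.sum (k := K) (Finset.range K) (F := G)
      (fun j hj => (hdep j).mono (Finset.mem_range.1 hj)) σ τ h
    simp only at this ⊢
    rw [this]
  rw [Ex_dep w hw K hK _ (hd K)]
  induction K with
  | zero => simp [Ek_zero_const]
  | succ K ih =>
    refine le_trans ?_ (ih (by omega))
    rw [Ek_succ w K hK]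
    apply Ek_mono hw
    intro σ
    have h1 : cnd w K hK (fun σ => Real.exp (∑ j ∈ Finset.range (K + 1), G j σ)) σ =
        Real.exp (∑ j ∈ Finset.range K, G j σ) * cnd w K hK (fun τ => Real.exp (G K τ)) σ := by
      unfold cnd
      rw [Finset.mul_sum]
      apply Finset.sum_congr rfl
      intro p _
      split_ifs with hp
      · beta_reduce; rw [Finset.sum_range_succ, Real.exp_add]
        have := hd K _ σ (fun i hi => swap_pre K hK p hp σ i hi)
        simp only at this
        rw [this]; ring
      · simp
    rw [h1]
    exact mul_le_of_le_one_right (Real.exp_nonneg _) (hc K hK σ)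

lemma maximal {w : Fin n → ℝ} (hw : ∀ i, 0 < w i) (G : ℕ → Equiv.Perm (Fin n) → ℝ)
    (hdep : ∀ j, DepOn (j + 1) (G j))
    (hc : ∀ j (hj : j < n) σ, cnd w j hj (fun τ => Real.exp (G j τ)) σ ≤ 1)
    (K : ℕ) (hK : K ≤ n) (x : ℝ) :
    Pr w {σ | ∃ k ≤ K, x ≤ ∑ j ∈ Finset.range k, G j σ} ≤ Real.exp (-x) := by
  set stp : ℕ → Equiv.Perm (Fin n) → Prop := fun j σ =>
    ∃ k ≤ j, x ≤ ∑ i ∈ Finset.range k, G i σ with hstp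
  set G' : ℕ → Equiv.Perm (Fin n) → ℝ := fun j σ => if stp j σ then 0 else G j σ with hG'
  have hstpdep : ∀ j σ τ, (∀ i : Fin n, i.1 < j → σ i = τ i) → (stp j σ ↔ stp j τ) := by
    intro j σ τ h
    simp only [hstp]
    apply exists_congr
    intro k
    apply and_congr_right
    intro hk
    have := DepOn.sum (k := j) (Finset.range k) (F := G)
      (fun i hi => (hdep i).mono (by have := Finset.mem_range.1 hi; omega)) σ τ h
    simp only at this
    rw [this]
  have hdep' : ∀ j, DepOn (j + 1) (G' j) := by
    intro j σ τ h
    simp only [hG']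
    rw [if_congr (hstpdep j σ τ fun i hi => h i (by omega)) rfl rfl, hdep j σ τ h]
  have hc' : ∀ j (hj : j < n) σ, cnd w j hj (fun τ => Real.exp (G' j τ)) σ ≤ 1 := by
    intro j hj σ
    have e : ∀ F : Equiv.Perm (Fin n) → ℝ, (∀ p : Fin n, j ≤ p.1 →
        Real.exp (G' j (σ * Equiv.swap ⟨j, hj⟩ p)) = F (σ * Equiv.swap ⟨j, hj⟩ p)) →
        cnd w j hj (fun τ => Real.exp (G' j τ)) σ = cnd w j hj F σ := by
      intro F hF
      unfold cnd
      apply Finset.sum_congr rfl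
      intro p _
      split_ifs with hp
      · beta_reduce; rw [hF p hp]
      · rfl
    by_cases hs : stp j σ
    · rw [e (fun _ => 1), cnd_eq_of_dep w hw j hj _ (fun _ _ _ => rfl)]
      intro p hp
      simp only [hG']
      rw [if_pos ((hstpdep j _ σ fun i hi => swap_pre j hj p hp σ i hi).2 hs), Real.exp_zero]
    · rw [e (fun τ => Real.exp (G j τ))]
      · exact hc j hj σ
      intro p hp
      simp only [hG']
      rw [if_neg (fun h => hs ((hstpdep j _ σ fun i hi => swap_pre j hj p hp σ i hi).1 h))]
  refine markov_exp hw _ (fun σ => ∑ j ∈ Finset.range K, G' j σ) x ?_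
    (exp_supermart hw G' hdep' hc' K hK)
  intro σ hσ
  have hex : ∃ k, k ≤ K ∧ x ≤ ∑ j ∈ Finset.range k, G j σ := hσ
  have hk := Nat.find_spec hex
  have hmin := fun k => Nat.find_min hex (m := k)
  set k0 := Nat.find hex
  have h1 : ∑ j ∈ Finset.range K, G' j σ = ∑ j ∈ Finset.range k0, G j σ := by
    rw [← Finset.sum_subset (Finset.range_subset_range.2 hk.1)]
    · apply Finset.sum_congr rfl
      intro j hj
      simp only [hG']
      rw [if_neg]
      rintro ⟨k, hkj, hkx⟩
      have := Finset.mem_range.1 hj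
      exact hmin k (by omega) ⟨by omega, hkx⟩
    · intro j _ hj
      simp only [hG']
      rw [if_pos ⟨k0, by simpa using hj, hk.2⟩]
  rw [h1]; exact hk.2

lemma exp_le_quad {x : ℝ} (hx : |x| ≤ 1) : Real.exp x ≤ 1 + x + x ^ 2 := by
  have := Real.abs_exp_sub_one_sub_id_le hx
  have := (abs_le.1 this).2
  linarith

/-- The increments of the basic exponential supermartingale. -/
noncomputable def Gf (w : Fin n → ℝ) (f : ℕ → Fin n → ℝ) (j : ℕ) (σ : Equiv.Perm (Fin n)) : ℝ :=
  val (f j) j σ - Dr w (f j) j σ - Dr w (fun i => f j i ^ 2) j σ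

lemma Gf_dep (w : Fin n → ℝ) (f : ℕ → Fin n → ℝ) (j : ℕ) : DepOn (j + 1) (Gf w f j) := by
  intro σ τ h
  unfold Gf
  rw [val_dep _ j σ τ h, (Dr_dep w (f j) j).mono (Nat.le_succ j) σ τ h,
    (Dr_dep w (fun i => f j i ^ 2) j).mono (Nat.le_succ j) σ τ h]

lemma Gf_cnd {w : Fin n → ℝ} (hw : ∀ i, 0 < w i) (f : ℕ → Fin n → ℝ) (hf : ∀ j i, |f j i| ≤ 1)
    (j : ℕ) (hj : j < n) (σ : Equiv.Perm (Fin n)) :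
    cnd w j hj (fun τ => Real.exp (Gf w f j τ)) σ ≤ 1 := by
  set D := Dr w (f j) j σ with hD
  set V := Dr w (fun i => f j i ^ 2) j σ with hV
  have hR := Rs_pos hw hj σ
  have h1 : cnd w j hj (fun τ => Real.exp (Gf w f j τ)) σ ≤
      Real.exp (-(D + V)) * (1 + D + V) := by
    have h2 : (1 + D + V) = ∑ p : Fin n, if j ≤ p.1 then
        w (σ p) / Rs w j σ * (1 + f j (σ p) + f j (σ p) ^ 2) else 0 := by
      have : ∀ p : Fin n, (if j ≤ p.1 then
        w (σ p) / Rs w j σ * (1 + f j (σ p) + f j (σ p) ^ 2) else 0) =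
        ((if j ≤ p.1 then w (σ p) else 0) + (if j ≤ p.1 then w (σ p) * f j (σ p) else 0)
          + (if j ≤ p.1 then w (σ p) * f j (σ p) ^ 2 else 0)) / Rs w j σ := by
        intro p; split_ifs
        · ring
        · simp
      rw [Finset.sum_congr rfl fun p _ => this p, ← Finset.sum_div, Finset.sum_add_distrib,
        Finset.sum_add_distrib, hD, hV]
      unfold Dr
      change _ = (Rs w j σ + Rs (fun i => w i * f j i) j σ + Rs (fun i => w i * f j i ^ 2) j σ) / _
      field_simp
    rw [h2, Finset.mul_sum]
    unfold cnd
    apply Finset.sum_le_sum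
    intro p _
    split_ifs with hp
    · have hpre := fun i hi => swap_pre j hj p hp σ i hi
      have e1 : Gf w f j (σ * Equiv.swap ⟨j, hj⟩ p) = f j (σ p) + -(D + V) := by
        unfold Gf
        rw [Dr_dep w _ j _ σ hpre, Dr_dep w _ j _ σ hpre]
        simp only [val, hj, dif_pos, hD, hV, Equiv.Perm.mul_apply, Equiv.swap_apply_left]
        ring
      beta_reduce; rw [e1, Real.exp_add]
      have := exp_le_quad (hf j (σ p))
      have hwr : 0 ≤ w (σ p) / Rs w j σ := div_nonneg (hw _).le hR.le
      calc _ = (w (σ p) / Rs w j σ * Real.exp (-(D + V))) * Real.exp (f j (σ p)) := by ring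
        _ ≤ (w (σ p) / Rs w j σ * Real.exp (-(D + V))) * (1 + f j (σ p) + f j (σ p) ^ 2) :=
          mul_le_mul_of_nonneg_left this (mul_nonneg hwr (Real.exp_nonneg _))
        _ = _ := by ring
    · simp
  refine h1.trans ?_
  have := Real.add_one_le_exp (D + V)
  calc _ ≤ Real.exp (-(D + V)) * Real.exp (D + V) :=
        mul_le_mul_of_nonneg_left (by linarith) (Real.exp_nonneg _)
    _ = 1 := by rw [← Real.exp_add]; simp

lemma freed_max {w : Fin n → ℝ} (hw : ∀ i, 0 < w i) (f : ℕ → Fin n → ℝ)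
    (hf : ∀ j i, |f j i| ≤ 1) (K : ℕ) (hK : K ≤ n) (x : ℝ) :
    Pr w {σ | ∃ k ≤ K, x ≤ ∑ j ∈ Finset.range k, Gf w f j σ} ≤ Real.exp (-x) :=
  maximal hw _ (Gf_dep w f) (Gf_cnd hw f hf) K hK x

lemma freed_mean {w : Fin n → ℝ} (hw : ∀ i, 0 < w i) (f : ℕ → Fin n → ℝ)
    (hf : ∀ j i, |f j i| ≤ 1) (K : ℕ) (hK : K ≤ n) :
    Ex w (fun σ => Real.exp (∑ j ∈ Finset.range K, Gf w f j σ)) ≤ 1 :=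
  exp_supermart hw _ (Gf_dep w f) (Gf_cnd hw f hf) K hK

lemma Dr_nonneg {w : Fin n → ℝ} (hw : ∀ i, 0 < w i) {h : Fin n → ℝ} (hh : ∀ i, 0 ≤ h i) (j : ℕ)
    (σ : Equiv.Perm (Fin n)) : 0 ≤ Dr w h j σ :=
  div_nonneg (Rs_nonneg (fun i => mul_nonneg (hw i).le (hh i)) _ _)
    (Rs_nonneg (fun i => (hw i).le) _ _)

lemma Dr_mono {w : Fin n → ℝ} (hw : ∀ i, 0 < w i) {h g : Fin n → ℝ} (hh : ∀ i, h i ≤ g i) (j : ℕ)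
    (σ : Equiv.Perm (Fin n)) : Dr w h j σ ≤ Dr w g j σ :=
  div_le_div_of_nonneg_right (Rs_mono (fun i => mul_le_mul_of_nonneg_left (hh i) (hw i).le) _ _)
    (Rs_nonneg (fun i => (hw i).le) _ _)

lemma Dr_mul (w : Fin n → ℝ) (c : ℝ) (h : Fin n → ℝ) (j : ℕ)
    (σ : Equiv.Perm (Fin n)) : Dr w (fun i => c * h i) j σ = c * Dr w h j σ := by
  unfold Dr
  have : (fun i => w i * (c * h i)) = fun i => c * (w i * h i) := by funext i; ring
  rw [this, Rs_mul]; ring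

lemma Dr_le_const {w : Fin n → ℝ} (hw : ∀ i, 0 < w i) {h : Fin n → ℝ} {c : ℝ} (hc : 0 ≤ c)
    (hh : ∀ i, h i ≤ c) (j : ℕ)
    (σ : Equiv.Perm (Fin n)) : Dr w h j σ ≤ c := by
  refine (Dr_mono hw hh j σ).trans ?_
  unfold Dr
  have : (fun i => w i * c) = fun i => c * w i := by funext i; ring
  rw [this, Rs_mul]
  by_cases hz : Rs w j σ = 0
  · simp [hz, hc]
  · field_simp; exact le_rfl

/-- The compensated sum of `f` over the steps in `J` before `k`. -/
noncomputable def Mt (w f : Fin n → ℝ) (J : ℕ → Prop) (k : ℕ) (σ : Equiv.Perm (Fin n)) : ℝ :=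
  ∑ j ∈ Finset.range k, if J j then val f j σ - Dr w f j σ else 0

lemma Gf_ite (w f : Fin n → ℝ) (J : ℕ → Prop) (c : ℝ) (j : ℕ) (σ : Equiv.Perm (Fin n)) :
    Gf w (fun j i => if J j then c * f i else 0) j σ =
      if J j then c * (val f j σ - Dr w f j σ) - c ^ 2 * Dr w (fun i => f i ^ 2) j σ else 0 := by
  unfold Gf
  by_cases h : J j
  · simp only [if_pos h]
    rw [val_mul, Dr_mul]
    have : (fun i => (c * f i) ^ 2) = fun i => c ^ 2 * f i ^ 2 := by funext i; ring
    rw [this, Dr_mul]; ring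
  · simp only [if_neg h]
    simp [val, Dr, Rs]

/-- One-sided bound, with `c = ± lam`. -/
lemma one_sided {w : Fin n → ℝ} (hw : ∀ i, 0 < w i) (f : Fin n → ℝ) (J : ℕ → Prop) (c : ℝ)
    (hcf : ∀ i, |c * f i| ≤ 1) (K : ℕ) (hK : K ≤ n) (v : ℝ)
    (hv : ∀ σ, ∑ j ∈ Finset.range K, (if J j then Dr w (fun i => f i ^ 2) j σ else 0) ≤ v) (x : ℝ) :
    Pr w {σ | ∃ k ≤ K, x ≤ c * Mt w f J k σ} ≤ Real.exp (-(x - c ^ 2 * v)) := by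
  refine (Pr_mono hw ?_).trans (freed_max hw (fun j i => if J j then c * f i else 0) ?_ K hK _)
  · rintro σ ⟨k, hk, hx⟩
    refine ⟨k, hk, ?_⟩
    simp_rw [Gf_ite]
    have h1 : ∑ j ∈ Finset.range k, (if J j then Dr w (fun i => f i ^ 2) j σ else 0) ≤ v := by
      refine le_trans ?_ (hv σ)
      apply Finset.sum_le_sum_of_subset_of_nonneg (Finset.range_subset_range.2 hk)
      intro j _ _
      split_ifs
      · exact Dr_nonneg hw (fun i => sq_nonneg _) _ _
      · exact le_rfl
    have h2 : ∑ j ∈ Finset.range k, (if J j then c * (val f j σ - Dr w f j σ) -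
        c ^ 2 * Dr w (fun i => f i ^ 2) j σ else 0) = c * Mt w f J k σ - c ^ 2 *
        ∑ j ∈ Finset.range k, (if J j then Dr w (fun i => f i ^ 2) j σ else 0) := by
      unfold Mt
      rw [Finset.mul_sum, Finset.mul_sum, ← Finset.sum_sub_distrib]
      apply Finset.sum_congr rfl
      intro j _
      split_ifs <;> simp
    rw [h2]
    have := mul_le_mul_of_nonneg_left h1 (sq_nonneg c)
    linarith
  · intro j i
    beta_reduce
    split_ifs
    · exact hcf i
    · simp

lemma two_sided {w : Fin n → ℝ} (hw : ∀ i, 0 < w i) (f : Fin n → ℝ) (J : ℕ → Prop) (c : ℝ)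
    (hc : 0 < c)
    (hcf : ∀ i, |c * f i| ≤ 1) (K : ℕ) (hK : K ≤ n) (v : ℝ)
    (hv : ∀ σ, ∑ j ∈ Finset.range K, (if J j then Dr w (fun i => f i ^ 2) j σ else 0) ≤ v) (u : ℝ) :
    Pr w {σ | ∃ k ≤ K, u ≤ |Mt w f J k σ|} ≤ 2 * Real.exp (-(c * u - c ^ 2 * v)) := by
  have h1 := one_sided hw f J c hcf K hK v hv (c * u)
  have h2 := one_sided hw f J (-c) (by intro i; rw [neg_mul, abs_neg]; exact hcf i) K hK v hv (c * u)
  rw [neg_sq] at h2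
  have : {σ | ∃ k ≤ K, u ≤ |Mt w f J k σ|} ⊆ {σ | ∃ k ≤ K, c * u ≤ c * Mt w f J k σ} ∪
      {σ | ∃ k ≤ K, c * u ≤ -c * Mt w f J k σ} := by
    rintro σ ⟨k, hk, hu⟩
    rcases le_abs.1 hu with h | h
    · left; exact ⟨k, hk, mul_le_mul_of_nonneg_left h hc.le⟩
    · right; refine ⟨k, hk, ?_⟩
      have := mul_le_mul_of_nonneg_left h hc.le
      linarith
  have := (Pr_mono hw this).trans (Pr_union hw _ _)
  linarith

lemma mean_abs {w : Fin n → ℝ} (hw : ∀ i, 0 < w i) (f : Fin n → ℝ) (J : ℕ → Prop) (c : ℝ)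
    (hc : 0 < c)
    (hcf : ∀ i, |c * f i| ≤ 1) (K : ℕ) (hK : K ≤ n) (v : ℝ)
    (hv : ∀ σ, ∑ j ∈ Finset.range K, (if J j then Dr w (fun i => f i ^ 2) j σ else 0) ≤ v) :
    Ex w (fun σ => |Mt w f J K σ|) ≤ c * v + 2 / c := by
  have key : ∀ e : ℝ, |e| = c → Ex w (fun σ => Real.exp (e * Mt w f J K σ - c ^ 2 * v)) ≤ 1 := by
    intro e he
    have he2 : e ^ 2 = c ^ 2 := by rw [← he, sq_abs]
    refine le_trans (Ex_mono hw ?_) (freed_mean hw (fun j i => if J j then e * f i else 0) ?_ K hK)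
    · intro σ
      rw [Real.exp_le_exp]
      simp_rw [Gf_ite]
      have h2 : ∑ j ∈ Finset.range K, (if J j then e * (val f j σ - Dr w f j σ) -
          e ^ 2 * Dr w (fun i => f i ^ 2) j σ else 0) = e * Mt w f J K σ - e ^ 2 *
          ∑ j ∈ Finset.range K, (if J j then Dr w (fun i => f i ^ 2) j σ else 0) := by
        unfold Mt
        rw [Finset.mul_sum, Finset.mul_sum, ← Finset.sum_sub_distrib]
        apply Finset.sum_congr rfl
        intro j _
        split_ifs <;> simp
      rw [h2, he2]
      have := mul_le_mul_of_nonneg_left (hv σ) (sq_nonneg c)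
      linarith
    · intro j i
      beta_reduce
      split_ifs
      · rw [abs_mul, he]; have := hcf i; rwa [abs_mul, abs_of_pos hc] at this
      · simp
  have h1 := key c (abs_of_pos hc)
  have h2 := key (-c) (by rw [abs_neg, abs_of_pos hc])
  have h3 : Ex w (fun σ => |Mt w f J K σ|) ≤ Ex w (fun σ => c * v + c⁻¹ *
      (Real.exp (c * Mt w f J K σ - c ^ 2 * v) + Real.exp (-c * Mt w f J K σ - c ^ 2 * v))) := by
    apply Ex_mono hw
    intro σ
    have e1 := Real.add_one_le_exp (c * Mt w f J K σ - c ^ 2 * v)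
    have e2 := Real.add_one_le_exp (-c * Mt w f J K σ - c ^ 2 * v)
    have p1 := Real.exp_pos (c * Mt w f J K σ - c ^ 2 * v)
    have p2 := Real.exp_pos (-c * Mt w f J K σ - c ^ 2 * v)
    have : c * |Mt w f J K σ| ≤ c * (c * v) +
      (Real.exp (c * Mt w f J K σ - c ^ 2 * v) + Real.exp (-c * Mt w f J K σ - c ^ 2 * v)) := by
      rcases abs_cases (Mt w f J K σ) with ⟨h, _⟩ | ⟨h, _⟩ <;> rw [h] <;> nlinarith
    calc |Mt w f J K σ| = c⁻¹ * (c * |Mt w f J K σ|) := by field_simp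
      _ ≤ c⁻¹ * (c * (c * v) + (Real.exp (c * Mt w f J K σ - c ^ 2 * v) +
          Real.exp (-c * Mt w f J K σ - c ^ 2 * v))) :=
          mul_le_mul_of_nonneg_left this (by positivity)
      _ = _ := by field_simp
  refine h3.trans ?_
  rw [Ex_add, Ex_const w hw, Ex_mul, Ex_add]
  have : c⁻¹ * (Ex w (fun σ => Real.exp (c * Mt w f J K σ - c ^ 2 * v)) +
    Ex w (fun σ => Real.exp (-c * Mt w f J K σ - c ^ 2 * v))) ≤ c⁻¹ * 2 :=
      mul_le_mul_of_nonneg_left (by linarith) (by positivity)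
  rw [div_eq_inv_mul]
  linarith

lemma Ex_Mt {w : Fin n → ℝ} (hw : ∀ i, 0 < w i) (f : Fin n → ℝ) (J : ℕ → Prop) (K : ℕ)
    (hK : K ≤ n) : Ex w (Mt w f J K) = 0 := by
  unfold Mt
  rw [Ex_sum]
  apply Finset.sum_eq_zero
  intro j hj
  have hj := Finset.mem_range.1 hj
  by_cases h : J j
  · simp only [if_pos h]
    rw [Ex_sub, Ex_val w hw f j (by omega), sub_self]
  · simp only [if_neg h]
    rw [Ex_const w hw]

end mart
end SB

namespace SB
section facts
variable {w : ∀ n : ℕ, Fin n → ℝ} {μ : Measure ℝ}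

lemma asymp_aux {f : ℕ → ℝ} {c : ℝ} {p : ℝ} (hp : p < 1)
    (h : (fun n : ℕ => f n - c * (n : ℝ)) =o[atTop] fun n : ℕ => (n : ℝ) ^ p) :
    Tendsto (fun n : ℕ => f n / (n : ℝ)) atTop (𝓝 c) := by
  have h1 : (fun n : ℕ => f n - c * (n : ℝ)) =o[atTop] fun n : ℕ => (n : ℝ) := by
    refine h.trans_isBigO ?_
    refine IsBigO.of_bound 1 ?_
    filter_upwards [eventually_ge_atTop 1] with n hn
    have : (1 : ℝ) ≤ n := by exact_mod_cast hn
    rw [one_mul, Real.norm_of_nonneg (by positivity), Real.norm_of_nonneg (by positivity)]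
    calc (n : ℝ) ^ p ≤ (n : ℝ) ^ (1 : ℝ) := Real.rpow_le_rpow_of_exponent_le this hp.le
      _ = n := Real.rpow_one _
  have h2 := h1.tendsto_div_nhds_zero
  have h3 : Tendsto (fun n : ℕ => (f n - c * (n : ℝ)) / n + c) atTop (𝓝 (0 + c)) :=
    h2.add tendsto_const_nhds
  rw [zero_add] at h3
  refine h3.congr' ?_
  filter_upwards [eventually_ge_atTop 1] with n hn
  have : (0 : ℝ) < n := by exact_mod_cast hn
  field_simp; ring

lemma int_pow (hC : CondC w μ) : Integrable (fun x : ℝ => x) μ := by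
  have := hC.isProb
  refine Integrable.mono' (hC.int3.add (integrable_const 1)) (by fun_prop) ?_
  filter_upwards [hC.pos] with x hx
  simp only [Pi.add_apply]
  rw [Real.norm_of_nonneg hx.le]
  nlinarith [sq_nonneg (x - 1), sq_nonneg (x+1), mul_nonneg hx.le (sq_nonneg (x - 1))]

lemma E1_pos (hC : CondC w μ) : 0 < ∫ x, x ∂μ := by
  have := hC.isProb
  rw [integral_pos_iff_support_of_nonneg_ae (hC.pos.mono fun x hx => hx.le) (int_pow hC)]
  have : μ (Function.support fun x : ℝ => x)ᶜ = 0 := by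
    rw [← mem_ae_iff]
    filter_upwards [hC.pos] with x hx
    exact hx.ne'
  rw [prob_compl_eq_zero_iff (measurableSet_support (f := fun x : ℝ => x) measurable_id)] at this
  have h2 : μ (Function.support fun x : ℝ => x) = 1 := this
  rw [h2]; simp

lemma fact1 (hC : CondC w μ) : ∃ c0 > (0 : ℝ), ∃ C0 ≥ (1 : ℝ), c0 ≤ 1 ∧ ∀ᶠ n : ℕ in atTop,
    c0 * n ≤ ∑ i, w n i ∧ ∑ i, w n i ≤ C0 * n ∧ ∑ i, w n i ^ 2 ≤ C0 * n ∧
    ∑ i, w n i ^ 3 ≤ C0 * n := by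
  have h1 := asymp_aux (by norm_num) hC.ell_asymp
  have h2 := asymp_aux (by norm_num) hC.sq_asymp
  have h3 : Tendsto (fun n : ℕ => (∑ i, w n i ^ 3) / (n : ℝ)) atTop (𝓝 (∫ x, x ^ 3 ∂μ)) := by
    refine asymp_aux (p := 0) (by norm_num) ?_
    simpa using hC.cube_asymp
  have hE := E1_pos hC
  set E1 := ∫ x, x ∂μ
  set E2 := ∫ x, x ^ 2 ∂μ
  set E3 := ∫ x, x ^ 3 ∂μ
  refine ⟨min 1 (E1 / 2), by positivity, max 1 (max (E1 + 1) (max (E2 + 1) (E3 + 1))), le_max_left _ _,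
    min_le_left _ _, ?_⟩
  filter_upwards [h1.eventually (lt_mem_nhds (show E1 / 2 < E1 by linarith)),
    h1.eventually (gt_mem_nhds (show E1 < E1 + 1 by linarith)),
    h2.eventually (gt_mem_nhds (show E2 < E2 + 1 by linarith)),
    h3.eventually (gt_mem_nhds (show E3 < E3 + 1 by linarith)), eventually_ge_atTop 1] with n a1 a2 a3 a4 hn
  have hn' : (0 : ℝ) < n := by exact_mod_cast hn
  rw [lt_div_iff₀ hn'] at a1
  rw [div_lt_iff₀ hn'] at a2 a3 a4
  have e1 : min 1 (E1 / 2) ≤ E1 / 2 := min_le_right _ _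
  refine ⟨(mul_le_mul_of_nonneg_right e1 hn'.le).trans a1.le, a2.le.trans ?_, a3.le.trans ?_, a4.le.trans ?_⟩
  all_goals apply mul_le_mul_of_nonneg_right _ hn'.le
  · simp
  · simp
  · simp

lemma fact3 (hC : CondC w μ) (δ : ℝ) (hδ : 0 < δ) : ∀ᶠ n : ℕ in atTop,
    ∀ i, w n i ≤ δ * (n : ℝ) ^ ((1 : ℝ) / 3) := by
  filter_upwards [hC.max_asymp.bound hδ] with n hn i
  rw [Real.norm_of_nonneg (show (0:ℝ) ≤ (n : ℝ) ^ ((1 : ℝ) / 3) by positivity)] at hn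
  refine le_trans ?_ ((le_abs_self _).trans hn)
  exact le_ciSup (f := fun i => w n i) (Set.finite_range _).bddAbove i

noncomputable def truncF (R : ℝ) (hR : 0 ≤ R) : BoundedContinuousFunction ℝ ℝ :=
  BoundedContinuousFunction.ofNormedAddCommGroup (fun x : ℝ => (min (max x 0) R) ^ 3)
    (by fun_prop) (R ^ 3) (by
      intro x
      have h0 : 0 ≤ min (max x 0) R := le_min (le_max_right _ _) hR
      rw [Real.norm_of_nonneg (by positivity)]
      exact pow_le_pow_left₀ h0 (min_le_right _ _) 3)

lemma truncF_apply (R : ℝ) (hR : 0 ≤ R) (x : ℝ) : truncF R hR x = (min (max x 0) R) ^ 3 := rfl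

lemma fact2 (hC : CondC w μ) (η : ℝ) (hη : 0 < η) : ∃ R ≥ (1 : ℝ), ∀ᶠ n : ℕ in atTop,
    ∑ i, (if R < w n i then w n i ^ 3 else 0) ≤ η * n := by
  have := hC.isProb
  have h3 : Tendsto (fun n : ℕ => (∑ i, w n i ^ 3) / (n : ℝ)) atTop (𝓝 (∫ x, x ^ 3 ∂μ)) := by
    refine asymp_aux (p := 0) (by norm_num) ?_
    simpa using hC.cube_asymp
  have hlim : Tendsto (fun k : ℕ => ∫ x, truncF (k : ℝ) (Nat.cast_nonneg k) x ∂μ) atTop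
      (𝓝 (∫ x, x ^ 3 ∂μ)) := by
    apply tendsto_integral_of_dominated_convergence (fun x => |x ^ 3|)
    · intro k
      exact (truncF (k : ℝ) (Nat.cast_nonneg k)).continuous.aestronglyMeasurable
    · exact hC.int3.abs
    · intro k
      filter_upwards [hC.pos] with x hx
      rw [truncF_apply, max_eq_left hx.le]
      have h0 : 0 ≤ min x (k : ℝ) := le_min hx.le (Nat.cast_nonneg k)
      rw [Real.norm_of_nonneg (by positivity), abs_of_nonneg (by positivity)]
      exact pow_le_pow_left₀ h0 (min_le_left _ _) 3
    · filter_upwards [hC.pos] with x hx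
      refine tendsto_const_nhds.congr' ?_
      filter_upwards [eventually_ge_atTop (⌈x⌉₊)] with k hk
      have : x ≤ k := (Nat.le_ceil x).trans (by exact_mod_cast hk)
      rw [truncF_apply, max_eq_left hx.le, min_eq_left this]
  obtain ⟨k, hk1, hk⟩ := ((eventually_ge_atTop 1).and (hlim.eventually
    (lt_mem_nhds (show (∫ x, x ^ 3 ∂μ) - η / 4 < _ by linarith)))).exists
  set E3 := ∫ x, x ^ 3 ∂μ
  have hk1' : (1 : ℝ) ≤ k := by exact_mod_cast hk1
  refine ⟨2 * k, by linarith, ?_⟩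
  filter_upwards [h3.eventually (gt_mem_nhds (show E3 < E3 + η / 4 by linarith)),
    (hC.weak (truncF (k : ℝ) (Nat.cast_nonneg k))).eventually (lt_mem_nhds hk),
    eventually_ge_atTop 1] with n a1 a2 hn
  have hn' : (0 : ℝ) < n := by exact_mod_cast hn
  rw [div_lt_iff₀ hn'] at a1
  rw [lt_div_iff₀ hn'] at a2
  have key : ∑ i, (if 2 * (k : ℝ) < w n i then w n i ^ 3 else 0) ≤
      2 * (∑ i, w n i ^ 3 - ∑ i, truncF (k : ℝ) (Nat.cast_nonneg k) (w n i)) := by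
    rw [← Finset.sum_sub_distrib, Finset.mul_sum]
    apply Finset.sum_le_sum
    intro i _
    have hwp := hC.w_pos n i
    rw [truncF_apply, max_eq_left hwp.le]
    split_ifs with h
    · rw [min_eq_right (by linarith)]
      have : (2 * (k : ℝ)) ^ 3 ≤ w n i ^ 3 := pow_le_pow_left₀ (by positivity) h.le 3
      have : 0 ≤ (k : ℝ) ^ 3 := by positivity
      nlinarith
    · have h0 : 0 ≤ min (w n i) (k : ℝ) := le_min hwp.le (Nat.cast_nonneg k)
      have := pow_le_pow_left₀ h0 (min_le_left (w n i) (k : ℝ)) 3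
      linarith
  refine key.trans ?_
  nlinarith

lemma fact4 (hC : CondC w μ) (θ : ℝ) (hθ : 0 < θ) : ∃ ε > (0 : ℝ), ∀ᶠ n : ℕ in atTop,
    ∀ s : Finset (Fin n), (s.card : ℝ) ≤ ε * n → ∑ i ∈ s, w n i ≤ θ * n ∧
      ∑ i ∈ s, w n i ^ 2 ≤ θ * n := by
  obtain ⟨c0, hc0, C0, hC0, -, hf⟩ := fact1 hC
  set R : ℝ := max 1 (2 * C0 / θ) with hR
  have hR1 : 1 ≤ R := le_max_left _ _
  have hRθ : C0 ≤ θ / 2 * R := by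
    have : 2 * C0 / θ ≤ R := le_max_right _ _
    rw [div_le_iff₀ hθ] at this; linarith
  refine ⟨θ / (2 * R ^ 2), by positivity, ?_⟩
  filter_upwards [hf, eventually_ge_atTop 1] with n ⟨_, _, _, h3⟩ hn s hs
  have hn' : (0 : ℝ) < n := by exact_mod_cast hn
  have h3s : ∑ i ∈ s, w n i ^ 3 ≤ C0 * n := by
    refine le_trans (Finset.sum_le_univ_sum_of_nonneg ?_) h3
    intro i; have := hC.w_pos n i; positivity
  have key : R ^ 2 * s.card + (∑ i ∈ s, w n i ^ 3) / R ≤ θ * n := by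
    have e1 : R ^ 2 * s.card ≤ θ / 2 * n := by
      calc R ^ 2 * s.card ≤ R ^ 2 * (θ / (2 * R ^ 2) * n) := by gcongr
        _ = _ := by field_simp
    have e2 : (∑ i ∈ s, w n i ^ 3) / R ≤ θ / 2 * n := by
      rw [div_le_iff₀ (by positivity)]
      nlinarith
    linarith
  have aux : ∀ f : Fin n → ℝ, (∀ i, f i ≤ R ^ 2 + w n i ^ 3 / R) → ∑ i ∈ s, f i ≤ θ * n := by
    intro f hf
    refine le_trans (Finset.sum_le_sum fun i _ => hf i) (le_trans (le_of_eq ?_) key)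
    rw [Finset.sum_add_distrib, Finset.sum_div]; simp [mul_comm]
  have hp : ∀ i, w n i ^ 2 ≤ R ^ 2 + w n i ^ 3 / R := by
    intro i
    have := hC.w_pos n i
    rcases le_or_gt (w n i) R with h | h
    · have : 0 ≤ w n i ^ 3 / R := by positivity
      nlinarith
    · have : w n i ^ 2 ≤ w n i ^ 3 / R := by
        rw [le_div_iff₀ (by positivity)]; nlinarith [sq_nonneg (w n i)]
      nlinarith
  refine ⟨aux _ ?_, aux _ hp⟩
  intro i
  have := hC.w_pos n i
  rcases le_or_gt (w n i) R with h | h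
  · have : 0 ≤ w n i ^ 3 / R := by positivity
    nlinarith
  · refine le_trans ?_ (hp i)
    nlinarith

end facts
end SB

namespace SB
section bridge
variable {n : ℕ}

/-- Partial sums along the order. -/
noncomputable def Sm (h : Fin n → ℝ) (k : ℕ) (σ : Equiv.Perm (Fin n)) : ℝ :=
  ∑ p ∈ Finset.range k, val h p σ

/-- centred window sum -/
noncomputable def Dev (w : Fin n → ℝ) (L k : ℕ) (σ : Equiv.Perm (Fin n)) : ℝ :=
  (Sm w k σ - Sm w L σ) - Ex w (fun τ => Sm w k τ - Sm w L τ)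

lemma prod_eq_prk (w : Fin n → ℝ) (σ : Equiv.Perm (Fin n)) :
    (∏ i : Fin n, w (σ i) / ((∑ k, w k) - ∑ k ∈ Finset.univ.filter fun k => k < i, w (σ k)))
      = prk w n σ := by
  unfold prk
  rw [Finset.prod_range]
  apply Finset.prod_congr rfl
  intro i _
  have h1 : val w i.1 σ = w (σ i) := by simp [val, i.2]
  have h2 : (∑ k, w k) - ∑ k ∈ Finset.univ.filter (fun k => k < i), w (σ k) = Rs w i.1 σ := by
    rw [← Equiv.sum_comp σ w, Finset.sum_filter, ← Finset.sum_sub_distrib]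
    unfold Rs
    apply Finset.sum_congr rfl
    intro k _
    by_cases hk : k < i
    · rw [if_pos hk, if_neg (by rw [not_le]; exact hk), sub_self]
    · rw [if_neg hk, if_pos (by simpa using hk), sub_zero]
  rw [h1, h2]

lemma bridge_meas {w : Fin n → ℝ} (hw : ∀ i, 0 < w i) (s : Set (Fin n → Fin n)) :
    sbMeasure n w s = ENNReal.ofReal (Pr w {σ | ⇑σ ∈ s}) := by
  have hs : MeasurableSet s := s.toFinite.measurableSet
  unfold sbMeasure
  rw [Measure.sum_apply _ hs, tsum_fintype]
  unfold Pr Ex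
  rw [ENNReal.ofReal_sum_of_nonneg]
  · apply Finset.sum_congr rfl
    intro σ _
    rw [prod_eq_prk, Measure.smul_apply, Measure.dirac_apply' _ hs, smul_eq_mul]
    by_cases h : ⇑σ ∈ s
    · have h' : σ ∈ {σ : Equiv.Perm (Fin n) | ⇑σ ∈ s} := h
      rw [Set.indicator_of_mem h, Set.indicator_of_mem h']; simp
    · have h' : σ ∉ {σ : Equiv.Perm (Fin n) | ⇑σ ∈ s} := h
      rw [Set.indicator_of_notMem h, Set.indicator_of_notMem h']; simp
  · intro σ _
    exact mul_nonneg (prk_nonneg hw n σ) (Set.indicator_nonneg (fun _ _ => zero_le_one) _)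

lemma bridge_int {w : Fin n → ℝ} (hw : ∀ i, 0 < w i) (F : (Fin n → Fin n) → ℝ) :
    ∫ ω, F ω ∂sbMeasure n w = Ex w (fun σ => F ⇑σ) := by
  unfold sbMeasure
  rw [Measure.sum_fintype]
  rw [integral_finset_sum_measure]
  · unfold Ex
    apply Finset.sum_congr rfl
    intro σ _
    rw [prod_eq_prk, integral_smul_measure, integral_dirac, ENNReal.toReal_ofReal (prk_nonneg hw n σ),
      smul_eq_mul]
  · intro σ _
    exact (integrable_dirac (by finiteness)).smul_measure ENNReal.ofReal_ne_top

lemma sbW_eq (w : Fin n → ℝ) (σ : Equiv.Perm (Fin n)) (k : ℕ) : sbW w ⇑σ (k + 1) = val w k σ := by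
  simp [sbW, val]

lemma sum_sbW (w : Fin n → ℝ) (σ : Equiv.Perm (Fin n)) (i j : ℕ) (hi : 1 ≤ i) (hij : i ≤ j) :
    ∑ k ∈ Finset.Icc i j, sbW w ⇑σ k = Sm w j σ - Sm w (i - 1) σ := by
  unfold Sm
  rw [← Finset.sum_Ico_eq_sub _ (by omega : i - 1 ≤ j), ← Finset.Ico_add_one_right_eq_Icc]
  obtain ⟨a, rfl⟩ : ∃ a, i = a + 1 := ⟨i - 1, by omega⟩
  rw [← Finset.sum_Ico_add' (fun k => sbW w ⇑σ k) a j 1]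
  simp [sbW_eq]

lemma reduce {w : Fin n → ℝ} (hw : ∀ i, 0 < w i) (l m : ℕ) (hl : 1 ≤ l) (y B : ℝ)
    (h : Pr w {σ | ∃ k, l - 1 ≤ k ∧ k ≤ m ∧ y / 2 ≤ |Dev w (l - 1) k σ|} ≤ B) :
    sbMeasure n w {ω : Fin n → Fin n | ∃ i j : ℕ, l ≤ i ∧ i ≤ j ∧ j ≤ m ∧
            y ≤ |(∑ k ∈ Finset.Icc i j, sbW w ω k) -
                ∫ ω', ∑ k ∈ Finset.Icc i j, sbW w ω' k ∂sbMeasure n w|} ≤ ENNReal.ofReal B := by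
  rw [bridge_meas hw]
  apply ENNReal.ofReal_le_ofReal
  refine le_trans (Pr_mono hw ?_) h
  rintro σ ⟨i, j, hli, hij, hjm, hy⟩
  rw [bridge_int hw, sum_sbW w σ i j (by omega) hij] at hy
  simp_rw [sum_sbW w _ i j (by omega) hij] at hy
  by_contra hcon
  simp only [Set.mem_setOf_eq, not_exists, not_and, not_le] at hcon
  have h1 := hcon j (by omega) hjm
  have h2 := hcon (i - 1) (by omega) (by omega)
  have e : Sm w j σ - Sm w (i - 1) σ - Ex w (fun τ => Sm w j τ - Sm w (i - 1) τ) =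
      Dev w (l - 1) j σ - Dev w (l - 1) (i - 1) σ := by
    unfold Dev
    simp only [Ex_sub]; ring
  rw [e] at hy
  have := abs_sub (Dev w (l - 1) j σ) (Dev w (l - 1) (i - 1) σ)
  linarith

end bridge
end SB

namespace SB
section thmA
variable {n : ℕ}

lemma Sm_set (k : ℕ) (σ : Equiv.Perm (Fin n)) : ∃ s : Finset (Fin n), s.card ≤ k ∧
    ∀ h : Fin n → ℝ, Sm h k σ = ∑ i ∈ s, h i := by
  refine ⟨(Finset.univ.filter fun p : Fin n => p.1 < k).map σ.toEmbedding, ?_, ?_⟩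
  · rw [Finset.card_map]
    have : (Finset.univ.filter fun p : Fin n => p.1 < k).card ≤ (Finset.range k).card := by
      apply Finset.card_le_card_of_injOn (fun p => p.1)
      · intro p hp; simpa using hp
      · intro p _ q _ h; exact Fin.ext h
    simpa using this
  · intro h
    rw [Finset.sum_map, Finset.sum_filter]
    unfold Sm
    have e : ∀ p ∈ Finset.range k, val h p σ = ∑ q : Fin n, if q.1 = p then h (σ q) else 0 := by
      intro p _
      unfold val
      split_ifs with hp
      · rw [Finset.sum_eq_single ⟨p, hp⟩]
        · simp
        · intro b _ hb
          rw [if_neg]; rintro rfl; exact hb rfl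
        · simp
      · symm
        apply Finset.sum_eq_zero
        intro q _
        rw [if_neg]; rintro rfl; exact hp q.2
    rw [Finset.sum_congr rfl e, Finset.sum_comm]
    apply Finset.sum_congr rfl
    intro q _
    simp

lemma Sm_nonneg {h : Fin n → ℝ} (hh : ∀ i, 0 ≤ h i) (k : ℕ) (σ : Equiv.Perm (Fin n)) :
    0 ≤ Sm h k σ := Finset.sum_nonneg fun p _ => val_nonneg hh p σ

lemma Sm_mono {h g : Fin n → ℝ} (hh : ∀ i, h i ≤ g i) (k : ℕ) (σ : Equiv.Perm (Fin n)) :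
    Sm h k σ ≤ Sm g k σ := Finset.sum_le_sum fun p _ => val_mono hh p σ

lemma Sm_add (h g : Fin n → ℝ) (k : ℕ) (σ : Equiv.Perm (Fin n)) :
    Sm (fun i => h i + g i) k σ = Sm h k σ + Sm g k σ := by
  unfold Sm
  rw [← Finset.sum_add_distrib]
  exact Finset.sum_congr rfl fun p _ => val_add h g p σ

lemma Sm_le_sum {h : Fin n → ℝ} (hh : ∀ i, 0 ≤ h i) (k : ℕ) (σ : Equiv.Perm (Fin n)) :
    Sm h k σ ≤ ∑ i, h i := by
  obtain ⟨s, -, hs⟩ := Sm_set k σ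
  rw [hs]; exact Finset.sum_le_univ_sum_of_nonneg hh

lemma Rs_eq (h : Fin n → ℝ) (k : ℕ) (hk : k ≤ n) (σ : Equiv.Perm (Fin n)) :
    Rs h k σ = (∑ i, h i) - Sm h k σ := by
  have := Rs_add_pre h k hk σ
  unfold Sm; linarith

lemma Mt_true (w f : Fin n → ℝ) (k : ℕ) (σ : Equiv.Perm (Fin n)) :
    Sm f k σ = Mt w f (fun _ => True) k σ + ∑ j ∈ Finset.range k, Dr w f j σ := by
  unfold Sm Mt
  rw [← Finset.sum_add_distrib]
  apply Finset.sum_congr rfl; intro j _; simp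

lemma trunc_drift {w : Fin n → ℝ} (hw : ∀ i, 0 < w i) {h : Fin n → ℝ} {H b s0 : ℝ} (hH : 0 ≤ H)
    (h0 : ∀ i, 0 ≤ h i) (hh : ∀ i, h i ≤ H) (hb : 0 < b) {m : ℕ} (hm : m ≤ n)
    (hRs : ∀ j < m, ∀ σ, b ≤ Rs w j σ) (hS : ∀ j < m, ∀ σ, Sm w j σ ≤ s0) (j : ℕ) (hj : j < m)
    (σ : Equiv.Perm (Fin n)) :
    |Dr w h j σ - (∑ i, w i * h i) / ∑ i, w i| ≤ 2 * H * s0 / b := by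
  set l := ∑ i, w i with hl
  set q := ∑ i, w i * h i with hq
  have hR := hRs j hj σ
  have e1 := Rs_eq w j (by omega) σ
  have e2 := Rs_eq (fun i => w i * h i) j (by omega) σ
  have hlpos : 0 < l := by
    have := Sm_nonneg (fun i => (hw i).le) j σ
    linarith
  have hk0 : 0 ≤ q / l := div_nonneg (Finset.sum_nonneg fun i _ => mul_nonneg (hw i).le (h0 i)) hlpos.le
  have hkH : q / l ≤ H := by
    rw [div_le_iff₀ hlpos, hl, Finset.mul_sum]
    exact Finset.sum_le_sum fun i _ => by nlinarith [hw i, hh i]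
  have hSw0 := Sm_nonneg (fun i => (hw i).le) j σ
  have hSh0 := Sm_nonneg (fun i => mul_nonneg (hw i).le (h0 i)) j σ
  have hSh : Sm (fun i => w i * h i) j σ ≤ H * Sm w j σ := by
    obtain ⟨s, -, hs⟩ := Sm_set j σ
    rw [hs, hs, Finset.mul_sum]
    exact Finset.sum_le_sum fun i _ => by nlinarith [hw i, hh i]
  have e3 : Dr w h j σ - q / l = ((q / l) * Sm w j σ - Sm (fun i => w i * h i) j σ) / Rs w j σ := by
    unfold Dr
    rw [e2, eq_div_iff (by linarith), sub_mul, div_mul_cancel₀ _ (by linarith), e1]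
    have : q / l * l = q := div_mul_cancel₀ _ hlpos.ne'
    rw [← hq]
    linarith
  rw [e3, abs_div, abs_of_pos (by linarith : 0 < Rs w j σ)]
  have hs := hS j hj σ
  have num : |(q / l) * Sm w j σ - Sm (fun i => w i * h i) j σ| ≤ 2 * H * s0 := by
    have a1 : (q / l) * Sm w j σ ≤ H * s0 := by gcongr
    have a2 : H * Sm w j σ ≤ H * s0 := by gcongr
    have a3 : 0 ≤ (q / l) * Sm w j σ := by positivity
    rw [abs_le]; constructor <;> linarith
  exact div_le_div₀ ((abs_nonneg _).trans num) num hb hR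

lemma trunc_both {w : Fin n → ℝ} (hw : ∀ i, 0 < w i) {h : Fin n → ℝ} {H b s0 u lam : ℝ} (hH : 0 ≤ H)
    (h0 : ∀ i, 0 ≤ h i) (hh : ∀ i, h i ≤ H) (hb : 0 < b) {m : ℕ} (hm : m ≤ n)
    (hRs : ∀ j < m, ∀ σ, b ≤ Rs w j σ) (hS : ∀ j < m, ∀ σ, Sm w j σ ≤ s0) (hs0 : 0 ≤ s0)
    (hu : m * (2 * H * s0 / b) ≤ u / 4) (hlam : 0 < lam) (hlH : lam * H ≤ 1)
    (hlv : lam * (m * H ^ 2) ≤ u / 8) (hlu : 2 / lam ≤ u / 8) :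
    Pr w {σ | ∃ k ≤ m, u / 2 ≤ |Sm h k σ - (∑ i, w i * h i) / (∑ i, w i) * k|} ≤
      2 * Real.exp (-(lam * u / 8)) ∧
    ∀ k ≤ m, Ex w (fun σ => |Sm h k σ - (∑ i, w i * h i) / (∑ i, w i) * k|) ≤ u / 2 := by
  set κ := (∑ i, w i * h i) / (∑ i, w i) with hκ
  have hdr := trunc_drift hw hH h0 hh hb hm hRs hS
  have hsplit : ∀ k ≤ m, ∀ σ, |Sm h k σ - κ * k| ≤ |Mt w h (fun _ => True) k σ| + u / 4 := by
    intro k hk σ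
    have e : Sm h k σ - κ * k = Mt w h (fun _ => True) k σ +
        ∑ j ∈ Finset.range k, (Dr w h j σ - κ) := by
      rw [Mt_true w h k σ, Finset.sum_sub_distrib]; simp; ring
    rw [e]
    refine (abs_add_le _ _).trans ?_
    gcongr
    refine (Finset.abs_sum_le_sum_abs _ _).trans ?_
    refine (Finset.sum_le_sum fun j hj => hdr j (by have := Finset.mem_range.1 hj; omega) σ).trans ?_
    rw [Finset.sum_const, Finset.card_range, nsmul_eq_mul]
    refine le_trans ?_ hu
    gcongr
  have hcf : ∀ i, |lam * h i| ≤ 1 := by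
    intro i
    rw [abs_of_nonneg (mul_nonneg hlam.le (h0 i))]
    exact (mul_le_mul_of_nonneg_left (hh i) hlam.le).trans hlH
  have hv : ∀ K ≤ m, ∀ σ, ∑ j ∈ Finset.range K, (if True then Dr w (fun i => h i ^ 2) j σ else 0) ≤
      m * H ^ 2 := by
    intro K hK σ
    have : ∀ j ∈ Finset.range K, (if True then Dr w (fun i => h i ^ 2) j σ else 0) ≤ H ^ 2 := by
      intro j _
      rw [if_pos trivial]
      exact Dr_le_const hw (by positivity) (fun i => pow_le_pow_left₀ (h0 i) (hh i) 2) j σ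
    refine (Finset.sum_le_sum this).trans ?_
    rw [Finset.sum_const, Finset.card_range, nsmul_eq_mul]
    gcongr
  constructor
  · have h1 := two_sided hw h (fun _ => True) lam hlam hcf m hm (m * H ^ 2) (fun σ => by simpa using hv m le_rfl σ) (u / 4)
    refine (Pr_mono hw ?_).trans (h1.trans ?_)
    · rintro σ ⟨k, hk, hku⟩
      exact ⟨k, hk, by linarith [hsplit k hk σ]⟩
    · gcongr
      have : lam ^ 2 * (m * H ^ 2) ≤ lam * (u / 8) := by
        rw [sq, mul_assoc]; exact mul_le_mul_of_nonneg_left hlv hlam.le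
      linarith
  · intro k hk
    have h1 := mean_abs hw h (fun _ => True) lam hlam hcf k (by omega) (m * H ^ 2) (fun σ => by simpa using hv k hk σ)
    refine (Ex_mono hw (hsplit k hk)).trans ?_
    rw [Ex_add, Ex_const w hw]
    linarith

lemma mid_both {w : Fin n → ℝ} (hw : ∀ i, 0 < w i) {g : Fin n → ℝ} {b u lam q : ℝ}
    (h0 : ∀ i, 0 ≤ g i) (hb : 0 < b) {m : ℕ} (hm : m ≤ n)
    (hRs : ∀ j < m, ∀ σ, b ≤ Rs w j σ)
    (hq : ∑ i, w i * g i ≤ q) (hu : m * (q / b) ≤ u / 16) (hlam : 0 < lam)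
    (hlH : ∀ i, lam * g i ≤ 1) :
    Pr w {σ | ∃ k ≤ m, u / 4 ≤ Sm g k σ} ≤ Real.exp (-(lam * u / 8)) ∧
    ∀ k ≤ m, Ex w (fun σ => Sm g k σ) ≤ u / 16 := by
  have hq0 : 0 ≤ q := le_trans (Finset.sum_nonneg fun i _ => mul_nonneg (hw i).le (h0 i)) hq
  have hD : ∀ j < m, ∀ σ, Dr w g j σ ≤ q / b := by
    intro j hj σ
    unfold Dr
    exact div_le_div₀ hq0 ((Rs_le_sum (fun i => mul_nonneg (hw i).le (h0 i)) _ _).trans hq) hb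
      (hRs j hj σ)
  have hDs : ∀ k ≤ m, ∀ σ, ∑ j ∈ Finset.range k, Dr w g j σ ≤ u / 16 := by
    intro k hk σ
    refine (Finset.sum_le_sum fun j hj => hD j (by have := Finset.mem_range.1 hj; omega) σ).trans ?_
    rw [Finset.sum_const, Finset.card_range, nsmul_eq_mul]
    refine le_trans ?_ hu
    gcongr
  constructor
  · have h1 := one_sided hw g (fun _ => True) lam (by
      intro i; rw [abs_of_nonneg (mul_nonneg hlam.le (h0 i))]; exact hlH i) m hm (u / 16 / lam) (by
      intro σ
      rw [le_div_iff₀ hlam]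
      refine le_trans ?_ (hDs m le_rfl σ)
      rw [Finset.sum_mul]
      apply Finset.sum_le_sum
      intro j _
      rw [if_pos trivial, mul_comm, ← Dr_mul]
      apply Dr_mono hw
      intro i
      nlinarith [h0 i, hlH i]) (lam * (3 * u / 16))
    refine (Pr_mono hw ?_).trans (h1.trans ?_)
    · rintro σ ⟨k, hk, hku⟩
      refine ⟨k, hk, mul_le_mul_of_nonneg_left ?_ hlam.le⟩
      have := hDs k hk σ
      rw [Mt_true w g k σ] at hku
      linarith
    · apply le_of_eq
      congr 1
      field_simp; ring
  · intro k hk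
    have e : (fun σ => Sm g k σ) = fun σ => Mt w g (fun _ => True) k σ +
      ∑ j ∈ Finset.range k, Dr w g j σ := by funext σ; exact Mt_true w g k σ
    rw [e, Ex_add]
    have : Ex w (fun σ => Mt w g (fun _ => True) k σ) = 0 := Ex_Mt hw g _ k (by omega)
    rw [this, zero_add]
    exact (Ex_mono hw (hDs k hk)).trans (by rw [Ex_const w hw])

/-- centred window sum of `f`. -/
noncomputable def DevF (w f : Fin n → ℝ) (L k : ℕ) (σ : Equiv.Perm (Fin n)) : ℝ :=
  (Sm f k σ - Sm f L σ) - Ex w (fun τ => Sm f k τ - Sm f L τ)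

lemma win_eq (w f : Fin n → ℝ) (L k : ℕ) (hLk : L ≤ k) (σ : Equiv.Perm (Fin n)) :
    Sm f k σ - Sm f L σ = Mt w f (fun j => L ≤ j) k σ + ∑ j ∈ Finset.Ico L k, Dr w f j σ := by
  unfold Sm Mt
  rw [← Finset.sum_Ico_eq_sub _ hLk]
  have : ∑ j ∈ Finset.range k, (if L ≤ j then val f j σ - Dr w f j σ else 0) =
      ∑ j ∈ Finset.Ico L k, (val f j σ - Dr w f j σ) := by
    rw [← Finset.sum_filter]
    congr 1
    ext j; simp; tauto
  have h2 := Finset.sum_sub_distrib (s := Finset.Ico L k) (fun j => val f j σ) (fun j => Dr w f j σ)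
  rw [h2] at this
  have h3 : ∀ a b c : ℝ, b = a - c → a = b + c := by intros; linarith
  apply h3
  rw [← this]
  apply Finset.sum_congr rfl; intro j _; congr

lemma DevF_le {w : Fin n → ℝ} (hw : ∀ i, 0 < w i) (f : Fin n → ℝ) (r : ℕ → ℝ) (L k K : ℕ) (hLk : L ≤ k)
    (hkK : k ≤ K) (hK : K ≤ n) (σ : Equiv.Perm (Fin n)) :
    |DevF w f L k σ| ≤ |Mt w f (fun j => L ≤ j) k σ| +
      ∑ j ∈ Finset.Ico L K, |Dr w f j σ - r j| +
      ∑ j ∈ Finset.Ico L K, Ex w (fun τ => |Dr w f j τ - r j|) := by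
  have e1 : DevF w f L k σ = Mt w f (fun j => L ≤ j) k σ + ∑ j ∈ Finset.Ico L k, (Dr w f j σ - r j)
      - Ex w (fun τ => ∑ j ∈ Finset.Ico L k, (Dr w f j τ - r j)) := by
    unfold DevF
    rw [win_eq w f L k hLk σ]
    have : (fun τ => Sm f k τ - Sm f L τ) = fun τ => Mt w f (fun j => L ≤ j) k τ +
        (∑ j ∈ Finset.Ico L k, (Dr w f j τ - r j) + ∑ j ∈ Finset.Ico L k, r j) := by
      funext τ
      rw [win_eq w f L k hLk τ, Finset.sum_sub_distrib]; ring
    rw [this, Ex_add, Ex_add, Ex_const w hw]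
    have h0 : Ex w (fun σ => Mt w f (fun j => L ≤ j) k σ) = 0 := Ex_Mt hw f _ k (by omega)
    rw [h0, Finset.sum_sub_distrib]; ring
  have sub : Finset.Ico L k ⊆ Finset.Ico L K := Finset.Ico_subset_Ico le_rfl hkK
  have e2 : |∑ j ∈ Finset.Ico L k, (Dr w f j σ - r j)| ≤ ∑ j ∈ Finset.Ico L K, |Dr w f j σ - r j| :=
    (Finset.abs_sum_le_sum_abs _ _).trans
      (Finset.sum_le_sum_of_subset_of_nonneg sub fun _ _ _ => abs_nonneg _)
  have e3 : |Ex w (fun τ => ∑ j ∈ Finset.Ico L k, (Dr w f j τ - r j))| ≤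
      ∑ j ∈ Finset.Ico L K, Ex w (fun τ => |Dr w f j τ - r j|) := by
    rw [Ex_sum]
    refine (Finset.abs_sum_le_sum_abs _ _).trans ?_
    refine le_trans (Finset.sum_le_sum fun j _ => Ex_abs_le hw _) ?_
    refine Finset.sum_le_sum_of_subset_of_nonneg sub fun j _ _ => ?_
    have := Ex_mono hw (F := fun _ => 0) (G := fun τ => |Dr w f j τ - r j|) (fun _ => abs_nonneg _)
    rwa [Ex_const w hw] at this
  rw [e1]
  refine (abs_sub _ _).trans (add_le_add ((abs_add_le _ _).trans (add_le_add le_rfl e2)) e3)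

end thmA
end SB

namespace SB
section thmA
variable {n : ℕ}

lemma ratio_dist {a S Q k ρ κ Q0 l b B : ℝ} (hb : 0 < b) (h1 : b ≤ l - S) (h2 : b ≤ l - ρ * k)
    (hB : 1 ≤ B) (hnum : |Q0 - κ * k| ≤ B * b) (ha : a = (Q0 - Q) / (l - S)) :
    |a - (Q0 - κ * k) / (l - ρ * k)| ≤ B / b * (|S - ρ * k| + |Q - κ * k|) := by
  have e : a - (Q0 - κ * k) / (l - ρ * k) = (-(Q - κ * k) + ((Q0 - κ * k) / (l - ρ * k)) * (S - ρ * k))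
      / (l - S) := by
    have hx1 : l - S ≠ 0 := by linarith
    have hx2 : l - ρ * k ≠ 0 := by linarith
    have e3 : (Q0 - κ * k) / (l - ρ * k) * (l - ρ * k) = Q0 - κ * k := div_mul_cancel₀ _ hx2
    rw [ha, eq_div_iff hx1, sub_mul, div_mul_cancel₀ _ hx1]
    linarith
  have hr : |(Q0 - κ * k) / (l - ρ * k)| ≤ B := by
    rw [abs_div, abs_of_pos (by linarith : 0 < l - ρ * k), div_le_iff₀ (by linarith)]
    exact hnum.trans (by gcongr)
  rw [e, abs_div, abs_of_pos (by linarith : 0 < l - S)]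
  have num : |(-(Q - κ * k) + ((Q0 - κ * k) / (l - ρ * k)) * (S - ρ * k))| ≤
      B * (|S - ρ * k| + |Q - κ * k|) := by
    refine (abs_add_le _ _).trans ?_
    rw [abs_neg, abs_mul]
    have := mul_le_mul_of_nonneg_right hr (abs_nonneg (S - ρ * k))
    have := mul_le_mul_of_nonneg_right hB (abs_nonneg (Q - κ * k))
    linarith
  calc _ ≤ B * (|S - ρ * k| + |Q - κ * k|) / b := div_le_div₀ (by positivity) num hb h1
    _ = _ := by ring

set_option maxHeartbeats 4000000 in
lemma thmA_core {w : Fin n → ℝ} (hw : ∀ i, 0 < w i) {c0 C0 C1 R η ε N y : ℝ} (hc0 : 0 < c0)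
    (hc1 : c0 ≤ 1) (hC0 : 1 ≤ C0) (hC1 : 1 ≤ C1) (hR : 1 ≤ R)
    (hη : η = c0 ^ 2 / (256 * C0)) (hε : 0 < ε) (hε1 : ε ≤ c0 ^ 2 / (2 * C0))
    (hε2 : ε ≤ η / (8 * C1 * (R ^ 2) ^ 2) * η / 16) (hn : 1 ≤ n) (hN : 1 ≤ N)
    (h1 : c0 * n ≤ ∑ i, w i) (h3 : ∑ i, w i ^ 2 ≤ C0 * n)
    (h4 : ∑ i, w i ^ 3 ≤ C0 * n) (hmax : ∀ i, w i ≤ η / 8 * N)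
    (hset : ∀ s : Finset (Fin n), (s.card : ℝ) ≤ ε * n →
      ∑ i ∈ s, w i ≤ η * c0 / (16 * C1 * R ^ 2) * n)
    (hheavy : ∑ i, (if R < w i then w i ^ 3 else 0) ≤ η * c0 / (32 * C1) * n)
    {l m : ℕ} (hl : 1 ≤ l) (hlm : l ≤ m) (hm : (m : ℝ) ≤ ε * n)
    (hmd : (m : ℝ) * ((m : ℝ) - l) ≤ C1 * y * n) (hd : 1 ≤ (m : ℝ) - l) (hy : 1 ≤ y) :
    Pr w {σ | ∃ k, l - 1 ≤ k ∧ k ≤ m ∧ y / 2 ≤ |Dev w (l - 1) k σ|} ≤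
      256 * C0 / c0 * Real.exp (-y ^ 2 / (256 * C0 / c0 * (y * N + ((m : ℝ) - l)))) := by
  have hn0 : (0 : ℝ) < n := by exact_mod_cast hn
  have hη0 : 0 < η := by rw [hη]; positivity
  have hc02 : c0 ^ 2 ≤ 1 := pow_le_one₀ hc0.le hc1
  have hη1 : η ≤ 1 := by rw [hη, div_le_one (by positivity)]; linarith
  have hεle : ε ≤ 1 := by
    refine hε1.trans ?_; rw [div_le_one (by positivity)]; linarith
  have hmn : m ≤ n := by
    have : (m : ℝ) ≤ n := hm.trans (mul_le_of_le_one_left hn0.le hεle)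
    exact_mod_cast this
  obtain ⟨d, hdd⟩ : ∃ x : ℝ, x = (m : ℝ) - l := ⟨_, rfl⟩
  rw [← hdd] at hmd hd ⊢
  have hl' : (1 : ℝ) ≤ l := by exact_mod_cast hl
  have hdm : d ≤ m := by linarith
  have hm0 : (0 : ℝ) < m := by linarith
  obtain ⟨H, hH⟩ : ∃ x, x = R ^ 2 := ⟨_, rfl⟩
  simp only [← hH] at hε2 hset
  have hH1 : 1 ≤ H := by rw [hH]; exact one_le_pow₀ hR
  have hRH : R ≤ H := by rw [hH]; exact le_self_pow₀ hR two_ne_zero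
  obtain ⟨u, hu⟩ : ∃ x, x = η * y * n / d := ⟨_, rfl⟩
  have hu0 : 0 < u := by rw [hu]; positivity
  have hum : η * m / C1 ≤ u := by
    rw [hu, div_le_div_iff₀ (by positivity) (by positivity)]
    have := mul_le_mul_of_nonneg_left hmd hη0.le
    linarith only [this]
  have huε : η * y / ε ≤ u := by
    rw [hu, div_le_div_iff₀ (by positivity) (by positivity)]
    have : d ≤ ε * n := hdm.trans hm
    have : 0 < η * y := by positivity
    have := mul_le_mul_of_nonneg_left ‹d ≤ ε * n› (‹0 < η * y›).le
    linarith only [this]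
  obtain ⟨θ, hθ⟩ : ∃ x, x = η * c0 / (16 * C1 * H) := ⟨_, rfl⟩
  simp only [← hθ] at hset
  have hθ0 : 0 < θ := by rw [hθ]; positivity
  have hθc : θ ≤ c0 / 2 := by
    rw [hθ, div_le_div_iff₀ (by positivity) (by positivity)]
    have : 1 ≤ C1 * H := one_le_mul_of_one_le_of_one_le hC1 hH1
    have h2 := mul_le_mul_of_nonneg_right hη1 hc0.le
    have h3 := mul_le_mul_of_nonneg_left this hc0.le
    linarith only [h2, h3, hc0]
  obtain ⟨b, hb⟩ : ∃ x, x = c0 * n / 2 := ⟨_, rfl⟩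
  have hb0 : 0 < b := by rw [hb]; positivity
  have hS : ∀ j ≤ m, ∀ σ, Sm w j σ ≤ θ * n := by
    intro j hj σ
    obtain ⟨s, hs, hs2⟩ := Sm_set j σ
    rw [hs2]
    apply hset
    have : (s.card : ℝ) ≤ m := by exact_mod_cast hs.trans hj
    linarith
  have hRs : ∀ j ≤ m, ∀ σ, b ≤ Rs w j σ := by
    intro j hj σ
    rw [Rs_eq w j (by omega)]
    have := hS j hj σ
    have : θ * n ≤ c0 / 2 * n := by gcongr
    rw [hb]; linarith
  -- truncated functions
  obtain ⟨lam0, hlam0⟩ : ∃ x, x = η / (8 * C1 * H ^ 2) := ⟨_, rfl⟩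
  simp only [← hlam0] at hε2
  have hlam00 : 0 < lam0 := by rw [hlam0]; positivity
  have htr : ∀ h : Fin n → ℝ, (∀ i, 0 ≤ h i) → (∀ i, h i ≤ H) →
      Pr w {σ | ∃ k ≤ m, u / 2 ≤ |Sm h k σ - (∑ i, w i * h i) / (∑ i, w i) * k|} ≤
      2 * Real.exp (-(lam0 * u / 8)) ∧
    ∀ k ≤ m, Ex w (fun σ => |Sm h k σ - (∑ i, w i * h i) / (∑ i, w i) * k|) ≤ u / 2 := by
    intro h hh0 hhH
    refine trunc_both hw (b := b) (s0 := θ * n) (by positivity) hh0 hhH hb0 hmn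
      (fun j hj => hRs j hj.le) (fun j hj => hS j hj.le) (by positivity) ?_ hlam00 ?_ ?_ ?_
    · have : (m : ℝ) * (2 * H * (θ * n) / b) = (η * m / C1) / 4 := by
        rw [hb, hθ]; field_simp; norm_num
      rw [this]; linarith
    · rw [hlam0, div_mul_eq_mul_div, div_le_one (by positivity)]
      have : 1 ≤ C1 * H := one_le_mul_of_one_le_of_one_le hC1 hH1
      have h3 := mul_le_mul this hH1 zero_le_one (by linarith only [this])
      linarith only [h3, mul_le_mul_of_nonneg_right hη1 (by linarith only [hH1] : (0:ℝ) ≤ H), hη1, hH1, this, mul_le_mul_of_nonneg_right this (by linarith only [hH1] : (0:ℝ) ≤ H)]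
    · have : lam0 * (m * H ^ 2) = (η * m / C1) / 8 := by rw [hlam0]; field_simp
      rw [this]; linarith
    · have : 2 / lam0 ≤ (η * y / ε) / 8 := by
        rw [div_div, div_le_div_iff₀ (by positivity) (by positivity)]
        have : 16 * ε ≤ lam0 * η := by linarith
        have h5 := mul_le_mul_of_nonneg_left hy (mul_pos hlam00 hη0).le
        linarith only [h5, this]
      linarith
  obtain ⟨g1, hg1⟩ : ∃ x : Fin n → ℝ, x = fun i => if w i ≤ R then w i else 0 := ⟨_, rfl⟩
  obtain ⟨g2, hg2⟩ : ∃ x : Fin n → ℝ, x = fun i => if w i ≤ R then w i ^ 2 else 0 := ⟨_, rfl⟩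
  obtain ⟨P1, M1⟩ := htr g1 (by intro i; simp only [hg1]; split_ifs; exacts [(hw i).le, le_rfl])
    (by intro i; simp only [hg1]; split_ifs; exacts [by linarith, by linarith])
  obtain ⟨P2, M2⟩ := htr g2 (by intro i; simp only [hg2]; split_ifs; exacts [by positivity, le_rfl])
    (by intro i; simp only [hg2]; split_ifs with h; exacts [by rw [hH]; exact pow_le_pow_left₀ (hw i).le h 2, by linarith])
  -- mid
  obtain ⟨g3, hg3⟩ : ∃ x : Fin n → ℝ, x = fun i => if R < w i ∧ w i * m ≤ n then w i ^ 2 else 0 := ⟨_, rfl⟩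
  obtain ⟨lam, hlam⟩ : ∃ x, x = 8 / η * (d / (n * N)) := ⟨_, rfl⟩
  have hlamp : 0 < lam := by rw [hlam]; positivity
  obtain ⟨η', hη'⟩ : ∃ x, x = η * c0 / (32 * C1) := ⟨_, rfl⟩
  simp only [← hη'] at hheavy
  have hη'0 : 0 < η' := by rw [hη']; positivity
  have hg30 : ∀ i, 0 ≤ g3 i := by intro i; simp only [hg3]; split_ifs <;> positivity
  obtain ⟨P3, M3⟩ := mid_both hw (g := g3) (b := b) (u := u) (lam := lam) (q := η' * n) (m := m)
    hg30 hb0 hmn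
    (fun j hj => hRs j hj.le)
    (by
      refine le_trans (Finset.sum_le_sum fun i _ => ?_) hheavy
      have := hw i
      simp only [hg3]
      split_ifs with ha hb hb
      · apply le_of_eq; ring
      · exact absurd ha.1 hb
      · simp; positivity
      · simp)
    (by
      have : (m : ℝ) * (η' * n / b) = (η * m / C1) / 16 := by
        rw [hb, hη']; field_simp; norm_num
      rw [this]; linarith)
    hlamp
    (by
      intro i
      have hwi := hw i
      simp only [hg3]
      split_ifs with ha
      · have e : lam * w i ^ 2 = (8 * w i / (η * N)) * (d * w i / n) := by
          rw [hlam]; field_simp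
        rw [e]
        apply mul_le_one₀
        · rw [div_le_one (by positivity)]; have := hmax i; linarith
        · positivity
        · rw [div_le_one (by positivity)]; have h5 := ha.2; have := mul_le_mul_of_nonneg_right hdm hwi.le; linarith only [this, h5]
      · simp)
  -- top
  have hdom2 : ∀ i, w i ^ 2 ≤ g2 i + (g3 i + (m / n) * (if R < w i then w i ^ 3 else 0)) := by
    intro i
    have hwi := hw i
    simp only [hg2, hg3]
    by_cases ha : w i ≤ R
    · rw [if_pos ha, if_neg (by intro h; linarith [h.1]), if_neg (by linarith)]; simp
    · rw [if_neg ha, if_pos (by linarith : R < w i)]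
      by_cases hb : w i * m ≤ n
      · rw [if_pos ⟨by linarith, hb⟩]
        have : 0 ≤ (m : ℝ) / n * w i ^ 3 := by positivity
        linarith
      · rw [if_neg (by intro h; exact hb h.2)]
        have : 1 ≤ (m : ℝ) / n * w i := by
          rw [div_mul_eq_mul_div, one_le_div hn0]; linarith
        have : w i ^ 2 * 1 ≤ w i ^ 2 * ((m : ℝ) / n * w i) := by gcongr
        linarith
  have hdom1 : ∀ i, w i ≤ g1 i + (g3 i + (m / n) * (if R < w i then w i ^ 3 else 0)) := by
    intro i
    have hwi := hw i
    by_cases ha : w i ≤ R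
    · simp only [hg1]
      rw [if_pos ha, if_neg (by linarith : ¬ R < w i)]
      have := hg30 i
      linarith
    · have := hdom2 i
      have e2 : g2 i = 0 := by simp [hg2, ha]
      have e1 : g1 i = 0 := by simp [hg1, ha]
      rw [e2] at this; rw [e1]
      have : w i ≤ w i ^ 2 := le_self_pow₀ (by linarith only [ha, hR]) two_ne_zero
      linarith
  have htop : ∀ k σ, Sm (fun i => (m / n) * (if R < w i then w i ^ 3 else 0)) k σ ≤ u / 16 := by
    intro k σ
    refine (Sm_le_sum ?_ k σ).trans ?_
    · intro i; have := hw i; split_ifs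
      · positivity
      · simp
    · rw [← Finset.mul_sum]
      have : (m : ℝ) / n * ∑ i, (if R < w i then w i ^ 3 else 0) ≤ m / n * (η' * n) := by gcongr
      refine this.trans ?_
      have e : (m : ℝ) / n * (η' * n) = (η * m / C1) * (c0 / 32) := by rw [hη']; field_simp
      rw [e]
      have : η * m / C1 * (c0 / 32) ≤ u * (1 / 32) := by gcongr
      linarith
  obtain ⟨ρ, hρ⟩ : ∃ x, x = (∑ i, w i * g1 i) / (∑ i, w i) := ⟨_, rfl⟩
  simp only [← hρ] at P1 M1
  obtain ⟨κ, hκ⟩ : ∃ x, x = (∑ i, w i * g2 i) / (∑ i, w i) := ⟨_, rfl⟩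
  simp only [← hκ] at P2 M2
  have hlpos : 0 < ∑ i, w i := lt_of_lt_of_le (by positivity) h1
  have hg1w : ∀ i, g1 i ≤ w i := by
    intro i; have := hw i; simp only [hg1]; split_ifs <;> linarith
  have hg2w : ∀ i, g2 i ≤ w i ^ 2 := by
    intro i; have := hw i; simp only [hg2]; split_ifs
    · exact le_rfl
    · positivity
  have hg10 : ∀ i, 0 ≤ g1 i := by
    intro i; have := hw i; simp only [hg1]; split_ifs <;> linarith
  have hg20 : ∀ i, 0 ≤ g2 i := by
    intro i; have := hw i; simp only [hg2]; split_ifs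
    · positivity
    · exact le_rfl
  have sdev : ∀ k σ, |Sm w k σ - ρ * k| ≤ |Sm g1 k σ - ρ * k| + (Sm g3 k σ + u / 16) := by
    intro k σ
    have a1 := Sm_mono (h := w) hdom1 k σ
    rw [Sm_add, Sm_add] at a1
    have a2 := htop k σ
    have a3 := Sm_mono (g := w) hg1w k σ
    have a4 := Sm_nonneg hg30 k σ
    have := abs_sub_abs_le_abs_sub (Sm w k σ - ρ * k) (Sm g1 k σ - ρ * k)
    have e : (Sm w k σ - ρ * k) - (Sm g1 k σ - ρ * k) = Sm w k σ - Sm g1 k σ := by ring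
    have hnn : 0 ≤ Sm w k σ - Sm g1 k σ := sub_nonneg.2 a3
    rw [e, abs_of_nonneg hnn] at this
    linarith only [this, a1, a2, a4]
  have qdev : ∀ k σ, |Sm (fun i => w i ^ 2) k σ - κ * k| ≤
      |Sm g2 k σ - κ * k| + (Sm g3 k σ + u / 16) := by
    intro k σ
    have a1 := Sm_mono hdom2 k σ
    rw [Sm_add, Sm_add] at a1
    have a2 := htop k σ
    have a3 := Sm_mono hg2w k σ
    have a4 := Sm_nonneg hg30 k σ
    have := abs_sub_abs_le_abs_sub (Sm (fun i => w i ^ 2) k σ - κ * k) (Sm g2 k σ - κ * k)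
    have e : (Sm (fun i => w i ^ 2) k σ - κ * k) - (Sm g2 k σ - κ * k) =
      Sm (fun i => w i ^ 2) k σ - Sm g2 k σ := by ring
    have hnn : 0 ≤ Sm (fun i => w i ^ 2) k σ - Sm g2 k σ := sub_nonneg.2 a3
    rw [e, abs_of_nonneg hnn] at this
    linarith only [this, a1, a2, a4]
  -- drift
  have hρ0 : 0 ≤ ρ := by rw [hρ]; exact div_nonneg (Finset.sum_nonneg fun i _ => mul_nonneg (hw i).le (hg10 i)) hlpos.le
  have hκ0 : 0 ≤ κ := by rw [hκ]; exact div_nonneg (Finset.sum_nonneg fun i _ => mul_nonneg (hw i).le (hg20 i)) hlpos.le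
  have hρle : ρ ≤ C0 / c0 := by
    have e : C0 / c0 = (C0 * n) / (c0 * n) := by field_simp
    rw [e, hρ]
    refine div_le_div₀ (by positivity) (le_trans (Finset.sum_le_sum fun i _ => ?_) h3) (by positivity) h1
    have := mul_le_mul_of_nonneg_left (hg1w i) (hw i).le; linarith only [this]
  have hκle : κ ≤ C0 / c0 := by
    have e : C0 / c0 = (C0 * n) / (c0 * n) := by field_simp
    rw [e, hκ]
    refine div_le_div₀ (by positivity) (le_trans (Finset.sum_le_sum fun i _ => ?_) h4) (by positivity) h1
    have := mul_le_mul_of_nonneg_left (hg2w i) (hw i).le; linarith only [this]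
  have hck : ∀ k ≤ m, ∀ x ≤ C0 / c0, x * (k : ℝ) ≤ b := by
    intro k hk x hx
    have hkm : (k : ℝ) ≤ m := by exact_mod_cast hk
    calc x * (k : ℝ) ≤ C0 / c0 * (ε * n) := by
          apply mul_le_mul hx (hkm.trans hm) (by positivity) (by positivity)
      _ ≤ C0 / c0 * (c0 ^ 2 / (2 * C0) * n) := by gcongr
      _ = b := by rw [hb]; field_simp
  obtain ⟨Q0, hQ0⟩ : ∃ x, x = ∑ i, w i ^ 2 := ⟨_, rfl⟩
  simp only [← hQ0] at h3
  obtain ⟨r, hr⟩ : ∃ x : ℕ → ℝ, x = fun (k : ℕ) => (Q0 - κ * k) / ((∑ i, w i) - ρ * k) := ⟨_, rfl⟩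
  have hB1 : 1 ≤ 2 * C0 / c0 := by rw [one_le_div hc0]; linarith
  have hdrift : ∀ k ≤ m, ∀ σ, |Dr w w k σ - r k| ≤ (2 * C0 / c0) / b *
      ((|Sm g1 k σ - ρ * k| + (Sm g3 k σ + u / 16)) + (|Sm g2 k σ - κ * k| + (Sm g3 k σ + u / 16))) := by
    intro k hk σ
    have hbk := hck k hk
    rw [hr]
    refine (ratio_dist (a := Dr w w k σ) (S := Sm w k σ) (Q := Sm (fun i => w i ^ 2) k σ) (k := (k : ℝ))
      (b := b) (B := 2 * C0 / c0) hb0 ?_ ?_ hB1 ?_ ?_).trans ?_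
    · rw [← Rs_eq w k (by omega)]; exact hRs k hk σ
    · have := hbk ρ hρle; rw [hb] at this ⊢; linarith
    · have a1 := hbk κ hκle
      have a2 : 0 ≤ κ * k := by positivity
      have a3 : 0 ≤ Q0 := by rw [hQ0]; exact Finset.sum_nonneg fun i _ => sq_nonneg _
      have e : 2 * C0 / c0 * b = C0 * n := by rw [hb]; field_simp
      rw [e, abs_le]
      have : b ≤ C0 * n := by
        rw [hb]
        have := mul_le_mul_of_nonneg_right (hc1.trans hC0) hn0.le
        have := mul_pos hc0 hn0
        linarith
      constructor <;> linarith
    · unfold Dr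
      rw [Rs_eq w k (by omega), Rs_eq _ k (by omega)]
      have : (fun i => w i * w i) = fun i => w i ^ 2 := by funext i; ring
      rw [this, hQ0]
    · have := sdev k σ
      have := qdev k σ
      gcongr
  obtain ⟨L, hL⟩ : ∃ x, x = l - 1 := ⟨_, rfl⟩
  rw [← hL]
  have hcard : ((Finset.Ico L m).card : ℝ) ≤ 2 * d := by
    rw [Nat.card_Ico, Nat.cast_sub (by omega), hL, Nat.cast_sub hl]
    push_cast; linarith
  have hC6 : 2 * d * ((2 * C0 / c0) / b * (2 * u)) = y / 16 := by
    rw [hu, hb, hη]; field_simp; norm_num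
  have hmean : ∑ j ∈ Finset.Ico L m, Ex w (fun τ => |Dr w w j τ - r j|) ≤ y / 16 := by
    have : ∀ j ∈ Finset.Ico L m, Ex w (fun τ => |Dr w w j τ - r j|) ≤ (2 * C0 / c0) / b * (2 * u) := by
      intro j hj
      have hjm : j ≤ m := (Finset.mem_Ico.1 hj).2.le
      refine (Ex_mono hw (hdrift j hjm)).trans ?_
      rw [Ex_mul, Ex_add, Ex_add, Ex_add, Ex_add, Ex_const w hw]
      have e3 : (Ex w fun σ => Sm g3 j σ + u / 16) = Ex w (fun σ => Sm g3 j σ) + u / 16 := by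
        rw [Ex_add, Ex_const w hw]
      have e4 : Ex w (Sm g3 j) = Ex w (fun σ => Sm g3 j σ) := rfl
      have := M1 j hjm
      have := M2 j hjm
      have := M3 j hjm
      have hpos : 0 ≤ (2 * C0 / c0) / b := by positivity
      apply mul_le_mul_of_nonneg_left _ hpos
      linarith
    refine (Finset.sum_le_sum this).trans ?_
    rw [Finset.sum_const, nsmul_eq_mul, ← hC6]
    gcongr
  -- main martingale
  obtain ⟨A', hA'⟩ : ∃ x, x = 32 * C0 / c0 := ⟨_, rfl⟩
  have hA'1 : 1 ≤ A' := by rw [hA', one_le_div hc0]; linarith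
  obtain ⟨c, hc⟩ : ∃ x, x = y / (A' * (y * N + d)) := ⟨_, rfl⟩
  have hcp : 0 < c := by rw [hc]; positivity
  have hV : ∀ σ, ∑ j ∈ Finset.range m, (if L ≤ j then Dr w (fun i => w i ^ 2) j σ else 0) ≤
      2 * d * (2 * C0 / c0) := by
    intro σ
    have e1 : ∑ j ∈ Finset.range m, (if L ≤ j then Dr w (fun i => w i ^ 2) j σ else 0) =
        ∑ j ∈ Finset.Ico L m, Dr w (fun i => w i ^ 2) j σ := by
      rw [← Finset.sum_filter]
      congr 1
      ext j; simp; tauto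
    rw [e1]
    have : ∀ j ∈ Finset.Ico L m, Dr w (fun i => w i ^ 2) j σ ≤ 2 * C0 / c0 := by
      intro j hj
      have hjm : j ≤ m := (Finset.mem_Ico.1 hj).2.le
      unfold Dr
      have e : 2 * C0 / c0 = C0 * n / b := by rw [hb]; field_simp
      rw [e]
      refine div_le_div₀ (by positivity) ?_ hb0 (hRs j hjm σ)
      refine (Rs_le_sum (fun i => by have := hw i; positivity) _ _).trans (le_trans (le_of_eq ?_) h4)
      apply Finset.sum_congr rfl; intro i _; ring
    refine (Finset.sum_le_sum this).trans ?_
    rw [Finset.sum_const, nsmul_eq_mul]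
    gcongr
  have PM := two_sided hw w (fun j => L ≤ j) c hcp (by
      intro i
      have hwi := hw i
      rw [abs_of_nonneg (by positivity), hc, div_mul_eq_mul_div, div_le_one (by positivity)]
      have : w i ≤ N := (hmax i).trans (by
        have := mul_le_mul_of_nonneg_right hη1 (by linarith only [hN] : 0 ≤ N)
        linarith only [this, hN])
      have a1 : y * w i ≤ y * N := by gcongr
      have a2 : y * N + d ≤ A' * (y * N + d) := le_mul_of_one_le_left (by positivity) hA'1
      linarith) m hmn (2 * d * (2 * C0 / c0)) (fun σ => le_trans (le_of_eq (Finset.sum_congr rfl fun j _ => by congr)) (hV σ)) (y / 4)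
  obtain ⟨E, hE⟩ : ∃ x, x = y ^ 2 / (y * N + d) := ⟨_, rfl⟩
  have hE0 : 0 < E := by rw [hE]; positivity
  have hEN : E ≤ y / N := by
    rw [hE, div_le_div_iff₀ (by positivity) (by positivity)]
    have := mul_nonneg (by linarith only [hy] : 0 ≤ y) (by linarith only [hd] : 0 ≤ d)
    linarith only [this]
  obtain ⟨X, hX⟩ : ∃ x, x = Real.exp (-(E / (256 * C0 / c0))) := ⟨_, rfl⟩
  have hA1 : 7 ≤ 256 * C0 / c0 := by rw [le_div_iff₀ hc0]; linarith
  have hcE : c * y = E / A' := by rw [hc, hE]; field_simp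
  have q1 : Real.exp (-(c * (y / 4) - c ^ 2 * (2 * d * (2 * C0 / c0)))) ≤ X := by
    rw [hX, Real.exp_le_exp]
    have e1 : c * (2 * d * (2 * C0 / c0)) ≤ y / 8 := by
      have e : c * (2 * d * (2 * C0 / c0)) = y / 8 * (d / (y * N + d)) := by
        rw [hc, hA']; field_simp; ring
      rw [e]
      apply mul_le_of_le_one_right (by positivity)
      rw [div_le_one (by positivity)]
      have : 0 < y * N := by positivity
      linarith
    have e2 : c ^ 2 * (2 * d * (2 * C0 / c0)) ≤ c * (y / 8) := by
      rw [sq, mul_assoc]; exact mul_le_mul_of_nonneg_left e1 hcp.le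
    have e3 : E / (256 * C0 / c0) = c * y / 8 := by rw [hcE, hA']; field_simp; ring
    rw [e3]; linarith
  have hEX : ∀ x, E ≤ x → Real.exp (-x) ≤ X := by
    intro x hx
    rw [hX, Real.exp_le_exp]
    have : E / (256 * C0 / c0) ≤ E := div_le_self hE0.le (by linarith)
    linarith
  have hyN : y / N ≤ y := div_le_self (by linarith) hN
  have q2 : Real.exp (-(lam0 * u / 8)) ≤ X := by
    apply hEX
    have : lam0 * (η * y / ε) ≤ lam0 * u := by gcongr
    have h16 : 16 * y ≤ lam0 * (η * y / ε) := by
      rw [mul_div_assoc', le_div_iff₀ hε]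
      have : 16 * ε ≤ lam0 * η := by linarith
      have h5 := mul_le_mul_of_nonneg_left this (by linarith only [hy] : 0 ≤ y)
      linarith only [h5]
    linarith
  have q3 : Real.exp (-(lam * u / 8)) ≤ X := by
    apply hEX
    have : lam * u / 8 = y / N := by rw [hlam, hu]; field_simp
    rw [this]; exact hEN
  have goalX : -y ^ 2 / (256 * C0 / c0 * (y * N + d)) = -(E / (256 * C0 / c0)) := by
    rw [hE]; field_simp
  rw [goalX, ← hX]
  refine (Pr_mono hw (t := {σ | ∃ k ≤ m, y / 4 ≤ |Mt w w (fun j => L ≤ j) k σ|} ∪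
    ({σ | ∃ k ≤ m, u / 2 ≤ |Sm g1 k σ - ρ * k|} ∪ ({σ | ∃ k ≤ m, u / 2 ≤ |Sm g2 k σ - κ * k|} ∪
    {σ | ∃ k ≤ m, u / 4 ≤ Sm g3 k σ}))) ?_).trans ?_
  · rintro σ ⟨k, hLk, hkm, hyk⟩
    by_contra hcon
    simp only [Set.mem_union, Set.mem_ofPred_eq, not_or, not_exists, not_and, not_le] at hcon
    obtain ⟨b1, b2, b3, b4⟩ := hcon
    have hk := DevF_le hw w r L k m hLk hkm hmn σ
    have hs : ∑ j ∈ Finset.Ico L m, |Dr w w j σ - r j| ≤ y / 16 := by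
      have : ∀ j ∈ Finset.Ico L m, |Dr w w j σ - r j| ≤ (2 * C0 / c0) / b * (2 * u) := by
        intro j hj
        have hjm : j ≤ m := (Finset.mem_Ico.1 hj).2.le
        refine (hdrift j hjm σ).trans ?_
        have := b2 j hjm
        have := b3 j hjm
        have := b4 j hjm
        have hpos : 0 ≤ (2 * C0 / c0) / b := by positivity
        apply mul_le_mul_of_nonneg_left _ hpos
        linarith
      refine (Finset.sum_le_sum this).trans ?_
      rw [Finset.sum_const, nsmul_eq_mul, ← hC6]
      gcongr
    have := b1 k hkm
    have e : DevF w w L k σ = Dev w L k σ := rfl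
    rw [e] at hk
    linarith
  · have u1 := Pr_union hw {σ | ∃ k ≤ m, y / 4 ≤ |Mt w w (fun j => L ≤ j) k σ|}
      ({σ | ∃ k ≤ m, u / 2 ≤ |Sm g1 k σ - ρ * k|} ∪ ({σ | ∃ k ≤ m, u / 2 ≤ |Sm g2 k σ - κ * k|} ∪
    {σ | ∃ k ≤ m, u / 4 ≤ Sm g3 k σ}))
    have u2 := Pr_union hw {σ | ∃ k ≤ m, u / 2 ≤ |Sm g1 k σ - ρ * k|}
      ({σ | ∃ k ≤ m, u / 2 ≤ |Sm g2 k σ - κ * k|} ∪ {σ | ∃ k ≤ m, u / 4 ≤ Sm g3 k σ})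
    have u3 := Pr_union hw {σ | ∃ k ≤ m, u / 2 ≤ |Sm g2 k σ - κ * k|}
      {σ | ∃ k ≤ m, u / 4 ≤ Sm g3 k σ}
    have hX0 : 0 < X := by rw [hX]; exact Real.exp_pos _
    have : 7 * X ≤ 256 * C0 / c0 * X := by gcongr
    linarith

end thmA
end SB

namespace SB

lemma thmA {w : ∀ n : ℕ, Fin n → ℝ} {μ : Measure ℝ} (hC : CondC w μ) :
    ∃ A > (0 : ℝ), ∀ C1 : ℝ, 1 ≤ C1 → ∃ ε > (0 : ℝ), ∀ᶠ n : ℕ in atTop, ∀ l m : ℕ, ∀ y : ℝ,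
      1 ≤ l → l ≤ m → (m : ℝ) ≤ ε * n → (m : ℝ) * ((m : ℝ) - l) ≤ C1 * y * n →
      1 ≤ (m : ℝ) - l → 1 ≤ y →
      Pr (w n) {σ | ∃ k, l - 1 ≤ k ∧ k ≤ m ∧ y / 2 ≤ |Dev (w n) (l - 1) k σ|} ≤
      A * Real.exp (-y ^ 2 / (A * (y * (n : ℝ) ^ ((1 : ℝ) / 3) + ((m : ℝ) - l)))) := by
  obtain ⟨c0, hc0, C0, hC0, hc1, hf⟩ := fact1 hC
  refine ⟨256 * C0 / c0, by positivity, fun C1 hC1 => ?_⟩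
  obtain ⟨η, hη⟩ : ∃ x, x = c0 ^ 2 / (256 * C0) := ⟨_, rfl⟩
  have hη0 : 0 < η := by rw [hη]; positivity
  have hC10 : 0 < C1 := by linarith
  obtain ⟨R, hR, hR2⟩ := fact2 hC (η * c0 / (32 * C1)) (by positivity)
  have hR0 : 0 < R := by linarith
  obtain ⟨ε1, hε1, hf4⟩ := fact4 hC (η * c0 / (16 * C1 * R ^ 2)) (by positivity)
  refine ⟨min ε1 (min (c0 ^ 2 / (2 * C0)) (η / (8 * C1 * (R ^ 2) ^ 2) * η / 16)), ?_, ?_⟩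
  · refine lt_min hε1 (lt_min ?_ ?_) <;> positivity
  filter_upwards [hf, hR2, hf4, fact3 hC (η / 8) (by positivity), eventually_ge_atTop 1] with n
    h1 h2 h3 h4 hn l m y hl hlm hm hmd hd hy
  have hn1 : (1 : ℝ) ≤ n := by exact_mod_cast hn
  refine thmA_core (hC.w_pos n) hc0 hc1 hC0 hC1 hR hη
    (lt_min hε1 (lt_min (by positivity) (by positivity)))
    ((min_le_right _ _).trans (min_le_left _ _)) ((min_le_right _ _).trans (min_le_right _ _)) hn
    (Real.one_le_rpow hn1 (by norm_num)) h1.1 h1.2.2.1 h1.2.2.2 h4 ?_ h2 hl hlm hm hmd hd hy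
  intro s hs
  refine (h3 s (hs.trans ?_)).1
  gcongr
  exact min_le_left _ _

end SB

namespace SB
section clock
open ProbabilityTheory

lemma exp_lint {a b s : ℝ} (ha : 0 < a) (hb : 0 ≤ b) (hs : 0 ≤ s) :
    ∫⁻ x in Set.Ioi s, ENNReal.ofReal (Real.exp (-(x * b))) ∂(expMeasure a) =
      ENNReal.ofReal (a / (a + b) * Real.exp (-(s * (a + b)))) := by
  have hm : Measurable (gammaPDF 1 a) := (measurable_gammaPDFReal 1 a).ennreal_ofReal
  unfold expMeasure gammaMeasure
  rw [setLIntegral_withDensity_eq_setLIntegral_mul _ hm (by fun_prop) measurableSet_Ioi]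
  have h1 : ∀ x ∈ Set.Ioi s, (gammaPDF 1 a * fun x => ENNReal.ofReal (Real.exp (-(x * b)))) x =
      ENNReal.ofReal (a * Real.exp (-(a + b) * x)) := by
    intro x hx
    have hx0 : 0 ≤ x := hs.trans (Set.mem_Ioi.1 hx).le
    have := exponentialPDF_of_nonneg (r := a) hx0
    unfold exponentialPDF exponentialPDFReal at this
    simp only [Pi.mul_apply]
    unfold gammaPDF
    rw [this, ← ENNReal.ofReal_mul (by positivity), mul_assoc, ← Real.exp_add]
    congr 3; ring
  rw [setLIntegral_congr_fun measurableSet_Ioi h1]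
  rw [← ofReal_integral_eq_lintegral_ofReal]
  · rw [integral_const_mul, integral_exp_mul_Ioi (by linarith)]
    congr 1
    rw [neg_div, ← div_neg, neg_neg, show -(a + b) * s = -(s * (a + b)) by ring]
    ring
  · exact (integrableOn_exp_mul_Ioi (by linarith) s).const_mul a
  · exact Eventually.of_forall fun x => by positivity

lemma exp_tail {a s : ℝ} (ha : 0 < a) (hs : 0 ≤ s) :
    expMeasure a (Set.Ioi s) = ENNReal.ofReal (Real.exp (-(a * s))) := by
  have := exp_lint (b := 0) ha le_rfl hs
  simp only [mul_zero, neg_zero, Real.exp_zero, ENNReal.ofReal_one, lintegral_const, one_mul,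
    Measure.restrict_apply MeasurableSet.univ, Set.univ_inter, add_zero, div_self ha.ne'] at this
  rw [this, mul_comm]

lemma ord_measurable {k : ℕ} (s : ℝ) :
    MeasurableSet {x : Fin k → ℝ | (∀ i, s < x i) ∧ StrictMono x} := by
  have : {x : Fin k → ℝ | (∀ i, s < x i) ∧ StrictMono x} =
      (⋂ i, {x | s < x i}) ∩ ⋂ i, ⋂ j, ⋂ (_ : i < j), {x | x i < x j} := by
    ext x
    simp [StrictMono]
  rw [this]
  refine (MeasurableSet.iInter fun i => measurableSet_lt (by fun_prop) (by fun_prop)).inter ?_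
  refine MeasurableSet.iInter fun i => MeasurableSet.iInter fun j => MeasurableSet.iInter fun _ => ?_
  exact measurableSet_lt (by fun_prop) (by fun_prop)

lemma ord_cons {k : ℕ} (s : ℝ) (x0 : ℝ) (x : Fin k → ℝ) :
    ((∀ i, s < (Fin.cons x0 x : Fin (k + 1) → ℝ) i) ∧ StrictMono (Fin.cons x0 x : Fin (k + 1) → ℝ)) ↔
      s < x0 ∧ (∀ i, x0 < x i) ∧ StrictMono x := by
  constructor
  · rintro ⟨h1, h2⟩
    refine ⟨by simpa using h1 0, fun i => ?_, fun i j hij => ?_⟩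
    · have := h2 (Fin.succ_pos i); simpa using this
    · have := h2 (Fin.succ_lt_succ_iff.2 hij); simpa using this
  · rintro ⟨h1, h2, h3⟩
    refine ⟨?_, ?_⟩
    · intro i
      refine Fin.cases ?_ (fun i => ?_) i
      · simpa using h1
      · simpa using h1.trans (h2 i)
    · intro i j
      refine Fin.cases ?_ (fun i => ?_) i
      · refine Fin.cases ?_ (fun j => ?_) j
        · intro h; exact absurd h (lt_irrefl _)
        · intro _; simpa using h2 j
      · refine Fin.cases ?_ (fun j => ?_) j
        · intro h; exact absurd h (Fin.not_lt_zero _)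
        · intro h; simpa using h3 (Fin.succ_lt_succ_iff.1 h)

lemma ord_meas : ∀ (k : ℕ) (a : Fin k → ℝ) (_ : ∀ i, 0 < a i) (s : ℝ) (_ : 0 ≤ s),
    Measure.pi (fun i => expMeasure (a i)) {x : Fin k → ℝ | (∀ i, s < x i) ∧ StrictMono x} =
      ENNReal.ofReal (Real.exp (-(s * ∑ i, a i)) *
        ∏ i, a i / ∑ j, if i ≤ j then a j else 0) := by
  intro k
  induction k with
  | zero =>
    intro a ha s hs
    have : {x : Fin 0 → ℝ | (∀ i, s < x i) ∧ StrictMono x} = Set.univ := by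
      ext x; simp [StrictMono]
    rw [this]
    have : IsProbabilityMeasure (Measure.pi fun i : Fin 0 => expMeasure (a i)) := by
      have : ∀ i, IsProbabilityMeasure (expMeasure (a i)) :=
        fun i => isProbabilityMeasure_expMeasure (ha i)
      infer_instance
    simp
  | succ k ih =>
    intro a ha s hs
    have hpr : ∀ i, IsProbabilityMeasure (expMeasure (a i)) :=
        fun i => isProbabilityMeasure_expMeasure (ha i)
    have hmp := (measurePreserving_piFinSuccAbove (fun i => expMeasure (a i)) 0).symm
    have hms := ord_measurable (k := k + 1) s
    rw [← hmp.measure_preimage hms.nullMeasurableSet]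
    rw [Measure.prod_apply (hmp.measurable hms)]
    have e : ∀ x0 : ℝ, (Measure.pi fun j : Fin k => expMeasure (a (Fin.succAbove 0 j)))
        (Prod.mk x0 ⁻¹' ((MeasurableEquiv.piFinSuccAbove (fun _ => ℝ) 0).symm ⁻¹'
          {x : Fin (k + 1) → ℝ | (∀ i, s < x i) ∧ StrictMono x})) =
        (Set.Ioi s).indicator (fun x0 => ENNReal.ofReal (Real.exp (-(x0 * ∑ i : Fin k, a i.succ)) *
        ∏ i : Fin k, a i.succ / ∑ j : Fin k, if i ≤ j then a j.succ else 0)) x0 := by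
      intro x0
      have e2 : (Prod.mk x0 ⁻¹' ((MeasurableEquiv.piFinSuccAbove (fun _ => ℝ) 0).symm ⁻¹'
          {x : Fin (k + 1) → ℝ | (∀ i, s < x i) ∧ StrictMono x})) =
          {x : Fin k → ℝ | s < x0 ∧ (∀ i, x0 < x i) ∧ StrictMono x} := by
        ext x
        have : (MeasurableEquiv.piFinSuccAbove (fun _ => ℝ) 0).symm (x0, x) =
          (Fin.cons x0 x : Fin (k + 1) → ℝ) := by
          simp [MeasurableEquiv.piFinSuccAbove, Fin.insertNthEquiv, Fin.insertNth_zero']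
        simp only [Set.mem_preimage, Set.mem_ofPred_eq]
        rw [this, ord_cons]
      rw [e2]
      by_cases h : s < x0
      · rw [Set.indicator_of_mem (Set.mem_Ioi.2 h)]
        have := ih (fun i => a i.succ) (fun i => ha _) x0 (hs.trans h.le)
        simpa [h] using this
      · rw [Set.indicator_of_notMem (by simpa using h)]
        simp [h]
    rw [lintegral_congr e, lintegral_indicator measurableSet_Ioi]
    have hP : 0 ≤ ∏ i : Fin k, a i.succ / ∑ j : Fin k, if i ≤ j then a j.succ else 0 := by
      refine Finset.prod_nonneg fun i _ => div_nonneg (ha _).le (Finset.sum_nonneg fun j _ => ?_)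
      split_ifs
      · exact (ha _).le
      · exact le_rfl
    have hsum : 0 ≤ ∑ i : Fin k, a i.succ := Finset.sum_nonneg fun i _ => (ha _).le
    simp only [ENNReal.ofReal_mul (Real.exp_nonneg _)]
    rw [lintegral_mul_const _ (by fun_prop), exp_lint (ha 0) hsum hs,
      ← ENNReal.ofReal_mul (by have := ha 0; positivity), ← ENNReal.ofReal_mul (Real.exp_nonneg _)]
    congr 1
    rw [Fin.prod_univ_succ, Fin.sum_univ_succ]
    have e3 : (∑ j : Fin (k + 1), if (0 : Fin (k + 1)) ≤ j then a j else 0) = a 0 + ∑ i : Fin k, a i.succ := by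
      rw [← Fin.sum_univ_succ]; simp
    have e4 : ∀ i : Fin k, (∑ j : Fin (k + 1), if i.succ ≤ j then a j else 0) =
        ∑ j : Fin k, if i ≤ j then a j.succ else 0 := by
      intro i
      rw [Fin.sum_univ_succ]
      simp [Fin.succ_le_succ_iff]
    rw [e3]
    simp only [e4]
    ring

end clock
end SB

namespace SB
section clock2
open ProbabilityTheory
variable {n : ℕ}

/-- Law of independent exponential clocks with rates `w i`. -/
noncomputable def cm (w : Fin n → ℝ) : Measure (Fin n → ℝ) :=
  Measure.pi fun i => expMeasure (w i)

lemma cm_prob {w : Fin n → ℝ} (hw : ∀ i, 0 < w i) : IsProbabilityMeasure (cm w) := by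
  have : ∀ i, IsProbabilityMeasure (expMeasure (w i)) :=
    fun i => isProbabilityMeasure_expMeasure (hw i)
  unfold cm
  infer_instance

lemma perm_measurable (σ : Equiv.Perm (Fin n)) :
    MeasurableSet {ω : Fin n → ℝ | StrictMono fun p => ω (σ p)} := by
  have : {ω : Fin n → ℝ | StrictMono fun p => ω (σ p)} =
      ⋂ i, ⋂ j, ⋂ (_ : i < j), {ω : Fin n → ℝ | ω (σ i) < ω (σ j)} := by
    ext x
    simp [StrictMono]
  rw [this]
  refine MeasurableSet.iInter fun i => MeasurableSet.iInter fun j => MeasurableSet.iInter fun _ => ?_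
  exact measurableSet_lt (by fun_prop) (by fun_prop)

lemma prk_le_cm {w : Fin n → ℝ} (hw : ∀ i, 0 < w i) (σ : Equiv.Perm (Fin n)) :
    ENNReal.ofReal (prk w n σ) ≤ cm w {ω : Fin n → ℝ | StrictMono fun p => ω (σ p)} := by
  have hpr : ∀ i, IsProbabilityMeasure (expMeasure (w i)) :=
    fun i => isProbabilityMeasure_expMeasure (hw i)
  have hmp := measurePreserving_piCongrLeft (fun i => expMeasure (w i)) σ
  unfold cm
  rw [← hmp.measure_preimage (perm_measurable σ).nullMeasurableSet]
  have h0 := ord_meas n (fun i => w (σ i)) (fun i => hw _) 0 le_rfl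
  have e : prk w n σ = Real.exp (-(0 * ∑ i, w (σ i))) *
        ∏ i, w (σ i) / ∑ j, if i ≤ j then w (σ j) else 0 := by
    simp only [zero_mul, neg_zero, Real.exp_zero, one_mul]
    unfold prk
    rw [← Fin.prod_univ_eq_prod_range (fun i => val w i σ / Rs w i σ) n]
    apply Finset.prod_congr rfl
    intro i _
    simp [val, Rs]
  rw [e, ← h0]
  apply measure_mono
  rintro x ⟨-, hx⟩
  have : (fun p => (MeasurableEquiv.piCongrLeft (fun _ => ℝ) σ) x (σ p)) = x := by
    funext p
    exact Equiv.piCongrLeft_apply_apply (fun _ => ℝ) σ x p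
  change StrictMono (fun p => (MeasurableEquiv.piCongrLeft (fun _ => ℝ) σ) x (σ p))
  rw [this]; exact hx

lemma perm_disj {σ τ : Equiv.Perm (Fin n)} {ω : Fin n → ℝ} (h1 : StrictMono fun p => ω (σ p))
    (h2 : StrictMono fun p => ω (τ p)) : σ = τ := by
  have hr : Set.range (fun p => ω (σ p)) = Set.range (fun p => ω (τ p)) := by
    ext x
    constructor
    · rintro ⟨p, rfl⟩; exact ⟨τ.symm (σ p), by simp⟩
    · rintro ⟨p, rfl⟩; exact ⟨σ.symm (τ p), by simp⟩
  have h3 := (StrictMono.range_inj h1 h2).1 hr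
  have hinj : Function.Injective ω := by
    intro a b hab
    have := h1.injective (a₁ := σ.symm a) (a₂ := σ.symm b) (by simpa using hab)
    exact σ.symm.injective this
  ext p
  have := hinj (congrFun h3 p)
  rw [this]

lemma Pr_le_clock {w : Fin n → ℝ} (hw : ∀ i, 0 < w i) (B : Set (Equiv.Perm (Fin n)))
    (bad : Set (Fin n → ℝ)) (h : ∀ σ ∈ B, ∀ ω : Fin n → ℝ, (StrictMono fun p => ω (σ p)) → ω ∈ bad) :
    Pr w B ≤ (cm w).real bad := by
  have := cm_prob hw
  have h1 : ENNReal.ofReal (Pr w B) ≤ cm w bad := by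
    calc ENNReal.ofReal (Pr w B) = ∑ σ ∈ Finset.univ.filter (· ∈ B), ENNReal.ofReal (prk w n σ) := by
          rw [← ENNReal.ofReal_sum_of_nonneg fun σ _ => prk_nonneg hw n σ]
          unfold Pr Ex
          rw [Finset.sum_filter]
          congr 1
          apply Finset.sum_congr rfl
          intro σ _
          by_cases hs : σ ∈ B <;> simp [hs]
      _ ≤ ∑ σ ∈ Finset.univ.filter (· ∈ B), cm w {ω : Fin n → ℝ | StrictMono fun p => ω (σ p)} :=
          Finset.sum_le_sum fun σ _ => prk_le_cm hw σ
      _ = cm w (⋃ σ ∈ Finset.univ.filter (· ∈ B), {ω : Fin n → ℝ | StrictMono fun p => ω (σ p)}) := by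
          rw [measure_biUnion_finset]
          · intro σ _ τ _ hne
            rw [Function.onFun, Set.disjoint_left]
            intro ω h1 h2
            exact hne (perm_disj h1 h2)
          · intro σ _; exact perm_measurable σ
      _ ≤ cm w bad := by
          apply measure_mono
          intro ω hω
          simp only [Set.mem_iUnion, Finset.mem_filter, Finset.mem_univ, true_and] at hω
          obtain ⟨σ, hσ, hm⟩ := hω
          exact h σ hσ ω hm
  rw [Measure.real]
  rw [← ENNReal.ofReal_le_iff_le_toReal (measure_ne_top _ _)]
  exact h1

/-- Total `a`-mass of clocks which ring after `t`. -/
noncomputable def Yc (a : Fin n → ℝ) (t : ℝ) (ω : Fin n → ℝ) : ℝ := ∑ i, if t < ω i then a i else 0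

/-- mean of `Yc` -/
noncomputable def Yb (w a : Fin n → ℝ) (t : ℝ) : ℝ := ∑ i, a i * Real.exp (-(w i * t))

lemma Yc_perm (a : Fin n → ℝ) (t : ℝ) (ω : Fin n → ℝ) (σ : Equiv.Perm (Fin n)) :
    Yc a t ω = ∑ p, if t < ω (σ p) then a (σ p) else 0 :=
  (Equiv.sum_comp σ (fun i => if t < ω i then a i else 0)).symm

lemma trans_le {a : Fin n → ℝ} (ha : ∀ i, 0 ≤ a i) {t : ℝ} {ω : Fin n → ℝ} {σ : Equiv.Perm (Fin n)}
    (hσ : StrictMono fun p => ω (σ p)) {k : ℕ} (hk : k ≤ n) (hc : (n : ℝ) - k ≤ Yc (fun _ => 1) t ω) :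
    Rs a k σ ≤ Yc a t ω := by
  rw [Yc_perm a t ω σ]
  unfold Rs
  apply Finset.sum_le_sum
  intro p _
  have key : k ≤ p.1 → t < ω (σ p) := by
    intro hkp
    by_contra hcon
    rw [Yc_perm _ t ω σ, ← Finset.sum_filter, Finset.sum_const, nsmul_eq_mul, mul_one] at hc
    have hsub : (Finset.univ.filter fun q : Fin n => t < ω (σ q)) ⊆ Finset.univ.filter fun q => p < q := by
      intro q hq
      simp only [Finset.mem_filter, Finset.mem_univ, true_and] at hq ⊢
      by_contra hqp
      have := hσ.monotone (not_lt.1 hqp)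
      linarith
    have h1 := Finset.card_le_card hsub
    have h2 : (Finset.univ.filter fun q : Fin n => p < q).card = n - 1 - p.1 := by
      have : (Finset.univ.filter fun q : Fin n => p < q) = Finset.Ioi p := by ext; simp
      rw [this, Fin.card_Ioi]
    have h3 : n ≤ (Finset.univ.filter fun q : Fin n => t < ω (σ q)).card + k := by
      have : (n : ℝ) ≤ (Finset.univ.filter fun q : Fin n => t < ω (σ q)).card + k := by linarith
      exact_mod_cast this
    have := p.2
    omega
  by_cases h : k ≤ p.1
  · rw [if_pos h, if_pos (key h)]
  · rw [if_neg h]; split_ifs; exacts [ha _, le_rfl]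

lemma trans_ge {a : Fin n → ℝ} (ha : ∀ i, 0 ≤ a i) {t : ℝ} {ω : Fin n → ℝ} {σ : Equiv.Perm (Fin n)}
    (hσ : StrictMono fun p => ω (σ p)) {k : ℕ} (hk : k ≤ n) (hc : Yc (fun _ => 1) t ω ≤ (n : ℝ) - k) :
    Yc a t ω ≤ Rs a k σ := by
  rw [Yc_perm a t ω σ]
  unfold Rs
  apply Finset.sum_le_sum
  intro p _
  have key : t < ω (σ p) → k ≤ p.1 := by
    intro htp
    by_contra hcon
    rw [Yc_perm _ t ω σ, ← Finset.sum_filter, Finset.sum_const, nsmul_eq_mul, mul_one] at hc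
    have hsub : (Finset.univ.filter fun q : Fin n => p ≤ q) ⊆ Finset.univ.filter fun q => t < ω (σ q) := by
      intro q hq
      simp only [Finset.mem_filter, Finset.mem_univ, true_and] at hq ⊢
      have := hσ.monotone hq
      linarith
    have h1 := Finset.card_le_card hsub
    have h2 : (Finset.univ.filter fun q : Fin n => p ≤ q).card = n - p.1 := by
      have : (Finset.univ.filter fun q : Fin n => p ≤ q) = Finset.Ici p := by ext; simp
      rw [this, Fin.card_Ici]
    have h3 : (Finset.univ.filter fun q : Fin n => t < ω (σ q)).card + k ≤ n := by
      have : ((Finset.univ.filter fun q : Fin n => t < ω (σ q)).card : ℝ) + k ≤ n := by linarith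
      exact_mod_cast this
    have := p.2
    omega
  by_cases h : t < ω (σ p)
  · rw [if_pos h, if_pos (key h)]
  · rw [if_neg h]; split_ifs; exacts [ha _, le_rfl]

end clock2
end SB

namespace SB
section clock3
open ProbabilityTheory
variable {n : ℕ}

lemma exp_tail_real {a t : ℝ} (ha : 0 < a) (ht : 0 ≤ t) (u v : ℝ) :
    ∫ x, (if t < x then u else v) ∂expMeasure a =
      Real.exp (-(a * t)) * u + (1 - Real.exp (-(a * t))) * v := by
  have := isProbabilityMeasure_expMeasure ha
  have h1 : (expMeasure a).real (Set.Ioi t) = Real.exp (-(a * t)) := by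
    rw [Measure.real, exp_tail ha ht, ENNReal.toReal_ofReal (Real.exp_nonneg _)]
  have e : (fun x : ℝ => if t < x then u else v) =
      fun x => (Set.Ioi t).indicator (fun _ => u - v) x + v := by
    funext x
    by_cases h : t < x
    · simp [h]
    · simp [h]
  rw [e, integral_add ((integrable_const _).indicator measurableSet_Ioi) (integrable_const _),
    integral_indicator_const _ measurableSet_Ioi, h1]
  simp
  ring

lemma clock_prod {w : Fin n → ℝ} (hw : ∀ i, 0 < w i) {t : ℝ} (ht : 0 ≤ t) (u v : Fin n → ℝ) :
    ∫ ω, ∏ i, (if t < ω i then u i else v i) ∂cm w =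
      ∏ i, (Real.exp (-(w i * t)) * u i + (1 - Real.exp (-(w i * t))) * v i) := by
  have : ∀ i, IsProbabilityMeasure (expMeasure (w i)) :=
    fun i => isProbabilityMeasure_expMeasure (hw i)
  unfold cm
  rw [integral_fintype_prod_eq_prod (μ := fun i => expMeasure (w i))
    (f := fun i x => if t < x then u i else v i)]
  apply Finset.prod_congr rfl
  intro i _
  exact exp_tail_real (hw i) ht _ _

lemma clock_markov {w : Fin n → ℝ} (hw : ∀ i, 0 < w i) {t : ℝ} (ht : 0 ≤ t) (u v : Fin n → ℝ)
    (x : ℝ)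
    (q : Fin n → ℝ) (hq : ∀ i, Real.exp (-(w i * t)) * Real.exp (u i) +
      (1 - Real.exp (-(w i * t))) * Real.exp (v i) ≤ Real.exp (q i)) :
    (cm w).real {ω | x ≤ ∑ i, if t < ω i then u i else v i} ≤ Real.exp (∑ i, q i - x) := by
  have := cm_prob hw
  have hp : ∀ i, Real.exp (-(w i * t)) ≤ 1 := fun i => by
    rw [Real.exp_le_one_iff]; nlinarith [mul_nonneg (hw i).le ht]
  have hm : Measurable fun ω : Fin n → ℝ => ∏ i, (if t < ω i then Real.exp (u i) else Real.exp (v i)) := by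
    apply Finset.measurable_prod
    intro i _
    exact Measurable.ite (measurableSet_lt measurable_const (measurable_pi_apply i)) measurable_const
      measurable_const
  have hi : Integrable (fun ω : Fin n → ℝ => ∏ i, (if t < ω i then Real.exp (u i) else Real.exp (v i)))
      (cm w) := by
    refine Integrable.of_bound hm.aestronglyMeasurable
      (∏ i, max (Real.exp (u i)) (Real.exp (v i))) (ae_of_all _ fun ω => ?_)
    rw [Real.norm_eq_abs, abs_of_nonneg]
    · apply Finset.prod_le_prod
      · intro i _; split_ifs <;> positivity
      · intro i _; split_ifs; exacts [le_max_left _ _, le_max_right _ _]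
    · apply Finset.prod_nonneg; intro i _; split_ifs <;> positivity
  have h0 := mul_meas_ge_le_integral_of_nonneg (μ := cm w)
    (f := fun ω : Fin n → ℝ => ∏ i, (if t < ω i then Real.exp (u i) else Real.exp (v i)))
    (ae_of_all _ fun ω => Finset.prod_nonneg fun i _ => by split_ifs <;> positivity) hi (Real.exp x)
  rw [clock_prod hw ht] at h0
  have h2 : ∏ i, (Real.exp (-(w i * t)) * Real.exp (u i) +
      (1 - Real.exp (-(w i * t))) * Real.exp (v i)) ≤ Real.exp (∑ i, q i) := by
    rw [Real.exp_sum]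
    apply Finset.prod_le_prod
    · intro i _
      have := hp i
      have h3 : 0 ≤ 1 - Real.exp (-(w i * t)) := by linarith
      positivity
    · intro i _; exact hq i
  have hs : {ω : Fin n → ℝ | x ≤ ∑ i, if t < ω i then u i else v i} =
      {ω : Fin n → ℝ | Real.exp x ≤ ∏ i, (if t < ω i then Real.exp (u i) else Real.exp (v i))} := by
    ext ω
    simp only [Set.mem_ofPred_eq]
    have : ∏ i, (if t < ω i then Real.exp (u i) else Real.exp (v i)) =
        Real.exp (∑ i, if t < ω i then u i else v i) := by
      rw [Real.exp_sum]
      apply Finset.prod_congr rfl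
      intro i _; split_ifs <;> rfl
    rw [this, Real.exp_le_exp]
  rw [hs, Real.exp_sub, le_div_iff₀ (Real.exp_pos _), mul_comm]
  exact h0.trans h2

/-- Bernstein bound for clocks, for coefficients of arbitrary sign. -/
lemma clock_bern {w : Fin n → ℝ} (hw : ∀ i, 0 < w i) {t : ℝ} (ht : 0 ≤ t) (b : Fin n → ℝ)
    (hb : ∀ i, |b i| ≤ 1) (x : ℝ) :
    (cm w).real {ω | x ≤ Yc b t ω - Yb w b t} ≤
      Real.exp (∑ i, b i ^ 2 * (Real.exp (-(w i * t)) * (1 - Real.exp (-(w i * t)))) - x) := by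
  have hs : ∀ ω : Fin n → ℝ, Yc b t ω - Yb w b t =
      ∑ i, if t < ω i then b i * (1 - Real.exp (-(w i * t))) else -(b i * Real.exp (-(w i * t))) := by
    intro ω
    unfold Yc Yb
    rw [← Finset.sum_sub_distrib]
    apply Finset.sum_congr rfl
    intro i _
    split_ifs <;> ring
  simp only [hs]
  refine clock_markov hw ht _ _ x _ fun i => ?_
  have hp0 := Real.exp_pos (-(w i * t))
  have hp1 : Real.exp (-(w i * t)) ≤ 1 := by
    rw [Real.exp_le_one_iff]; nlinarith [mul_nonneg (hw i).le ht]
  set p := Real.exp (-(w i * t))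
  have h1 : |b i * (1 - p)| ≤ 1 := by
    rw [abs_mul, abs_of_nonneg (by linarith : (0:ℝ) ≤ 1 - p)]
    exact mul_le_one₀ (hb i) (by linarith) (by linarith)
  have h2 : |-(b i * p)| ≤ 1 := by
    rw [abs_neg, abs_mul, abs_of_nonneg hp0.le]
    exact mul_le_one₀ (hb i) hp0.le hp1
  have e1 := exp_le_quad h1
  have e2 := exp_le_quad h2
  have e3 := Real.add_one_le_exp (b i ^ 2 * (p * (1 - p)))
  have e4 := mul_le_mul_of_nonneg_left e1 hp0.le
  have e5 := mul_le_mul_of_nonneg_left e2 (by linarith : (0:ℝ) ≤ 1 - p)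
  refine le_trans (add_le_add e4 e5) (le_trans (le_of_eq ?_) e3)
  ring

lemma Yc_mul (c : ℝ) (a : Fin n → ℝ) (t : ℝ) (ω : Fin n → ℝ) :
    Yc (fun i => c * a i) t ω = c * Yc a t ω := by
  unfold Yc; rw [Finset.mul_sum]
  apply Finset.sum_congr rfl; intro i _; split_ifs <;> simp

lemma Yb_mul (w : Fin n → ℝ) (c : ℝ) (a : Fin n → ℝ) (t : ℝ) :
    Yb w (fun i => c * a i) t = c * Yb w a t := by
  unfold Yb; rw [Finset.mul_sum]
  apply Finset.sum_congr rfl; intro i _; ring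

/-- upper tail -/
lemma clock_up {w : Fin n → ℝ} (hw : ∀ i, 0 < w i) {t : ℝ} (ht : 0 ≤ t) (a : Fin n → ℝ)
    {lam : ℝ} (hl : 0 < lam) (ha : ∀ i, lam * |a i| ≤ 1) (x V : ℝ)
    (hV : ∑ i, a i ^ 2 * (Real.exp (-(w i * t)) * (1 - Real.exp (-(w i * t)))) ≤ V) :
    (cm w).real {ω | Yb w a t + x ≤ Yc a t ω} ≤ Real.exp (-(lam * x - lam ^ 2 * V)) := by
  have := cm_prob hw
  have h := clock_bern hw ht (fun i => lam * a i)
    (fun i => by rw [abs_mul, abs_of_pos hl]; exact ha i) (lam * x)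
  refine (measureReal_mono ?_).trans (h.trans ?_)
  · intro ω hω
    simp only [Set.mem_ofPred_eq, Yc_mul, Yb_mul] at hω ⊢
    have := mul_le_mul_of_nonneg_left hω hl.le
    linarith
  · rw [Real.exp_le_exp]
    have : ∑ i, (lam * a i) ^ 2 * (Real.exp (-(w i * t)) * (1 - Real.exp (-(w i * t)))) =
        lam ^ 2 * ∑ i, a i ^ 2 * (Real.exp (-(w i * t)) * (1 - Real.exp (-(w i * t)))) := by
      rw [Finset.mul_sum]; apply Finset.sum_congr rfl; intro i _; ring
    rw [this]
    have := mul_le_mul_of_nonneg_left hV (sq_nonneg lam)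
    linarith

/-- lower tail -/
lemma clock_dn {w : Fin n → ℝ} (hw : ∀ i, 0 < w i) {t : ℝ} (ht : 0 ≤ t) (a : Fin n → ℝ)
    {lam : ℝ} (hl : 0 < lam) (ha : ∀ i, lam * |a i| ≤ 1) (x V : ℝ)
    (hV : ∑ i, a i ^ 2 * (Real.exp (-(w i * t)) * (1 - Real.exp (-(w i * t)))) ≤ V) :
    (cm w).real {ω | Yc a t ω ≤ Yb w a t - x} ≤ Real.exp (-(lam * x - lam ^ 2 * V)) := by
  have := cm_prob hw
  have h := clock_up hw ht (fun i => (-1) * a i) hl (fun i => by simpa using ha i) x V (by simpa using hV)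
  refine (measureReal_mono ?_).trans h
  intro ω hω
  simp only [Set.mem_ofPred_eq, Yc_mul, Yb_mul] at hω ⊢
  linarith

/-- exponential moment for nonnegative large coefficients -/
lemma clock_heavy {w : Fin n → ℝ} (hw : ∀ i, 0 < w i) {t : ℝ} (ht : 0 ≤ t) (S : Fin n → Prop) (x : ℝ) :
    (cm w).real {ω | x ≤ Yc (fun i => if S i then w i else 0) t ω} ≤
      Real.exp (∑ i, (if S i then Real.exp (-(w i * t / 2)) else 0) - t / 2 * x) := by
  have := cm_prob hw
  have h := clock_markov hw ht (fun i => if S i then w i * t / 2 else 0) (fun _ => 0) (t / 2 * x)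
    (fun i => if S i then Real.exp (-(w i * t / 2)) else 0) (fun i => by
      by_cases hs : S i
      · simp only [hs, if_true, Real.exp_zero, mul_one]
        have e3 := Real.add_one_le_exp (Real.exp (-(w i * t / 2)))
        have e4 : Real.exp (-(w i * t)) * Real.exp (w i * t / 2) = Real.exp (-(w i * t / 2)) := by
          rw [← Real.exp_add]; congr 1; ring
        have := Real.exp_pos (-(w i * t))
        linarith
      · simp [hs])
  refine (measureReal_mono ?_).trans h
  intro ω hω
  simp only [Set.mem_ofPred_eq] at hω ⊢
  have h1 := mul_le_mul_of_nonneg_left hω (by linarith : (0:ℝ) ≤ t / 2)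
  refine h1.trans (le_of_eq ?_)
  unfold Yc
  rw [Finset.mul_sum]
  apply Finset.sum_congr rfl
  intro i _
  by_cases h1 : t < ω i
  · by_cases h2 : S i
    · simp only [h1, h2, if_true]; ring
    · simp [h1, h2]
  · simp [h1]

end clock3
end SB

namespace SB
section lemY
variable {n : ℕ}

lemma val_sum_le_Rs {f : Fin n → ℝ} (hf : ∀ i, 0 ≤ f i) (j k : ℕ) (hj : j ≤ n) (hk : k ≤ n)
    (σ : Equiv.Perm (Fin n)) : ∑ p ∈ Finset.Ico j k, val f p σ ≤ Rs f j σ := by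
  rcases le_total j k with h | h
  · rw [Finset.sum_Ico_eq_sub _ h]
    have h1 := Rs_eq f j hj σ
    have h2 := Rs_eq f k hk σ
    have h3 := Rs_nonneg hf k σ
    unfold Sm at h1 h2
    linarith
  · rw [Finset.Ico_eq_empty_of_le h]; simpa using Rs_nonneg hf j σ

lemma lemY {w : Fin n → ℝ} (hw : ∀ i, 0 < w i) {f g hv : Fin n → ℝ} (hsum : ∀ i, w i = g i + f i + hv i)
    (hf : ∀ i, 0 ≤ f i) (hg : ∀ i, 0 ≤ g i) (hhv : ∀ i, 0 ≤ hv i) {a γ h ρ Ψ D S p y c : ℝ}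
    (ha : 0 ≤ a) (hγ : 0 ≤ γ) (hρ : 0 ≤ ρ) (hΨ : 0 ≤ Ψ)
    (hfa : ∀ i, f i ≤ a) (hgγ : ∀ i, g i ≤ γ) (L K : ℕ) (hLK : L ≤ K) (hK : K ≤ n)
    (hD : (K : ℝ) - L ≤ D) (hS : ∑ i, w i ≤ S) (J : ℕ → Prop)
    (r : ℕ → ℝ)
    (hr : ∀ j, L ≤ j → j < K → J j → 0 ≤ r j ∧ r j ≤ a)
    (B : Set (Equiv.Perm (Fin n))) (hp : Pr w B ≤ p)
    (H1 : ∀ σ, σ ∉ B → Rs hv L σ ≤ h)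
    (H2 : ∀ σ, σ ∉ B → ∀ j, L ≤ j → j < K → J j → |Dr w f j σ - r j| ≤ ρ)
    (H3 : ∀ σ, σ ∉ B → ∀ j, L ≤ j → j < K → ¬ J j → Rs f j σ ≤ Ψ)
    (hy : 2 * (D * γ + h + D * ρ + Ψ) + (S + D * a) * p < y / 4)
    (hc : 0 < c) (hca : c * a ≤ 1) :
    Pr w {σ | ∃ k, L ≤ k ∧ k ≤ K ∧ y / 2 ≤ |Dev w L k σ|} ≤
      p + 2 * Real.exp (-(c * (y / 4) - c ^ 2 * (D * a ^ 2))) := by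
  have hLn : L ≤ n := hLK.trans hK
  have hD0 : 0 ≤ D := le_trans (sub_nonneg.2 (by exact_mod_cast hLK)) hD
  have hS0 : 0 ≤ S := le_trans (Finset.sum_nonneg fun i _ => (hw i).le) hS
  have hcard : ∀ k, L ≤ k → k ≤ K → ((Finset.Ico L k).card : ℝ) ≤ D := by
    intro k h1 h2
    rw [Nat.card_Ico, Nat.cast_sub h1]
    have : (k : ℝ) ≤ K := by exact_mod_cast h2
    linarith
  let J1 : ℕ → Prop := fun j => L ≤ j ∧ J j
  -- the error
  let E : ℕ → Equiv.Perm (Fin n) → ℝ := fun k σ =>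
    ∑ j ∈ Finset.Ico L k, val g j σ + ∑ j ∈ Finset.Ico L k, val hv j σ +
      ∑ j ∈ Finset.Ico L k, (if J j then Dr w f j σ - r j else 0) +
      ∑ j ∈ Finset.Ico L k, (if J j then 0 else val f j σ)
  have hMt : ∀ k σ, L ≤ k → Mt w f J1 k σ =
      ∑ j ∈ Finset.Ico L k, if J j then val f j σ - Dr w f j σ else 0 := by
    intro k σ hk
    unfold Mt
    have : Finset.Ico L k = (Finset.range k).filter (fun j => L ≤ j) := by
      ext j; simp; tauto
    rw [this, Finset.sum_filter]
    apply Finset.sum_congr rfl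
    intro j _
    by_cases h1 : L ≤ j <;> by_cases h2 : J j <;> simp [J1, h1, h2]
  have hdec : ∀ k σ, L ≤ k → Sm w k σ - Sm w L σ =
      Mt w f J1 k σ + E k σ + ∑ j ∈ Finset.Ico L k, if J j then r j else 0 := by
    intro k σ hk
    rw [hMt k σ hk]
    unfold Sm
    rw [← Finset.sum_Ico_eq_sub _ hk]
    simp only [E]
    simp only [← Finset.sum_add_distrib]
    apply Finset.sum_congr rfl
    intro j _
    have : val w j σ = val g j σ + val f j σ + val hv j σ := by
      rw [← val_add, ← val_add]; congr 1; funext i; exact hsum i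
    rw [this]
    split_ifs <;> ring
  -- good bound
  have hgood : ∀ σ, σ ∉ B → ∀ k, L ≤ k → k ≤ K → |E k σ| ≤ D * γ + h + D * ρ + Ψ := by
    intro σ hσ k h1 h2
    have b1 : |∑ j ∈ Finset.Ico L k, val g j σ| ≤ D * γ := by
      rw [abs_of_nonneg (Finset.sum_nonneg fun j _ => val_nonneg hg j σ)]
      calc _ ≤ ∑ j ∈ Finset.Ico L k, γ := Finset.sum_le_sum fun j _ => val_le hγ hgγ j σ
        _ = ((Finset.Ico L k).card : ℝ) * γ := by rw [Finset.sum_const, nsmul_eq_mul]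
        _ ≤ D * γ := mul_le_mul_of_nonneg_right (hcard k h1 h2) hγ
    have b2 : |∑ j ∈ Finset.Ico L k, val hv j σ| ≤ h := by
      rw [abs_of_nonneg (Finset.sum_nonneg fun j _ => val_nonneg hhv j σ)]
      exact (val_sum_le_Rs hhv L k hLn (h2.trans hK) σ).trans (H1 σ hσ)
    have b3 : |∑ j ∈ Finset.Ico L k, (if J j then Dr w f j σ - r j else 0)| ≤ D * ρ := by
      refine (Finset.abs_sum_le_sum_abs _ _).trans ?_
      calc _ ≤ ∑ j ∈ Finset.Ico L k, ρ := Finset.sum_le_sum fun j hj => by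
              rw [Finset.mem_Ico] at hj
              split_ifs with hJj
              · exact H2 σ hσ j hj.1 (by omega) hJj
              · simpa using hρ
        _ = ((Finset.Ico L k).card : ℝ) * ρ := by rw [Finset.sum_const, nsmul_eq_mul]
        _ ≤ D * ρ := mul_le_mul_of_nonneg_right (hcard k h1 h2) hρ
    have b4 : |∑ j ∈ Finset.Ico L k, (if J j then 0 else val f j σ)| ≤ Ψ := by
      rw [abs_of_nonneg (Finset.sum_nonneg fun j _ => by
        split_ifs; exacts [le_rfl, val_nonneg hf j σ])]
      by_cases hex : ∃ j, L ≤ j ∧ j < k ∧ ¬ J j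
      · have hm := Nat.find_spec hex
        set j1 := Nat.find hex
        have hmin : ∀ j, L ≤ j → j < j1 → J j := by
          intro j hj hj1
          have := Nat.find_min hex hj1
          by_contra hcon
          exact this ⟨hj, by omega, hcon⟩
        rw [← Finset.sum_Ico_consecutive _ hm.1 hm.2.1.le]
        have z1 : ∑ j ∈ Finset.Ico L j1, (if J j then 0 else val f j σ) = 0 := by
          apply Finset.sum_eq_zero
          intro j hj
          rw [Finset.mem_Ico] at hj
          rw [if_pos (hmin j hj.1 hj.2)]
        rw [z1, zero_add]
        refine le_trans (Finset.sum_le_sum (g := fun j => val f j σ) fun j _ => ?_) 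
          ((val_sum_le_Rs hf j1 k (by omega) (h2.trans hK) σ).trans
          (H3 σ hσ j1 hm.1 (by omega) hm.2.2))
        split_ifs; exacts [val_nonneg hf j σ, le_rfl]
      · push Not at hex
        refine le_trans (le_of_eq (Finset.sum_eq_zero ?_)) hΨ
        intro j hj
        rw [Finset.mem_Ico] at hj
        rw [if_pos (hex j hj.1 hj.2)]
    refine (abs_add_le _ _).trans (add_le_add ((abs_add_le _ _).trans (add_le_add
      ((abs_add_le _ _).trans (add_le_add b1 b2)) b3)) b4)
  -- crude bound
  have hcr : ∀ σ k, L ≤ k → k ≤ K → |E k σ| ≤ S + D * a := by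
    intro σ k h1 h2
    have b3 : |∑ j ∈ Finset.Ico L k, (if J j then Dr w f j σ - r j else 0)| ≤ D * a := by
      refine (Finset.abs_sum_le_sum_abs _ _).trans ?_
      calc _ ≤ ∑ j ∈ Finset.Ico L k, a := Finset.sum_le_sum fun j hj => by
              rw [Finset.mem_Ico] at hj
              split_ifs with hJj
              · have e1 := hr j hj.1 (by omega) hJj
                have e2 := Dr_nonneg hw hf j σ
                have e3 := Dr_le_const hw ha hfa j σ
                rw [abs_le]; constructor <;> linarith
              · simpa using ha
        _ = ((Finset.Ico L k).card : ℝ) * a := by rw [Finset.sum_const, nsmul_eq_mul]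
        _ ≤ D * a := mul_le_mul_of_nonneg_right (hcard k h1 h2) ha
    have b0 : ∑ j ∈ Finset.Ico L k, val g j σ + ∑ j ∈ Finset.Ico L k, val hv j σ +
      ∑ j ∈ Finset.Ico L k, (if J j then 0 else val f j σ) ≤ S := by
      rw [← Finset.sum_add_distrib, ← Finset.sum_add_distrib]
      refine le_trans (Finset.sum_le_sum (g := fun j => val w j σ) fun j _ => ?_) 
        ((val_sum_le_Rs (fun i => (hw i).le) L k hLn (h2.trans hK) σ).trans
          ((Rs_le_sum (fun i => (hw i).le) L σ).trans hS))
      have : val w j σ = val g j σ + val f j σ + val hv j σ := by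
        rw [← val_add, ← val_add]; congr 1; funext i; exact hsum i
      have e := val_nonneg hf j σ
      rw [this]
      split_ifs <;> linarith
    have n1 : 0 ≤ ∑ j ∈ Finset.Ico L k, val g j σ := Finset.sum_nonneg fun j _ => val_nonneg hg j σ
    have n2 : 0 ≤ ∑ j ∈ Finset.Ico L k, val hv j σ := Finset.sum_nonneg fun j _ => val_nonneg hhv j σ
    have n3 : 0 ≤ ∑ j ∈ Finset.Ico L k, (if J j then 0 else val f j σ) :=
      Finset.sum_nonneg fun j _ => by split_ifs; exacts [le_rfl, val_nonneg hf j σ]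
    rw [abs_le] at b3 ⊢
    simp only [E]
    constructor <;> linarith [b3.1, b3.2]
  set e0 := D * γ + h + D * ρ + Ψ with he0
  have hDev : ∀ σ, σ ∉ B → ∀ k, L ≤ k → k ≤ K → |Dev w L k σ| ≤
      |Mt w f J1 k σ| + (2 * e0 + (S + D * a) * p) := by
    intro σ hσ k h1 h2
    have e1 : Dev w L k σ = Mt w f J1 k σ + E k σ - Ex w (E k) := by
      unfold Dev
      rw [hdec k σ h1]
      have : (fun τ => Sm w k τ - Sm w L τ) = fun τ => Mt w f J1 k τ + (E k τ +
          ∑ j ∈ Finset.Ico L k, if J j then r j else 0) := by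
        funext τ; rw [hdec k τ h1]; ring
      rw [this, Ex_add, Ex_add, Ex_const w hw]
      have h0 : Ex w (fun σ => Mt w f J1 k σ) = 0 := Ex_Mt hw f _ k (by omega)
      rw [h0]; ring
    have e2 : |Ex w (E k)| ≤ e0 + (S + D * a) * p := by
      refine (Ex_abs_le hw _).trans ?_
      refine (Ex_le_of_bad hw B (fun σ => |E k σ|) e0 (S + D * a) ?_ ?_ ?_).trans ?_
      · exact le_trans (abs_nonneg _) (hgood σ hσ k h1 h2)
      · exact fun τ hτ => hgood τ hτ k h1 h2
      · first
          | exact fun τ _ => hcr τ k h1 h2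
          | exact fun τ => hcr τ k h1 h2
      · have := mul_le_mul_of_nonneg_left hp (add_nonneg hS0 (mul_nonneg hD0 ha))
        linarith
    have e3 := hgood σ hσ k h1 h2
    rw [e1]
    have e4 := abs_sub (Mt w f J1 k σ + E k σ) (Ex w (E k))
    have e5 := abs_add_le (Mt w f J1 k σ) (E k σ)
    linarith
  have hV : ∀ σ, ∑ j ∈ Finset.range K, (if J1 j then Dr w (fun i => f i ^ 2) j σ else 0) ≤ D * a ^ 2 := by
    intro σ
    have hle : ∀ i, (fun i => f i ^ 2) i ≤ a ^ 2 := fun i => pow_le_pow_left₀ (hf i) (hfa i) 2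
    calc _ ≤ ∑ j ∈ Finset.range K, (if L ≤ j then a ^ 2 else 0) := by
          apply Finset.sum_le_sum
          intro j _
          by_cases h1 : L ≤ j
          · rw [if_pos h1]
            split_ifs
            · exact Dr_le_const hw (sq_nonneg a) hle j σ
            · positivity
          · rw [if_neg h1, if_neg]; rintro ⟨h3, _⟩; exact h1 h3
      _ = ((Finset.Ico L K).card : ℝ) * a ^ 2 := by
          rw [← Finset.sum_filter, Finset.sum_const, nsmul_eq_mul]
          congr 3
          ext j; simp; tauto
      _ ≤ D * a ^ 2 := mul_le_mul_of_nonneg_right (hcard K hLK le_rfl) (sq_nonneg a)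
  have hM := two_sided hw f J1 c hc (fun i => by
    rw [abs_of_nonneg (mul_nonneg hc.le (hf i))]
    exact (mul_le_mul_of_nonneg_left (hfa i) hc.le).trans hca) K hK (D * a ^ 2)
    (fun σ => le_trans (le_of_eq (Finset.sum_congr rfl fun j _ => by congr)) (hV σ)) (y / 4)
  refine (Pr_mono hw (t := B ∪ {σ | ∃ k ≤ K, y / 4 ≤ |Mt w f J1 k σ|}) ?_).trans
    ((Pr_union hw _ _).trans (add_le_add hp hM))
  rintro σ ⟨k, h1, h2, h3⟩
  by_cases hσ : σ ∈ B
  · exact Or.inl hσ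
  · right
    refine ⟨k, h2, ?_⟩
    have := hDev σ hσ k h1 h2
    linarith

/-- Reduction of the window to positions at most `n`. -/
lemma Dev_cut (w : Fin n → ℝ) (L m : ℕ) (y : ℝ) (hy : 0 < y) (σ : Equiv.Perm (Fin n))
    (h : ∃ k, L ≤ k ∧ k ≤ m ∧ y / 2 ≤ |Dev w L k σ|) :
    L < n ∧ ∃ k, L ≤ k ∧ k ≤ min m n ∧ y / 2 ≤ |Dev w L k σ| := by
  obtain ⟨k, h1, h2, h3⟩ := h
  have hcut : ∀ k σ, n ≤ k → Sm w k σ = Sm w n σ := by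
    intro k σ hk
    unfold Sm
    rw [← Finset.sum_range_add_sum_Ico _ hk]
    have : ∑ p ∈ Finset.Ico n k, val w p σ = 0 := by
      apply Finset.sum_eq_zero
      intro p hp
      rw [Finset.mem_Ico] at hp
      unfold val
      rw [dif_neg (by omega)]
    rw [this, add_zero]
  by_cases hL : L < n
  · refine ⟨hL, ?_⟩
    by_cases hk : k ≤ n
    · exact ⟨k, h1, le_min h2 hk, h3⟩
    · refine ⟨n, hL.le, le_min (by omega) le_rfl, ?_⟩
      have : Dev w L k σ = Dev w L n σ := by
        unfold Dev
        have e : (fun τ => Sm w k τ - Sm w L τ) = fun τ => Sm w n τ - Sm w L τ := by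
          funext τ; rw [hcut k τ (by omega)]
        rw [e, hcut k σ (by omega)]
      rw [← this]; exact h3
  · exfalso
    have : Dev w L k σ = 0 := by
      unfold Dev
      have e : (fun τ => Sm w k τ - Sm w L τ) = fun τ => (0:ℝ) := by
        funext τ; rw [hcut k τ (by omega), hcut L τ (by omega), sub_self]
      rw [e, hcut k σ (by omega), hcut L σ (by omega)]
      unfold Ex
      simp
    rw [this, abs_zero] at h3
    linarith

end lemY
end SB

namespace SB
section lemG
variable {n : ℕ}

lemma Yb_nonneg (w : Fin n → ℝ) {a : Fin n → ℝ} (ha : ∀ i, 0 ≤ a i) (t : ℝ) : 0 ≤ Yb w a t :=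
  Finset.sum_nonneg fun i _ => mul_nonneg (ha i) (Real.exp_nonneg _)

lemma Yb_mono (w : Fin n → ℝ) {a b : Fin n → ℝ} (hab : ∀ i, a i ≤ b i) (t : ℝ) : Yb w a t ≤ Yb w b t :=
  Finset.sum_le_sum fun i _ => mul_le_mul_of_nonneg_right (hab i) (Real.exp_nonneg _)

lemma Yb_anti {w : Fin n → ℝ} (hw : ∀ i, 0 < w i) {a : Fin n → ℝ} (ha : ∀ i, 0 ≤ a i) {s t : ℝ}
    (hst : s ≤ t) : Yb w a t ≤ Yb w a s := by
  apply Finset.sum_le_sum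
  intro i _
  apply mul_le_mul_of_nonneg_left _ (ha i)
  rw [Real.exp_le_exp]
  have := mul_le_mul_of_nonneg_left hst (hw i).le
  linarith

lemma Yb_cont (w a : Fin n → ℝ) : Continuous (Yb w a) := by
  unfold Yb; fun_prop

/-- forward comparison, coefficients supported on weights at most `A` -/
lemma Yb_fwd {w : Fin n → ℝ} {c : Fin n → ℝ} (hc : ∀ i, 0 ≤ c i) {A : ℝ}
    (hcA : ∀ i, c i ≠ 0 → w i ≤ A) {s D : ℝ} (hD : 0 ≤ D) :
    (1 - A * D) * Yb w c s ≤ Yb w c (s + D) := by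
  unfold Yb
  rw [Finset.mul_sum]
  apply Finset.sum_le_sum
  intro i _
  by_cases h : c i = 0
  · simp [h]
  · have h1 := mul_le_mul_of_nonneg_right (hcA i h) hD
    have h2 := Real.add_one_le_exp (-(w i * D))
    have h3 : Real.exp (-(w i * (s + D))) = Real.exp (-(w i * s)) * Real.exp (-(w i * D)) := by
      rw [← Real.exp_add]; congr 1; ring
    rw [h3]
    have h4 : 1 - A * D ≤ Real.exp (-(w i * D)) := by linarith
    have h5 := mul_le_mul_of_nonneg_left h4 (mul_nonneg (hc i) (Real.exp_nonneg (-(w i * s))))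
    linarith

lemma exp_le_two {x : ℝ} (h0 : 0 ≤ x) (h1 : x ≤ 1) : Real.exp x ≤ 1 + 2 * x := by
  have := exp_le_quad (x := x) (by rw [abs_of_nonneg h0]; exact h1)
  nlinarith

/-- backward comparison -/
lemma Yb_bwd {w : Fin n → ℝ} {c : Fin n → ℝ} (hc : ∀ i, 0 ≤ c i) {A : ℝ}
    (hcA : ∀ i, c i ≠ 0 → w i ≤ A) {s D : ℝ} (hA : 0 ≤ A) (hD : 0 ≤ D) (hAD : A * D ≤ 1) :
    Yb w c (s - D) ≤ (1 + 2 * (A * D)) * Yb w c s := by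
  unfold Yb
  rw [Finset.mul_sum]
  apply Finset.sum_le_sum
  intro i _
  by_cases h : c i = 0
  · simp [h]
  · have h1 := mul_le_mul_of_nonneg_right (hcA i h) hD
    have h2 := exp_le_two (mul_nonneg hA hD) hAD
    have h6 := Real.exp_le_exp.2 h1
    have h3 : Real.exp (-(w i * (s - D))) = Real.exp (-(w i * s)) * Real.exp (w i * D) := by
      rw [← Real.exp_add]; congr 1; ring
    rw [h3]
    have h4 : Real.exp (w i * D) ≤ 1 + 2 * (A * D) := by linarith
    have h5 := mul_le_mul_of_nonneg_left h4 (mul_nonneg (hc i) (Real.exp_nonneg (-(w i * s))))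
    linarith

/-- weights truncated at `A` -/
noncomputable def wb (w : Fin n → ℝ) (A : ℝ) (i : Fin n) : ℝ := if w i ≤ A then w i else 0
/-- heavy weights -/
noncomputable def wh (w : Fin n → ℝ) (A : ℝ) (i : Fin n) : ℝ := if A < w i then w i else 0
/-- light weights -/
noncomputable def wf (w : Fin n → ℝ) (A : ℝ) (i : Fin n) : ℝ := if 1 / A < w i ∧ w i ≤ A then w i else 0
/-- square of light weights -/
noncomputable def wq (w : Fin n → ℝ) (A : ℝ) (i : Fin n) : ℝ := w i * wf w A i

lemma one_sub_exp_ge {x : ℝ} (h0 : 0 ≤ x) (h1 : x ≤ 1) : x / 2 ≤ 1 - Real.exp (-x) := by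
  have h2 : Real.exp (-x) ≤ 1 / (1 + x) := by
    rw [Real.exp_neg, inv_eq_one_div]
    apply one_div_le_one_div_of_le (by linarith)
    linarith [Real.add_one_le_exp x]
  have h3 : 1 / (1 + x) ≤ 1 - x / 2 := by
    rw [div_le_iff₀ (by linarith)]; nlinarith
  linarith

lemma nu_bwd {w : Fin n → ℝ} (hw : ∀ i, 0 < w i) {A : ℝ} {s D : ℝ} (hD : 0 ≤ D) :
    Yb w (fun _ => 1) s + D * Yb w (wb w A) s ≤ Yb w (fun _ => 1) (s - D) := by
  unfold Yb
  rw [Finset.mul_sum, ← Finset.sum_add_distrib]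
  apply Finset.sum_le_sum
  intro i _
  have h3 : Real.exp (-(w i * (s - D))) = Real.exp (-(w i * s)) * Real.exp (w i * D) := by
    rw [← Real.exp_add]; congr 1; ring
  rw [h3]
  have h1 := Real.add_one_le_exp (w i * D)
  have h2 := mul_le_mul_of_nonneg_left h1 (Real.exp_nonneg (-(w i * s)))
  unfold wb
  split_ifs
  · linarith
  · have := mul_nonneg (mul_nonneg (hw i).le hD) (Real.exp_nonneg (-(w i * s)))
    linarith

lemma nu_fwd {w : Fin n → ℝ} (hw : ∀ i, 0 < w i) {A : ℝ} {s D : ℝ} (hD : 0 ≤ D) (hAD : A * D ≤ 1) :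
    Yb w (fun _ => 1) (s + D) ≤ Yb w (fun _ => 1) s - D * Yb w (wb w A) s / 2 := by
  unfold Yb
  rw [mul_div_assoc, mul_comm, Finset.sum_div, Finset.sum_mul, ← Finset.sum_sub_distrib]
  apply Finset.sum_le_sum
  intro i _
  have h3 : Real.exp (-(w i * (s + D))) = Real.exp (-(w i * s)) * Real.exp (-(w i * D)) := by
    rw [← Real.exp_add]; congr 1; ring
  rw [h3]
  unfold wb
  have hwD := mul_nonneg (hw i).le hD
  split_ifs with h
  · have h1 := one_sub_exp_ge hwD ((mul_le_mul_of_nonneg_right h hD).trans hAD)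
    have h2 := mul_le_mul_of_nonneg_left h1 (Real.exp_nonneg (-(w i * s)))
    linarith
  · have h1 : Real.exp (-(w i * D)) ≤ 1 := by rw [Real.exp_le_one_iff]; linarith
    have h2 := mul_le_mul_of_nonneg_left h1 (Real.exp_nonneg (-(w i * s)))
    linarith

/-- good event at time `s` -/
def goodT (w : Fin n → ℝ) (A δ s : ℝ) (ω : Fin n → ℝ) : Prop :=
  Yb w (fun _ => 1) (s + δ / A) ≤ Yc (fun _ => 1) s ω ∧
  Yc (fun _ => 1) s ω ≤ Yb w (fun _ => 1) (s - δ / A) ∧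
  Yc (wb w A) s ω ≤ (1 + δ) * Yb w (wb w A) s ∧
  (1 - δ) * Yb w (wb w A) s ≤ Yc (wb w A) s ω ∧
  Yc (wq w A) s ω ≤ Yb w (wq w A) s + δ * Yb w (wb w A) s ∧
  Yb w (wq w A) s - δ * Yb w (wb w A) s ≤ Yc (wq w A) s ω

lemma wb_nonneg {w : Fin n → ℝ} (hw : ∀ i, 0 < w i) (A : ℝ) (i) : 0 ≤ wb w A i := by
  unfold wb; split_ifs; exacts [(hw i).le, le_rfl]
lemma wh_nonneg {w : Fin n → ℝ} (hw : ∀ i, 0 < w i) (A : ℝ) (i) : 0 ≤ wh w A i := by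
  unfold wh; split_ifs; exacts [(hw i).le, le_rfl]
lemma wf_nonneg {w : Fin n → ℝ} (hw : ∀ i, 0 < w i) (A : ℝ) (i) : 0 ≤ wf w A i := by
  unfold wf; split_ifs; exacts [(hw i).le, le_rfl]
lemma wq_nonneg {w : Fin n → ℝ} (hw : ∀ i, 0 < w i) (A : ℝ) (i) : 0 ≤ wq w A i :=
  mul_nonneg (hw i).le (wf_nonneg hw A i)
lemma wb_le {w : Fin n → ℝ} {A : ℝ} (hA : 0 ≤ A) (i) : wb w A i ≤ A := by
  unfold wb; split_ifs with h; exacts [h, hA]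
lemma wf_le_wb {w : Fin n → ℝ} (hw : ∀ i, 0 < w i) (A : ℝ) (i) : wf w A i ≤ wb w A i := by
  unfold wf wb
  split_ifs with h1 h2 h3
  · exact le_rfl
  · exact absurd h1.2 h2
  · exact (hw i).le
  · exact le_rfl
lemma wq_le_wb {w : Fin n → ℝ} (hw : ∀ i, 0 < w i) {A : ℝ} (hA : 0 ≤ A) (i) : wq w A i ≤ A * wb w A i := by
  unfold wq
  by_cases h : w i ≤ A
  · exact mul_le_mul h (wf_le_wb hw A i) (wf_nonneg hw A i) hA
  · have : wf w A i = 0 := by unfold wf; rw [if_neg]; tauto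
    rw [this, mul_zero]; exact mul_nonneg hA (wb_nonneg hw A i)

lemma wb_supp {w : Fin n → ℝ} {A : ℝ} (i) (h : wb w A i ≠ 0) : w i ≤ A := by
  unfold wb at h; by_contra hc; simp [hc] at h
lemma wf_supp {w : Fin n → ℝ} {A : ℝ} (i) (h : wf w A i ≠ 0) : w i ≤ A := by
  unfold wf at h; by_contra hc; simp [hc] at h
lemma wq_supp {w : Fin n → ℝ} {A : ℝ} (i) (h : wq w A i ≠ 0) : w i ≤ A :=
  wf_supp i (right_ne_zero_of_mul h)

lemma lemG {w : Fin n → ℝ} (hw : ∀ i, 0 < w i) {A δ s ψ E : ℝ} (hA : 1 ≤ A) (hδ : 0 < δ) (hδ1 : δ ≤ 1)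
    (hs : 0 ≤ s) (hs2 : s ≤ A ^ 2)
    (hH : ∑ i, (if A < w i then Real.exp (-(w i * s)) else 0) ≤ Yb w (wb w A) s)
    (hψ : ψ / 2 ≤ Yb w (wb w A) s) (hE : E ≤ δ ^ 2 * ψ / (64 * A ^ 4)) :
    (cm w).real {ω | ¬ goodT w A δ s ω} ≤ 6 * Real.exp (-E) := by
  have := cm_prob hw
  have hA0 : 0 < A := by linarith
  set lb := Yb w (wb w A) s with hlb
  have hlb0 : 0 ≤ lb := Yb_nonneg w (wb_nonneg hw A) s
  have hAD : A * (δ / A) = δ := by field_simp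
  have hD0 : 0 ≤ δ / A := by positivity
  have hE' : E ≤ δ ^ 2 * lb / (32 * A ^ 4) := by
    refine hE.trans ?_
    rw [div_le_div_iff₀ (by positivity) (by positivity)]
    have := mul_le_mul_of_nonneg_left hψ (by positivity : (0:ℝ) ≤ δ ^ 2 * A ^ 4)
    linarith only [this]
  have p1 : ∀ i, Real.exp (-(w i * s)) ≤ 1 := fun i => by
    rw [Real.exp_le_one_iff]; linarith [mul_nonneg (hw i).le hs]
  have hA2 : 1 ≤ A ^ 2 := one_le_pow₀ hA
  -- count
  have V1 : ∑ i, (fun _ : Fin n => (1:ℝ)) i ^ 2 * (Real.exp (-(w i * s)) * (1 - Real.exp (-(w i * s)))) ≤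
      2 * A ^ 2 * lb := by
    have : ∑ i, (fun _ : Fin n => (1:ℝ)) i ^ 2 * (Real.exp (-(w i * s)) * (1 - Real.exp (-(w i * s)))) ≤
        ∑ i, (s * (wb w A i * Real.exp (-(w i * s))) + if A < w i then Real.exp (-(w i * s)) else 0) := by
      apply Finset.sum_le_sum
      intro i _
      have e0 := Real.exp_nonneg (-(w i * s))
      have e1 := Real.add_one_le_exp (-(w i * s))
      unfold wb
      by_cases h : w i ≤ A
      · simp only [h, if_true, not_lt.2 h, if_false, one_pow, one_mul, add_zero]
        have := mul_le_mul_of_nonneg_left (by linarith : 1 - Real.exp (-(w i * s)) ≤ w i * s) e0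
        linarith
      · simp only [h, if_false, not_le.1 h, if_true, one_pow, one_mul, zero_mul, mul_zero, zero_add]
        have := mul_le_mul_of_nonneg_left (by linarith : 1 - Real.exp (-(w i * s)) ≤ 1) e0
        linarith
    refine this.trans ?_
    rw [Finset.sum_add_distrib, ← Finset.mul_sum]
    have e2 : ∑ i, wb w A i * Real.exp (-(w i * s)) = lb := rfl
    rw [e2]
    have e3 := mul_le_mul_of_nonneg_right hs2 hlb0
    have e4 := mul_le_mul_of_nonneg_right hA2 hlb0
    linarith
  have hl1 : 0 < δ / (8 * A ^ 3) := by positivity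
  have hl1' : ∀ i : Fin n, δ / (8 * A ^ 3) * |(fun _ : Fin n => (1:ℝ)) i| ≤ 1 := fun i => by
    simp only [abs_one, mul_one]
    rw [div_le_one (by positivity)]
    have : 1 ≤ A ^ 3 := one_le_pow₀ hA
    linarith
  have ex1 : E ≤ δ / (8 * A ^ 3) * (δ / A * lb / 2) - (δ / (8 * A ^ 3)) ^ 2 * (2 * A ^ 2 * lb) := by
    refine hE'.trans (le_of_eq ?_)
    field_simp
    ring
  have c1 := (clock_up hw hs (fun _ => 1) hl1 hl1' (δ / A * lb / 2) _ V1).trans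
    (Real.exp_le_exp.2 (neg_le_neg ex1))
  have c2 := (clock_dn hw hs (fun _ => 1) hl1 hl1' (δ / A * lb / 2) _ V1).trans
    (Real.exp_le_exp.2 (neg_le_neg ex1))
  -- weights
  have V2 : ∑ i, wb w A i ^ 2 * (Real.exp (-(w i * s)) * (1 - Real.exp (-(w i * s)))) ≤ A * lb := by
    rw [hlb, Yb, Finset.mul_sum]
    apply Finset.sum_le_sum
    intro i _
    have e0 := Real.exp_nonneg (-(w i * s))
    have b0 := wb_nonneg hw A i
    have b1 := wb_le (w := w) hA0.le i
    calc _ ≤ wb w A i ^ 2 * (Real.exp (-(w i * s)) * 1) := by gcongr; linarith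
      _ = wb w A i * (wb w A i * Real.exp (-(w i * s))) := by ring
      _ ≤ A * (wb w A i * Real.exp (-(w i * s))) := by gcongr
  have hl2 : 0 < δ / (2 * A) := by positivity
  have hl2' : ∀ i : Fin n, δ / (2 * A) * |wb w A i| ≤ 1 := fun i => by
    rw [abs_of_nonneg (wb_nonneg hw A i)]
    calc _ ≤ δ / (2 * A) * A := by gcongr; exact wb_le hA0.le i
      _ = δ / 2 := by field_simp
      _ ≤ 1 := by linarith
  have ex2 : E ≤ δ / (2 * A) * (δ * lb) - (δ / (2 * A)) ^ 2 * (A * lb) := by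
    have : δ / (2 * A) * (δ * lb) - (δ / (2 * A)) ^ 2 * (A * lb) = δ ^ 2 * lb / (4 * A) := by
      field_simp; ring
    rw [this]
    refine hE'.trans ?_
    apply div_le_div_of_nonneg_left (by positivity) (by positivity)
    have : A ^ 1 ≤ A ^ 4 := pow_le_pow_right₀ hA (by norm_num)
    linarith
  have c3 := (clock_up hw hs (wb w A) hl2 hl2' (δ * lb) _ V2).trans
    (Real.exp_le_exp.2 (neg_le_neg ex2))
  have c4 := (clock_dn hw hs (wb w A) hl2 hl2' (δ * lb) _ V2).trans
    (Real.exp_le_exp.2 (neg_le_neg ex2))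
  -- squares
  have q1 : ∀ i, wq w A i ≤ A ^ 2 := fun i => by
    refine (wq_le_wb hw hA0.le i).trans ?_
    rw [sq]; exact mul_le_mul_of_nonneg_left (wb_le hA0.le i) hA0.le
  have V3 : ∑ i, wq w A i ^ 2 * (Real.exp (-(w i * s)) * (1 - Real.exp (-(w i * s)))) ≤ A ^ 3 * lb := by
    rw [hlb, Yb, Finset.mul_sum]
    apply Finset.sum_le_sum
    intro i _
    have e0 := Real.exp_nonneg (-(w i * s))
    have b0 := wq_nonneg hw A i
    have b2 := wb_nonneg hw A i
    calc _ ≤ wq w A i ^ 2 * (Real.exp (-(w i * s)) * 1) := by gcongr; linarith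
      _ = wq w A i * (wq w A i * Real.exp (-(w i * s))) := by ring
      _ ≤ A ^ 2 * (A * wb w A i * Real.exp (-(w i * s))) := by
          gcongr; exacts [q1 i, wq_le_wb hw hA0.le i]
      _ = _ := by ring
  have hl3 : 0 < δ / (2 * A ^ 3) := by positivity
  have hl3' : ∀ i : Fin n, δ / (2 * A ^ 3) * |wq w A i| ≤ 1 := fun i => by
    rw [abs_of_nonneg (wq_nonneg hw A i)]
    calc _ ≤ δ / (2 * A ^ 3) * A ^ 2 := by gcongr; exact q1 i
      _ = δ / (2 * A) := by field_simp
      _ ≤ 1 := by rw [div_le_one (by positivity)]; linarith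
  have ex3 : E ≤ δ / (2 * A ^ 3) * (δ * lb) - (δ / (2 * A ^ 3)) ^ 2 * (A ^ 3 * lb) := by
    have : δ / (2 * A ^ 3) * (δ * lb) - (δ / (2 * A ^ 3)) ^ 2 * (A ^ 3 * lb) = δ ^ 2 * lb / (4 * A ^ 3) := by
      field_simp; ring
    rw [this]
    refine hE'.trans ?_
    apply div_le_div_of_nonneg_left (by positivity) (by positivity)
    have : A ^ 3 ≤ A ^ 4 := pow_le_pow_right₀ hA (by norm_num)
    linarith [pow_pos hA0 4]
  have c5 := (clock_up hw hs (wq w A) hl3 hl3' (δ * lb) _ V3).trans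
    (Real.exp_le_exp.2 (neg_le_neg ex3))
  have c6 := (clock_dn hw hs (wq w A) hl3 hl3' (δ * lb) _ V3).trans
    (Real.exp_le_exp.2 (neg_le_neg ex3))
  have hb := nu_bwd hw (A := A) (s := s) hD0
  have hf := nu_fwd hw (A := A) (s := s) hD0 (by rw [hAD]; exact hδ1)
  have hsub : {ω | ¬ goodT w A δ s ω} ⊆
      (((({ω | Yb w (fun _ => 1) s + δ / A * lb / 2 ≤ Yc (fun _ => 1) s ω} ∪
      {ω | Yc (fun _ => 1) s ω ≤ Yb w (fun _ => 1) s - δ / A * lb / 2}) ∪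
      {ω | Yb w (wb w A) s + δ * lb ≤ Yc (wb w A) s ω}) ∪
      {ω | Yc (wb w A) s ω ≤ Yb w (wb w A) s - δ * lb}) ∪
      {ω | Yb w (wq w A) s + δ * lb ≤ Yc (wq w A) s ω}) ∪
      {ω | Yc (wq w A) s ω ≤ Yb w (wq w A) s - δ * lb} := by
    intro ω hω
    by_contra hcon
    simp only [Set.mem_union, Set.mem_ofPred_eq, not_or, not_le] at hcon
    obtain ⟨⟨⟨⟨⟨h1, h2⟩, h3⟩, h4⟩, h5⟩, h6⟩ := hcon
    have hl : 0 ≤ δ / A * lb := mul_nonneg hD0 hlb0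
    rw [← hlb] at hb hf h3 h4
    apply hω
    refine ⟨by linarith, by linarith, by rw [← hlb]; linarith, by rw [← hlb]; linarith, by rw [← hlb]; linarith, by rw [← hlb]; linarith⟩
  refine (measureReal_mono hsub).trans ?_
  refine (measureReal_union_le _ _).trans ?_
  refine (add_le_add (measureReal_union_le _ _) le_rfl).trans ?_
  refine (add_le_add (add_le_add (measureReal_union_le _ _) le_rfl) le_rfl).trans ?_
  refine (add_le_add (add_le_add (add_le_add (measureReal_union_le _ _) le_rfl) le_rfl) le_rfl).trans ?_
  refine (add_le_add (add_le_add (add_le_add (add_le_add (measureReal_union_le _ _) le_rfl)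
    le_rfl) le_rfl) le_rfl).trans ?_
  linarith

end lemG
end SB

namespace SB
section lemX
variable {n : ℕ}

lemma Yb_ivt {w : Fin n → ℝ} (hw : ∀ i, 0 < w i) (c : Fin n → ℝ) {x t1 : ℝ} (hx : 0 < x)
    (h1 : x ≤ Yb w c t1) : ∃ t, t1 ≤ t ∧ Yb w c t = x := by
  have hlim : Tendsto (Yb w c) atTop (𝓝 0) := by
    have : (0:ℝ) = ∑ i : Fin n, c i * 0 := by simp
    rw [this]
    unfold Yb
    refine tendsto_finsetSum _ fun i _ => Tendsto.const_mul _ ?_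
    refine Real.tendsto_exp_atBot.comp ?_
    refine tendsto_neg_atTop_atBot.comp ?_
    exact Tendsto.const_mul_atTop (hw i) tendsto_id
  obtain ⟨T, hT1, hT2⟩ := ((hlim.eventually (gt_mem_nhds hx)).and (eventually_ge_atTop t1)).exists
  obtain ⟨t, ht, he⟩ := intermediate_value_Icc' hT2 (Yb_cont w c).continuousOn ⟨hT1.le, h1⟩
  exact ⟨t, ht.1, he⟩

lemma nu_ge {w : Fin n → ℝ} {S : ℝ} (hS : ∑ i, w i ≤ S) {t : ℝ} (ht : 0 ≤ t) :
    (n : ℝ) - S * t ≤ Yb w (fun _ => 1) t := by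
  have h1 : ∑ i, (1 - w i * t) ≤ Yb w (fun _ => 1) t := by
    unfold Yb
    apply Finset.sum_le_sum
    intro i _
    linarith [Real.add_one_le_exp (-(w i * t))]
  rw [Finset.sum_sub_distrib, ← Finset.sum_mul] at h1
  simp only [Finset.sum_const, Finset.card_univ, Fintype.card_fin, nsmul_eq_mul, mul_one] at h1
  have := mul_le_mul_of_nonneg_right hS ht
  linarith

lemma nu_zero (w : Fin n → ℝ) : Yb w (fun _ => 1) 0 = n := by
  unfold Yb; simp

lemma goodtime {w : Fin n → ℝ} (hw : ∀ i, 0 < w i) {A δ s t0 ψ E : ℝ} (hA : 1 ≤ A) (hδ : 0 < δ) (hδ1 : δ ≤ 1)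
    (ht0 : 0 ≤ t0) (hs : t0 ≤ s) (hψ : ψ / 2 ≤ Yb w (wf w A) s)
    (hψ1 : n * (A * Real.exp (-A)) < ψ / 2) (hψ2 : n * Real.exp (-(A * t0)) ≤ ψ / 2)
    (hE : E ≤ δ ^ 2 * ψ / (64 * A ^ 4)) :
    (cm w).real {ω | ¬ goodT w A δ s ω} ≤ 6 * Real.exp (-E) := by
  have hA0 : 0 < A := by linarith
  have hs0 : 0 ≤ s := ht0.trans hs
  have hψb : ψ / 2 ≤ Yb w (wb w A) s := hψ.trans (Yb_mono w (wf_le_wb hw A) s)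
  refine lemG hw hA hδ hδ1 hs0 ?_ ?_ hψb hE
  · by_contra hcon
    push Not at hcon
    have : Yb w (wf w A) s ≤ ∑ i : Fin n, A * Real.exp (-A) := by
      unfold Yb
      apply Finset.sum_le_sum
      intro i _
      by_cases h : 1 / A < w i ∧ w i ≤ A
      · have e : wf w A i = w i := by unfold wf; rw [if_pos h]
        rw [e]
        apply mul_le_mul h.2 _ (Real.exp_nonneg _) hA0.le
        rw [Real.exp_le_exp]
        have h1 : A ≤ 1 / A * s := by
          rw [one_div, ← div_eq_inv_mul, le_div_iff₀ hA0]; nlinarith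
        have h2 := mul_le_mul_of_nonneg_right h.1.le hs0
        linarith
      · have e : wf w A i = 0 := by unfold wf; rw [if_neg h]
        rw [e]; simp; positivity
    rw [Finset.sum_const, Finset.card_univ, Fintype.card_fin, nsmul_eq_mul] at this
    linarith
  · refine le_trans ?_ (hψ2.trans hψb)
    have : ∑ i, (if A < w i then Real.exp (-(w i * s)) else 0) ≤ ∑ i : Fin n, Real.exp (-(A * t0)) := by
      apply Finset.sum_le_sum
      intro i _
      split_ifs with h
      · rw [Real.exp_le_exp]
        have := mul_le_mul h.le hs ht0 (hw i).le
        linarith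
      · exact Real.exp_nonneg _
    rw [Finset.sum_const, Finset.card_univ, Fintype.card_fin, nsmul_eq_mul] at this
    exact this

lemma w_split (w : Fin n → ℝ) (A : ℝ) : w = fun i => wb w A i + wh w A i := by
  funext i
  unfold wb wh
  by_cases h : w i ≤ A
  · simp [h, not_lt.2 h]
  · simp [h, not_le.1 h]

lemma ratio_fin {Q R q l A δ : ℝ} (hA : 1 ≤ A) (hδ : 0 < δ) (hδ1 : δ ≤ 1 / 10) (hl : 0 < l)
    (hq0 : 0 ≤ q) (hq : q ≤ A * l) (hQ : |Q - q| ≤ 5 * A * δ * l) (hR : |R - l| ≤ 5 * δ * l) :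
    |Q / R - q / l| ≤ 22 * A * δ := by
  have hR' := abs_le.1 hR
  have hRl : l / 2 ≤ R := by
    have := mul_le_mul_of_nonneg_right hδ1 hl.le
    linarith [hR'.1]
  have hR0 : 0 < R := by linarith
  have e : Q / R - q / l = ((Q - q) - q / l * (R - l)) / R := by field_simp; ring
  rw [e, abs_div, abs_of_pos hR0, div_le_iff₀ hR0]
  have hr : |q / l| ≤ A := by
    rw [abs_of_nonneg (by positivity), div_le_iff₀ hl]; exact hq
  have h1 := abs_sub (Q - q) (q / l * (R - l))
  rw [abs_mul] at h1
  have h2 := mul_le_mul hr hR (abs_nonneg _) (by linarith)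
  have h3 := mul_le_mul_of_nonneg_left hRl (by positivity : (0:ℝ) ≤ 22 * A * δ)
  have h4 : 0 ≤ A * δ * l := by positivity
  linarith

lemma detJ {w : Fin n → ℝ} (hw : ∀ i, 0 < w i) {A δ t : ℝ} (hA : 1 ≤ A) (hδ : 0 < δ) (hδ1 : δ ≤ 1 / 10)
    {j : ℕ} (hj : j ≤ n) (hν : Yb w (fun _ => 1) t = n - j) {ω : Fin n → ℝ} {σ : Equiv.Perm (Fin n)}
    (hσ : StrictMono fun p => ω (σ p)) (g1 : goodT w A δ (t + δ / A) ω) (g2 : goodT w A δ (t - δ / A) ω)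
    (hl : 0 < Yb w (wb w A) t) (hh : Rs (wh w A) j σ ≤ δ * Yb w (wb w A) t) :
    |Dr w (wf w A) j σ - Yb w (wq w A) t / Yb w (wb w A) t| ≤ 22 * A * δ := by
  have hA0 : 0 < A := by linarith
  have hD : 0 ≤ δ / A := by positivity
  have hAD : A * (δ / A) = δ := by field_simp
  obtain ⟨-, b1, -, b2, -, b3⟩ := g1
  obtain ⟨a1, -, a2, -, a3, -⟩ := g2
  rw [add_sub_cancel_right, hν] at b1
  rw [sub_add_cancel, hν] at a1
  have l1 := Yb_fwd (w := w) (wb_nonneg hw A) (A := A) (fun i => wb_supp i) (s := t) hD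
  have q1 := Yb_fwd (w := w) (wq_nonneg hw A) (A := A) (fun i => wq_supp i) (s := t) hD
  have l2 := Yb_bwd (w := w) (wb_nonneg hw A) (A := A) (fun i => wb_supp i) (s := t) hA0.le hD
    (by rw [hAD]; linarith)
  have q2 := Yb_bwd (w := w) (wq_nonneg hw A) (A := A) (fun i => wq_supp i) (s := t) hA0.le hD
    (by rw [hAD]; linarith)
  have l3 : Yb w (wb w A) (t + δ / A) ≤ Yb w (wb w A) t := Yb_anti hw (wb_nonneg hw A) (by linarith)
  rw [hAD] at l1 l2 q1 q2
  have r1 := trans_ge (wb_nonneg hw A) hσ hj b1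
  have r2 := trans_le (wb_nonneg hw A) hσ hj a1
  have r3 := trans_ge (wq_nonneg hw A) hσ hj b1
  have r4 := trans_le (wq_nonneg hw A) hσ hj a1
  have hq0 : 0 ≤ Yb w (wq w A) t := Yb_nonneg w (wq_nonneg hw A) t
  have hq : Yb w (wq w A) t ≤ A * Yb w (wb w A) t := by
    rw [← Yb_mul]; exact Yb_mono w (wq_le_wb hw hA0.le) t
  set l := Yb w (wb w A) t
  set q := Yb w (wq w A) t
  have hRw : Rs w j σ = Rs (wb w A) j σ + Rs (wh w A) j σ := by
    conv_lhs => rw [w_split w A]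
    rw [← Rs_add]
  have hh0 : 0 ≤ Rs (wh w A) j σ := Rs_nonneg (wh_nonneg hw A) j σ
  have hδl : 0 ≤ δ * l := by positivity
  have hδδl : δ * (δ * l) ≤ 1 / 10 * (δ * l) := mul_le_mul_of_nonneg_right hδ1 hδl
  have hAδl : 1 * (δ * l) ≤ A * (δ * l) := mul_le_mul_of_nonneg_right hA hδl
  have hδq : δ * q ≤ δ * (A * l) := mul_le_mul_of_nonneg_left hq hδ.le
  have hδq0 : 0 ≤ δ * q := by positivity
  have hδδl0 : 0 ≤ δ * (δ * l) := by positivity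
  have e : Dr w (wf w A) j σ = Rs (wq w A) j σ / Rs w j σ := rfl
  rw [e]
  apply ratio_fin hA hδ hδ1 hl hq0 hq
  · have m1 := mul_le_mul_of_nonneg_left l2 hδ.le
    have m2 := mul_le_mul_of_nonneg_left l3 hδ.le
    rw [abs_le]; constructor
    · linarith only [r3, b3, q1, m2, hδq, hAδl, hδl]
    · linarith only [r4, a3, q2, m1, hδq, hAδl, hδl, hδδl]
  · have m1 := mul_le_mul_of_nonneg_left l2 (by linarith : 0 ≤ 1 + δ)
    have m2 := mul_le_mul_of_nonneg_left l1 (by linarith : 0 ≤ 1 - δ)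
    rw [hRw, abs_le]; constructor
    · linarith only [r1, b2, m2, hh0, hδl, hδδl0]
    · linarith only [r2, a2, m1, hh, hδl, hδδl]

end lemX
end SB

namespace SB
section lemX2
variable {n : ℕ}

/-- The light mass is small when its mean is small. -/
lemma small_f {w : Fin n → ℝ} (hw : ∀ i, 0 < w i) {A s ψ : ℝ} (hA : 1 ≤ A) (hs : 0 ≤ s)
    (hF : Yb w (wf w A) s ≤ 2 * ψ) :
    (cm w).real {ω | 4 * ψ ≤ Yc (wf w A) s ω} ≤ Real.exp (-(ψ / (2 * A))) := by
  have := cm_prob hw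
  have hA0 : 0 < A := by linarith
  have f1 : ∀ i, wf w A i ≤ A := fun i => (wf_le_wb hw A i).trans (wb_le hA0.le i)
  have V : ∑ i, wf w A i ^ 2 * (Real.exp (-(w i * s)) * (1 - Real.exp (-(w i * s)))) ≤ A * (2 * ψ) := by
    refine le_trans ?_ (mul_le_mul_of_nonneg_left hF hA0.le)
    rw [Yb, Finset.mul_sum]
    apply Finset.sum_le_sum
    intro i _
    have e0 := Real.exp_nonneg (-(w i * s))
    have b0 := wf_nonneg hw A i
    calc _ ≤ wf w A i ^ 2 * (Real.exp (-(w i * s)) * 1) := by gcongr; linarith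
      _ = wf w A i * (wf w A i * Real.exp (-(w i * s))) := by ring
      _ ≤ A * (wf w A i * Real.exp (-(w i * s))) := by gcongr; exact f1 i
  have h := clock_up hw hs (wf w A) (lam := 1 / (2 * A)) (by positivity) (fun i => by
    rw [abs_of_nonneg (wf_nonneg hw A i)]
    calc _ ≤ 1 / (2 * A) * A := by gcongr; exact f1 i
      _ = 1 / 2 := by field_simp
      _ ≤ 1 := by norm_num) (2 * ψ) _ V
  refine (measureReal_mono ?_).trans (h.trans (le_of_eq ?_))
  · intro ω hω
    simp only [Set.mem_ofPred_eq] at hω ⊢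
    linarith
  · congr 2
    field_simp
    ring

lemma star {w : Fin n → ℝ} (hw : ∀ i, 0 < w i) {A δ t0 ψ E : ℝ} (hA : 1 ≤ A) (hδ : 0 < δ) (hδ1 : δ ≤ 1 / 10)
    (ht0 : 0 ≤ t0) (hψ0 : 0 < ψ)
    (hψ1 : n * (A * Real.exp (-A)) < ψ / 2) (hψ2 : n * Real.exp (-(A * t0)) ≤ ψ / 2)
    (hE : E ≤ δ ^ 2 * ψ / (64 * A ^ 4)) (L : ℕ) (T : ℕ → ℝ) 
    (hT : ∀ j, j < n → Yb w (fun _ => 1) (T j) = n - j) :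
    ∃ Bs : Set (Fin n → ℝ), (cm w).real Bs ≤ 7 * Real.exp (-E) ∧ ∀ ω, ω ∉ Bs →
      (n : ℝ) - L ≤ Yc (fun _ => 1) t0 ω → ∀ j, L ≤ j → j < n → Yb w (wf w A) (T j) < ψ →
      ∃ s, (n : ℝ) - j ≤ Yc (fun _ => 1) s ω ∧ Yc (wf w A) s ω ≤ 4 * ψ := by
  have := cm_prob hw
  have hA0 : 0 < A := by linarith
  have hE2 : E ≤ ψ / (2 * A) := by
    refine hE.trans ?_
    rw [div_le_div_iff₀ (by positivity) (by positivity)]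
    have h1 : δ ^ 2 ≤ 1 := pow_le_one₀ hδ.le (by linarith)
    have h2 : A ^ 1 ≤ A ^ 4 := pow_le_pow_right₀ hA (by norm_num)
    have h3 : δ ^ 2 * A ≤ 1 * A ^ 4 := mul_le_mul h1 (by linarith) hA0.le (by norm_num)
    have h4 := mul_le_mul_of_nonneg_left h3 hψ0.le
    have h5 : 0 ≤ ψ * A ^ 4 := by positivity
    linarith only [h4, h5]
  have hexp : 0 ≤ Real.exp (-E) := Real.exp_nonneg _
  by_cases hc : Yb w (wf w A) t0 ≤ 2 * ψ
  · refine ⟨{ω | 4 * ψ ≤ Yc (wf w A) t0 ω}, ?_, ?_⟩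
    · have := (small_f hw hA ht0 hc).trans (Real.exp_le_exp.2 (neg_le_neg hE2))
      linarith
    · intro ω hω hL j hj _ _
      simp only [Set.mem_ofPred_eq, not_le] at hω
      refine ⟨t0, ?_, hω.le⟩
      have : (L : ℝ) ≤ j := by exact_mod_cast hj
      linarith
  · push Not at hc
    obtain ⟨s, hs, hFs⟩ := Yb_ivt hw (wf w A) (by linarith : 0 < 2 * ψ) hc.le
    have g := goodtime hw hA hδ (by linarith) ht0 hs (by linarith) hψ1 hψ2 hE
    have g2 := (small_f hw hA (ht0.trans hs) hFs.le).trans (Real.exp_le_exp.2 (neg_le_neg hE2))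
    refine ⟨{ω | ¬ goodT w A δ s ω} ∪ {ω | 4 * ψ ≤ Yc (wf w A) s ω}, ?_, ?_⟩
    · refine (measureReal_union_le _ _).trans ?_
      linarith
    · intro ω hω _ j _ hjn hFj
      simp only [Set.mem_union, Set.mem_ofPred_eq, not_or, not_le, not_not] at hω
      obtain ⟨hg, hf⟩ := hω
      refine ⟨s, ?_, hf.le⟩
      rw [← hT j hjn]
      refine le_trans ?_ hg.1
      apply Yb_anti hw (fun _ => zero_le_one)
      by_contra hcon
      push Not at hcon
      have h1 := Yb_anti hw (wf_nonneg hw A) hcon.le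
      have h2 := Yb_fwd (w := w) (wf_nonneg hw A) (A := A) (fun i => wf_supp i) (s := s)
        (by positivity : 0 ≤ δ / A)
      have hAD : A * (δ / A) = δ := by field_simp
      rw [hAD, hFs] at h2
      have h3 := mul_le_mul_of_nonneg_right hδ1 hψ0.le
      linarith

lemma lemX {w : Fin n → ℝ} (hw : ∀ i, 0 < w i) {A δ t0 ψ E S h lam : ℝ} (hA : 1 ≤ A) (hδ : 0 < δ)
    (hδ1 : δ ≤ 1 / 10) (ht0 : 0 ≤ t0) (hψ0 : 0 < ψ)
    (hψ1 : n * (A * Real.exp (-A)) < ψ / 2) (hψ2 : n * Real.exp (-(A * t0)) ≤ ψ / 2)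
    (hE : E ≤ δ ^ 2 * ψ / (64 * A ^ 4)) (hS0 : 0 < S) (hS : ∑ i, w i ≤ S) (L : ℕ)
    (hL : S * (t0 + δ / A) ≤ L) (hlam : 0 < lam) (hlam1 : lam ≤ 1)
    (hE2 : E ≤ lam * (L - S * t0) - lam ^ 2 * n)
    (hE3 : E ≤ t0 / 2 * h - n * Real.exp (-(A * t0 / 2))) (hh : h ≤ δ * ψ) :
    ∃ (B : Set (Equiv.Perm (Fin n))) (J : ℕ → Prop) (r : ℕ → ℝ),
      Pr w B ≤ (12 * n + 9) * Real.exp (-E) ∧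
      (∀ j, L ≤ j → j < n → J j → 0 ≤ r j ∧ r j ≤ A) ∧
      (∀ σ, σ ∉ B → L ≤ n → Rs (wh w A) L σ ≤ h) ∧
      (∀ σ, σ ∉ B → ∀ j, L ≤ j → j < n → J j → |Dr w (wf w A) j σ - r j| ≤ 22 * A * δ) ∧
      (∀ σ, σ ∉ B → ∀ j, L ≤ j → j < n → ¬ J j → Rs (wf w A) j σ ≤ 4 * ψ) := by
  have := cm_prob hw
  have hA0 : 0 < A := by linarith
  have hD : 0 < δ / A := by positivity
  have hAD : A * (δ / A) = δ := by field_simp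
  have hT' : ∀ j : ℕ, ∃ t : ℝ, j < n → 0 ≤ t ∧ Yb w (fun _ => 1) t = n - j := by
    intro j
    by_cases hj : j < n
    · have hj' : (j : ℝ) < n := by exact_mod_cast hj
      obtain ⟨t, h1, h2⟩ := Yb_ivt hw (fun _ => 1) (x := (n : ℝ) - j) (t1 := 0) (by linarith)
        (by rw [nu_zero]; linarith [Nat.cast_nonneg (α := ℝ) j])
      exact ⟨t, fun _ => ⟨h1, h2⟩⟩
    · exact ⟨0, fun h => absurd h hj⟩
  choose T hT using hT'
  have hTt : ∀ j, L ≤ j → j < n → t0 + δ / A ≤ T j := by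
    intro j h1 h2
    obtain ⟨h3, h4⟩ := hT j h2
    have h5 := nu_ge hS h3
    have h6 : (L : ℝ) ≤ j := by exact_mod_cast h1
    have : S * (t0 + δ / A) ≤ S * T j := by linarith
    exact le_of_mul_le_mul_left this hS0
  obtain ⟨Bs, hBs, hBs2⟩ := star hw hA hδ hδ1 ht0 hψ0 hψ1 hψ2 hE L T (fun j hj => (hT j hj).2)
  let J : ℕ → Prop := fun j => ψ ≤ Yb w (wf w A) (T j)
  let r : ℕ → ℝ := fun j => Yb w (wq w A) (T j) / Yb w (wb w A) (T j)
  let BJ : ℕ → Set (Fin n → ℝ) := fun j => if L ≤ j ∧ J j then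
    {ω | ¬ goodT w A δ (T j + δ / A) ω} ∪ {ω | ¬ goodT w A δ (T j - δ / A) ω} else ∅
  let B1 : Set (Fin n → ℝ) := {ω | Yc (fun _ => 1) t0 ω ≤ Yb w (fun _ => 1) t0 - (L - S * t0)}
  let B2 : Set (Fin n → ℝ) := {ω | h ≤ Yc (wh w A) t0 ω}
  have m1 : (cm w).real B1 ≤ Real.exp (-E) := by
    refine (clock_dn hw ht0 (fun _ => 1) hlam (fun i => by simpa using hlam1) (L - S * t0) n ?_).trans
      (Real.exp_le_exp.2 (neg_le_neg hE2))
    calc _ ≤ ∑ i : Fin n, (1:ℝ) := by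
          apply Finset.sum_le_sum
          intro i _
          have e0 := Real.exp_nonneg (-(w i * t0))
          have e1 : Real.exp (-(w i * t0)) ≤ 1 := by
            rw [Real.exp_le_one_iff]; linarith [mul_nonneg (hw i).le ht0]
          simp only [one_pow, one_mul]
          exact mul_le_one₀ e1 (by linarith) (by linarith)
      _ = n := by simp
  have m2 : (cm w).real B2 ≤ Real.exp (-E) := by
    have e := clock_heavy hw ht0 (fun i => A < w i) h
    have e1 : (fun i => if A < w i then w i else 0) = wh w A := by
      funext i; unfold wh; rfl
    refine le_trans (le_of_eq ?_) (e.trans (Real.exp_le_exp.2 ?_))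
    · congr 1
    · have : ∑ i, (if A < w i then Real.exp (-(w i * t0 / 2)) else 0) ≤ ∑ i : Fin n, Real.exp (-(A * t0 / 2)) := by
        apply Finset.sum_le_sum
        intro i _
        split_ifs with hi
        · rw [Real.exp_le_exp]
          have := mul_le_mul_of_nonneg_right hi.le ht0
          linarith
        · exact Real.exp_nonneg _
      rw [Finset.sum_const, Finset.card_univ, Fintype.card_fin, nsmul_eq_mul] at this
      have e3 : ∑ i, (if A < w i then Real.exp (-(w i * t0 / 2)) else 0) - t0 / 2 * h ≤ -E := by linarith
      refine le_trans (le_of_eq ?_) e3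
      congr
  have hexp : 0 ≤ Real.exp (-E) := Real.exp_nonneg _
  have m3 : ∀ j ∈ Finset.range n, (cm w).real (BJ j) ≤ 12 * Real.exp (-E) := by
    intro j hj
    rw [Finset.mem_range] at hj
    simp only [BJ]
    split_ifs with hc
    · obtain ⟨hLj, hJj⟩ := hc
      have ht := hTt j hLj hj
      have f1 := Yb_fwd (w := w) (wf_nonneg hw A) (A := A) (fun i => wf_supp i) (s := T j) hD.le
      rw [hAD] at f1
      have f2 : ψ ≤ Yb w (wf w A) (T j) := hJj
      have f3 := mul_le_mul_of_nonneg_left f2 (by linarith : 0 ≤ 1 - δ)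
      have f4 := mul_le_mul_of_nonneg_right hδ1 hψ0.le
      have f5 : Yb w (wf w A) (T j) ≤ Yb w (wf w A) (T j - δ / A) :=
        Yb_anti hw (wf_nonneg hw A) (by linarith)
      have g1 := goodtime hw hA hδ (by linarith) ht0 (s := T j + δ / A) (by linarith) (by linarith)
        hψ1 hψ2 hE
      have g2 := goodtime hw hA hδ (by linarith) ht0 (s := T j - δ / A) (by linarith) (by linarith)
        hψ1 hψ2 hE
      refine (measureReal_union_le _ _).trans ?_
      linarith
    · simp only [measureReal_empty]; positivity
  let bad : Set (Fin n → ℝ) := ((B1 ∪ B2) ∪ Bs) ∪ ⋃ j ∈ Finset.range n, BJ j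
  have mbad : (cm w).real bad ≤ (12 * n + 9) * Real.exp (-E) := by
    have u1 : (cm w).real (⋃ j ∈ Finset.range n, BJ j) ≤ n * (12 * Real.exp (-E)) := by
      refine (measureReal_biUnion_finset_le _ _).trans ?_
      refine (Finset.sum_le_sum m3).trans ?_
      simp
    have u2 := measureReal_union_le (μ := cm w) ((B1 ∪ B2) ∪ Bs) (⋃ j ∈ Finset.range n, BJ j)
    have u3 := measureReal_union_le (μ := cm w) (B1 ∪ B2) Bs
    have u4 := measureReal_union_le (μ := cm w) B1 B2
    linarith
  let G : Set (Equiv.Perm (Fin n)) := {σ | (L ≤ n → Rs (wh w A) L σ ≤ h) ∧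
      (∀ j, L ≤ j → j < n → J j → |Dr w (wf w A) j σ - r j| ≤ 22 * A * δ) ∧
      (∀ j, L ≤ j → j < n → ¬ J j → Rs (wf w A) j σ ≤ 4 * ψ)}
  have hpr : Pr w Gᶜ ≤ (cm w).real bad := by
    refine Pr_le_clock hw Gᶜ bad ?_
    intro σ hσ ω hω
    by_contra hcon
    apply hσ
    simp only [bad, Set.mem_union, not_or] at hcon
    obtain ⟨⟨⟨n1, n2⟩, n3⟩, n4⟩ := hcon
    have n1' : (n : ℝ) - L ≤ Yc (fun _ => 1) t0 ω := by
      simp only [B1, Set.mem_ofPred_eq, not_le] at n1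
      have := nu_ge hS ht0
      linarith
    have n2' : Yc (wh w A) t0 ω ≤ h := by
      simp only [B2, Set.mem_ofPred_eq, not_le] at n2
      exact n2.le
    have hH : ∀ j, L ≤ j → j ≤ n → Rs (wh w A) j σ ≤ h := by
      intro j h1 h2
      refine (trans_le (wh_nonneg hw A) hω h2 ?_).trans n2'
      have : (L : ℝ) ≤ j := by exact_mod_cast h1
      linarith
    refine ⟨fun hLn => hH L le_rfl hLn, ?_, ?_⟩
    · intro j h1 h2 hJj
      have hn : ω ∉ BJ j := by
        intro hm
        apply n4
        rw [Set.mem_iUnion₂]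
        exact ⟨j, Finset.mem_range.2 h2, hm⟩
      simp only [BJ, if_pos (And.intro h1 hJj), Set.mem_union, Set.mem_ofPred_eq, not_or, not_not] at hn
      have f2 : ψ ≤ Yb w (wf w A) (T j) := hJj
      have f3 : ψ ≤ Yb w (wb w A) (T j) := f2.trans (Yb_mono w (wf_le_wb hw A) _)
      refine detJ hw hA hδ hδ1 h2.le (hT j h2).2 hω hn.1 hn.2 (by linarith) ?_
      refine (hH j h1 h2.le).trans (hh.trans (mul_le_mul_of_nonneg_left f3 hδ.le))
    · intro j h1 h2 hJj
      obtain ⟨s, s1, s2⟩ := hBs2 ω n3 n1' j h1 h2 (not_le.1 hJj)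
      exact (trans_le (wf_nonneg hw A) hω h2.le s1).trans s2
  refine ⟨Gᶜ, J, r, hpr.trans mbad, ?_, ?_, ?_, ?_⟩
  · intro j h1 h2 hJj
    have f2 : ψ ≤ Yb w (wf w A) (T j) := hJj
    have f3 : ψ ≤ Yb w (wb w A) (T j) := f2.trans (Yb_mono w (wf_le_wb hw A) _)
    refine ⟨div_nonneg (Yb_nonneg w (wq_nonneg hw A) _) (by linarith), ?_⟩
    rw [div_le_iff₀ (by linarith), ← Yb_mul]
    exact Yb_mono w (wq_le_wb hw hA0.le) _
  · intro σ hσ; exact (not_not.1 hσ : σ ∈ G).1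
  · intro σ hσ; exact (not_not.1 hσ : σ ∈ G).2.1
  · intro σ hσ; exact (not_not.1 hσ : σ ∈ G).2.2

end lemX2
end SB

namespace SB
section thmB

/-- The small-weight part. -/
noncomputable def wg {n : ℕ} (w : Fin n → ℝ) (A : ℝ) (i : Fin n) : ℝ :=
  w i - wf w A i - wh w A i

lemma wg_bound {n : ℕ} {w : Fin n → ℝ} (hw : ∀ i, 0 < w i) {A : ℝ} (hA : 1 ≤ A) (i : Fin n) :
    0 ≤ wg w A i ∧ wg w A i ≤ 1 / A := by
  have h1 : 0 < 1 / A := by positivity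
  have h2 : 1 / A ≤ 1 := by rw [div_le_one (by linarith)]; exact hA
  unfold wg wf wh
  have := hw i
  by_cases c1 : A < w i
  · rw [if_neg (by rintro ⟨_, h⟩; linarith), if_pos c1]
    constructor <;> linarith
  · by_cases c2 : 1 / A < w i
    · rw [if_pos ⟨c2, by linarith⟩, if_neg c1]
      constructor <;> linarith
    · rw [if_neg (by rintro ⟨h, _⟩; linarith), if_neg c1]
      constructor <;> linarith

lemma thmB_det {n : ℕ} {w : Fin n → ℝ} (hw : ∀ i, 0 < w i) {a ε C C0 t0 y : ℝ}
    (hε : 0 < ε) (hε1 : ε ≤ 1) (hC : 1 ≤ C) (hC0 : 1 ≤ C0) (ht : t0 = ε / (8 * C0))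
    (hn : (n : ℝ) = a ^ 60) (h64 : 64 ≤ a) (h1 : 8 * C0 ≤ a * ε) (h2 : 256 ≤ a * ε ^ 2)
    (h3 : 4 ≤ a * t0) (h4 : 16 * (23 * C + 5) ≤ a)
    (h5 : 21 * (C0 + C) * (a ^ 121 * Real.exp (-a)) < 1 / 8)
    (h6 : a ^ 60 * Real.exp (-(a * t0 / 2)) ≤ 1 / 2)
    (hS : ∑ i, w i ≤ C0 * n) (L m : ℕ) (hL : ε * n / 2 ≤ L) (hD : (m : ℝ) - L ≤ C * y)
    (hy1 : a ^ 20 ≤ y) (hy2 : y ≤ a ^ 60) :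
    Pr w {σ | ∃ k, L ≤ k ∧ k ≤ m ∧ y / 2 ≤ |Dev w L k σ|} ≤ Real.exp (-(y / a ^ 20)) := by
  have ha0 : (0:ℝ) < a := by linarith
  have ha1 : (1:ℝ) ≤ a := by linarith
  have ht0 : 0 < t0 := by rw [ht]; positivity
  obtain ⟨q, hq⟩ : ∃ q, q = y / a ^ 12 := ⟨_, rfl⟩
  have hyq : y = q * a ^ 12 := by rw [hq]; field_simp
  have hq8 : a ^ 8 ≤ q := by
    rw [hq, le_div_iff₀ (by positivity)]
    calc a ^ 8 * a ^ 12 = a ^ 20 := by ring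
      _ ≤ y := hy1
  have hqa : a ≤ q := le_trans (le_self_pow₀ ha1 (by norm_num)) hq8
  have hq0 : 0 < q := by linarith
  have hy0 : 0 < y := by rw [hyq]; positivity
  have hy1' : 1 ≤ y := le_trans (one_le_pow₀ ha1) hy1
  have hexp0 : 0 < Real.exp (-a) := Real.exp_pos _
  have hX : a ^ 121 * Real.exp (-a) < 1 / 336 := by
    have : 42 * (a ^ 121 * Real.exp (-a)) ≤ 21 * (C0 + C) * (a ^ 121 * Real.exp (-a)) :=
      mul_le_mul_of_nonneg_right (by linarith) (by positivity)
    linarith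
  have hn0 : (0:ℝ) < n := by rw [hn]; positivity
  have hn1 : (1:ℝ) ≤ n := by rw [hn]; exact one_le_pow₀ ha1
  by_cases hLn : L < n
  swap
  · have : {σ : Equiv.Perm (Fin n) | ∃ k, L ≤ k ∧ k ≤ m ∧ y / 2 ≤ |Dev w L k σ|} ⊆ ∅ := by
      intro σ hσ
      exact absurd (Dev_cut w L m y hy0 σ hσ).1 hLn
    refine le_trans (Pr_mono hw this) ?_
    have : Pr w (∅ : Set (Equiv.Perm (Fin n))) = 0 := by simp [Pr, Ex]
    rw [this]; positivity
  have hψ19 : 1 ≤ y / a := by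
    rw [le_div_iff₀ ha0]
    have : a ≤ a ^ 20 := le_self_pow₀ ha1 (by norm_num)
    linarith
  have hSt : C0 * n * t0 = ε * n / 8 := by rw [ht]; field_simp
  obtain ⟨B, J, r, hB, hr, H1, H2, H3⟩ := lemX (n := n) (w := w) hw (A := a) (δ := 1 / a ^ 3) (t0 := t0)
    (ψ := y / a) (E := q) (S := C0 * n) (h := 1 / a ^ 3 * (y / a)) (lam := ε / 16) ha1 (by positivity)
    (by
      rw [div_le_div_iff₀ (by positivity) (by norm_num)]
      have : a ≤ a ^ 3 := le_self_pow₀ ha1 (by norm_num)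
      linarith) ht0.le (by positivity)
    (by
      have e1 : (n:ℝ) * (a * Real.exp (-a)) = a ^ 61 * Real.exp (-a) := by rw [hn]; ring
      have e2 : a ^ 61 * Real.exp (-a) ≤ a ^ 121 * Real.exp (-a) :=
        mul_le_mul_of_nonneg_right (pow_le_pow_right₀ ha1 (by norm_num)) hexp0.le
      linarith)
    (by
      have e1 : Real.exp (-(a * t0)) ≤ Real.exp (-(a * t0 / 2)) := by
        apply Real.exp_le_exp.2
        have : 0 < a * t0 := by positivity
        linarith
      have e2 := mul_le_mul_of_nonneg_left e1 hn0.le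
      rw [← hn] at h6
      linarith)
    (by
      rw [hyq]
      have : (1 / a ^ 3) ^ 2 * (q * a ^ 12 / a) / (64 * a ^ 4) = q * a / 64 := by field_simp
      rw [this]
      have := mul_le_mul_of_nonneg_left h64 hq0.le
      linarith) (by positivity) hS L
    (by
      have e1 : C0 * n * (1 / a ^ 3 / a) ≤ ε * n / 8 := by
        have e2 : C0 ≤ a ^ 4 * ε / 8 := by
          have : a * ε ≤ a ^ 4 * ε := mul_le_mul_of_nonneg_right (le_self_pow₀ ha1 (by norm_num)) hε.le
          linarith
        have e3 : C0 * n * (1 / a ^ 3 / a) = C0 * (n / a ^ 4) := by field_simp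
        rw [e3]
        refine le_trans (mul_le_mul_of_nonneg_right e2 (by positivity)) (le_of_eq ?_)
        field_simp
      have : 0 < ε * n := by positivity
      rw [mul_add, hSt]
      linarith)
    (by positivity) (by linarith)
    (by
      rw [hSt]
      have e1 : ε / 16 * (ε * n / 2 - ε * n / 8) ≤ ε / 16 * (L - ε * n / 8) :=
        mul_le_mul_of_nonneg_left (by linarith) (by positivity)
      have e2 : q * 256 ≤ n * ε ^ 2 := by
        have e3 : q * a ≤ n := by
          calc q * a ≤ q * a ^ 12 := mul_le_mul_of_nonneg_left (le_self_pow₀ ha1 (by norm_num)) hq0.le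
            _ = y := hyq.symm
            _ ≤ n := by rw [hn]; exact hy2
        calc q * 256 ≤ q * (a * ε ^ 2) := mul_le_mul_of_nonneg_left h2 hq0.le
          _ = q * a * ε ^ 2 := by ring
          _ ≤ n * ε ^ 2 := mul_le_mul_of_nonneg_right e3 (by positivity)
      have e4 : 0 ≤ n * ε ^ 2 := by positivity
      linarith only [e1, e2, e4])
    (by
      have e1 : t0 / 2 * (1 / a ^ 3 * (y / a)) = (a * t0) * (q * a ^ 7) / 2 := by
        rw [hyq]; field_simp
      rw [e1, hn]
      have e2 : 4 * (q * a ^ 7) ≤ (a * t0) * (q * a ^ 7) :=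
        mul_le_mul_of_nonneg_right h3 (by positivity)
      have e3 : q * 1 ≤ q * a ^ 7 := mul_le_mul_of_nonneg_left (one_le_pow₀ ha1) hq0.le
      linarith) le_rfl
  have hKn : min m n ≤ n := min_le_right _ _
  by_cases hLm : L ≤ m
  swap
  · have : {σ : Equiv.Perm (Fin n) | ∃ k, L ≤ k ∧ k ≤ m ∧ y / 2 ≤ |Dev w L k σ|} ⊆ ∅ := by
      rintro σ ⟨k, hk1, hk2, _⟩
      exact absurd (hk1.trans hk2) hLm
    refine le_trans (Pr_mono hw this) ?_
    have : Pr w (∅ : Set (Equiv.Perm (Fin n))) = 0 := by simp [Pr, Ex]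
    rw [this]; positivity
  have heq : Real.exp (-q) ≤ Real.exp (-a) := Real.exp_le_exp.2 (by linarith)
  have hY := lemY (n := n) (w := w) hw (f := wf w a) (g := wg w a) (hv := wh w a)
    (fun i => by unfold wg; ring) (wf_nonneg hw a) (fun i => (wg_bound hw ha1 i).1) (wh_nonneg hw a)
    (a := a) (γ := 1 / a) (h := 1 / a ^ 3 * (y / a)) (ρ := 22 * a * (1 / a ^ 3)) (Ψ := 4 * (y / a))
    (D := C * y) (S := C0 * n) (p := (12 * n + 9) * Real.exp (-q)) (y := y) (c := 1 / a ^ 4)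
    ha0.le (by positivity) (by positivity) (by positivity)
    (fun i => le_trans (wf_le_wb hw a i) (wb_le ha0.le i)) (fun i => (wg_bound hw ha1 i).2) L (min m n)
    (le_min hLm hLn.le) hKn
    (by
      have : ((min m n : ℕ) : ℝ) ≤ m := by exact_mod_cast min_le_left _ _
      linarith)
    hS J r (fun j h1 h2 h3 => hr j h1 (lt_of_lt_of_le h2 hKn) h3) B hB
    (fun σ hσ => H1 σ hσ hLn.le) (fun σ hσ j h1 h2 h3 => H2 σ hσ j h1 (lt_of_lt_of_le h2 hKn) h3)
    (fun σ hσ j h1 h2 h3 => H3 σ hσ j h1 (lt_of_lt_of_le h2 hKn) h3)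
    (by
      have e1 : 2 * (C * y * (1 / a) + 1 / a ^ 3 * (y / a) + C * y * (22 * a * (1 / a ^ 3)) + 4 * (y / a))
          ≤ y / 8 := by
        have f1 : 1 / a ^ 3 * (y / a) ≤ y / a := by
          have : 1 / a ^ 3 ≤ 1 := by rw [div_le_one (by positivity)]; exact one_le_pow₀ ha1
          exact mul_le_of_le_one_left (by positivity) this
        have f2 : C * y * (22 * a * (1 / a ^ 3)) ≤ 22 * C * (y / a) := by
          have : C * y * (22 * a * (1 / a ^ 3)) = 22 * C * (y / a) * (1 / a) := by field_simp
          rw [this]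
          refine mul_le_of_le_one_right (by positivity) ?_
          rw [div_le_one ha0]; exact ha1
        have f3 : C * y * (1 / a) = C * (y / a) := by field_simp
        have f4 : 16 * (23 * C + 5) * (y / a) ≤ y := by
          have := mul_le_mul_of_nonneg_right h4 (show 0 ≤ y / a by positivity)
          have g : a * (y / a) = y := by field_simp
          linarith
        linarith only [f1, f2, f3, f4]
      have e2 : (C0 * n + C * y * a) * ((12 * n + 9) * Real.exp (-q)) < y / 8 := by
        have f1 : C0 * n + C * y * a ≤ (C0 + C) * a ^ 61 := by
          have g1 : C0 * n ≤ C0 * a ^ 61 := by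
            rw [hn]
            exact mul_le_mul_of_nonneg_left (pow_le_pow_right₀ ha1 (by norm_num)) (by linarith)
          have g2 : C * y * a ≤ C * a ^ 60 * a := by gcongr
          have g3 : C * a ^ 60 * a = C * a ^ 61 := by ring
          linarith
        have f2 : (12 * n + 9) * Real.exp (-q) ≤ 21 * a ^ 60 * Real.exp (-a) := by
          apply mul_le_mul _ heq (Real.exp_pos _).le (by positivity)
          rw [← hn]; linarith
        calc _ ≤ ((C0 + C) * a ^ 61) * (21 * a ^ 60 * Real.exp (-a)) :=
              mul_le_mul f1 f2 (by positivity) (by positivity)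
          _ = 21 * (C0 + C) * (a ^ 121 * Real.exp (-a)) := by ring
          _ < 1 / 8 := h5
          _ ≤ y / 8 := by linarith
      linarith)
    (by positivity)
    (by
      have : 1 / a ^ 4 * a = 1 / a ^ 3 := by field_simp
      rw [this, div_le_one (by positivity)]; exact one_le_pow₀ ha1)
  refine le_trans (Pr_mono hw (fun σ hσ => (Dev_cut w L m y hy0 σ hσ).2)) (le_trans hY ?_)
  have m1 : Real.exp (-(1 / a ^ 4 * (y / 4) - (1 / a ^ 4) ^ 2 * (C * y * a ^ 2))) ≤ Real.exp (-q) := by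
    apply Real.exp_le_exp.2
    have e1 : 1 / a ^ 4 * (y / 4) - (1 / a ^ 4) ^ 2 * (C * y * a ^ 2) = q * (a ^ 8 / 4 - C * a ^ 6) := by
      rw [hyq]; field_simp
    have e2 : 1 ≤ a ^ 8 / 4 - C * a ^ 6 := by
      have g1 : 16 * C ≤ a := by linarith
      have g2 : 16 * C * a ^ 6 ≤ a * a ^ 6 := mul_le_mul_of_nonneg_right g1 (by positivity)
      have g3 : 64 * a ^ 7 ≤ a * a ^ 7 := mul_le_mul_of_nonneg_right h64 (by positivity)
      have g4 : (1:ℝ) ≤ a ^ 7 := one_le_pow₀ ha1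
      have g5 : a * a ^ 6 = a ^ 7 := by ring
      have g6 : a * a ^ 7 = a ^ 8 := by ring
      linarith
    rw [e1]
    have := mul_le_mul_of_nonneg_left e2 hq0.le
    linarith
  have m2 : (12 * n + 9) * Real.exp (-q) + 2 * Real.exp (-q) ≤ Real.exp (-(y / a ^ 20)) := by
    have e1 : y / a ^ 20 = q / a ^ 8 := by rw [hyq]; field_simp
    have e2 : q / a ^ 8 + a ≤ q := by
      have g1 : q / a ^ 8 ≤ q / 2 := by
        apply div_le_div_of_nonneg_left hq0.le (by norm_num)
        exact le_trans (by linarith) (le_self_pow₀ ha1 (by norm_num))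
      have g2 : 2 * a ≤ a ^ 8 := by
        have : a ^ 2 ≤ a ^ 8 := pow_le_pow_right₀ ha1 (by norm_num)
        nlinarith
      linarith
    have e3 : Real.exp (-q) ≤ Real.exp (-a) * Real.exp (-(y / a ^ 20)) := by
      rw [← Real.exp_add]
      apply Real.exp_le_exp.2
      rw [e1]; linarith
    have e4 : (12 * n + 11) * Real.exp (-a) ≤ 1 := by
      have g1 : 12 * (n:ℝ) + 11 ≤ 23 * a ^ 121 := by
        have : a ^ 60 ≤ a ^ 121 := pow_le_pow_right₀ ha1 (by norm_num)
        rw [← hn] at this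
        linarith
      have g2 := mul_le_mul_of_nonneg_right g1 hexp0.le
      linarith
    calc (12 * n + 9) * Real.exp (-q) + 2 * Real.exp (-q) = (12 * n + 11) * Real.exp (-q) := by ring
      _ ≤ (12 * n + 11) * (Real.exp (-a) * Real.exp (-(y / a ^ 20))) :=
        mul_le_mul_of_nonneg_left e3 (by positivity)
      _ = ((12 * n + 11) * Real.exp (-a)) * Real.exp (-(y / a ^ 20)) := by ring
      _ ≤ 1 * Real.exp (-(y / a ^ 20)) := mul_le_mul_of_nonneg_right e4 (Real.exp_pos _).le
      _ = _ := one_mul _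
  linarith

lemma pow_exp_small (k : ℕ) {b s : ℝ} (hb : 0 < b) (hs : 0 < s) :
    ∀ᶠ a : ℝ in atTop, a ^ k * Real.exp (-(b * a)) < s := by
  have h1 := Real.tendsto_pow_mul_exp_neg_atTop_nhds_zero k
  have h2 := h1.comp (tendsto_id.const_mul_atTop hb)
  have h3 := h2.const_mul ((b ^ k)⁻¹)
  rw [mul_zero] at h3
  filter_upwards [h3.eventually_lt_const hs] with a ha
  simp only [Function.comp, id, mul_pow] at ha
  have : (b ^ k)⁻¹ * (b ^ k * a ^ k * Real.exp (-(b * a))) = a ^ k * Real.exp (-(b * a)) := by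
    field_simp
  linarith

theorem thmB {w : ∀ n : ℕ, Fin n → ℝ} {μ : Measure ℝ} (hCC : CondC w μ) {ε C : ℝ}
    (hε : 0 < ε) (hε1 : ε ≤ 1) (hC : 1 ≤ C) :
    ∀ᶠ n : ℕ in atTop, ∀ (l m : ℕ) (y : ℝ), 1 ≤ l → l ≤ m → ε * n ≤ m →
      (m : ℝ) - l + 1 ≤ C * y → (m : ℝ) - l ≤ ε / 4 * n → (n : ℝ) ^ ((1:ℝ) / 3) ≤ y → y ≤ n →
      Pr (w n) {σ | ∃ k, l - 1 ≤ k ∧ k ≤ m ∧ y / 2 ≤ |Dev (w n) (l - 1) k σ|} ≤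
        Real.exp (-(y / (n : ℝ) ^ ((1:ℝ) / 3))) := by
  obtain ⟨c0, hc0, C0, hC0, -, hf⟩ := fact1 hCC
  have ht0 : 0 < ε / (8 * C0) := by positivity
  have hat : Tendsto (fun n : ℕ => (n : ℝ) ^ ((1:ℝ) / 60)) atTop atTop :=
    (tendsto_rpow_atTop (by norm_num)).comp tendsto_natCast_atTop_atTop
  have k1 := hat.eventually (eventually_ge_atTop (64:ℝ))
  have k2 := hat.eventually (eventually_ge_atTop (8 * C0 / ε))
  have k3 := hat.eventually (eventually_ge_atTop (256 / ε ^ 2))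
  have k4 := hat.eventually (eventually_ge_atTop (4 / (ε / (8 * C0))))
  have k5 := hat.eventually (eventually_ge_atTop (16 * (23 * C + 5)))
  have k6 := hat.eventually (pow_exp_small 121 (b := 1) (s := 1 / 8 / (21 * (C0 + C))) one_pos
    (by positivity))
  have k7 := hat.eventually (pow_exp_small 60 (b := ε / (8 * C0) / 2) (s := 1 / 2) (by positivity)
    (by positivity))
  have k8 := tendsto_natCast_atTop_atTop.eventually (eventually_ge_atTop (4 / ε : ℝ))
  filter_upwards [hf, k1, k2, k3, k4, k5, k6, k7, k8] with n hf k1 k2 k3 k4 k5 k6 k7 k8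
  intro l m y hl hlm hm hD hd hy1 hy2
  have hn60 : (n:ℝ) = ((n : ℝ) ^ ((1:ℝ) / 60)) ^ 60 := by
    rw [← Real.rpow_natCast, ← Real.rpow_mul (Nat.cast_nonneg _)]
    norm_num
  have hn20 : (n:ℝ) ^ ((1:ℝ) / 3) = ((n : ℝ) ^ ((1:ℝ) / 60)) ^ 20 := by
    rw [← Real.rpow_natCast, ← Real.rpow_mul (Nat.cast_nonneg _)]
    norm_num
  rw [hn20] at hy1 ⊢
  generalize (n : ℝ) ^ ((1:ℝ) / 60) = a at *
  have hcast : ((l - 1 : ℕ) : ℝ) = (l:ℝ) - 1 := by rw [Nat.cast_sub hl]; simp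
  refine thmB_det (hCC.w_pos n) (ε := ε) (C := C) (C0 := C0) (t0 := ε / (8 * C0)) hε hε1 hC hC0 rfl hn60
    k1 ?_ ?_ ?_ k5 ?_ ?_ hf.2.1 _ m ?_ ?_ hy1 (hn60 ▸ hy2)
  · rwa [div_le_iff₀ hε] at k2
  · rwa [div_le_iff₀ (by positivity)] at k3
  · rwa [div_le_iff₀ ht0] at k4
  · rw [one_mul, lt_div_iff₀ (by positivity)] at k6
    linarith
  · have : -(ε / (8 * C0) / 2 * a) = -(a * (ε / (8 * C0)) / 2) := by ring
    rw [this] at k7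
    exact k7.le
  · rw [hcast]
    rw [div_le_iff₀ hε] at k8
    linarith
  · rw [hcast]; linarith
end thmB
end SB

/-- Theorem of the paper: concentration of the size-biased sums sampled
without replacement, uniformly over `l ≤ i ≤ j ≤ m`. -/
theorem size_biased_sum_concentration_general
    (w : ∀ n : ℕ, Fin n → ℝ) (μ : Measure ℝ) (hC : CondC w μ) :
    ∃ Abar > (0 : ℝ), ∃ A > (0 : ℝ), ∀ l m : ℕ → ℕ, ∀ y : ℕ → ℝ,
      (∀ n, 1 ≤ l n ∧ l n ≤ m n) →
      Cond2 w Abar (fun n => Real.sqrt ((m n : ℝ) * ((m n : ℝ) - (l n : ℝ)))) y →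
      Tendsto (fun n => (m n : ℝ) - (l n : ℝ)) atTop atTop →
      y =O[atTop] (fun n => (m n : ℝ) - (l n : ℝ)) →
      ∀ᶠ n : ℕ in atTop,
        sbMeasure n (w n)
          {ω : Fin n → Fin n | ∃ i j : ℕ, l n ≤ i ∧ i ≤ j ∧ j ≤ m n ∧
            y n ≤ |(∑ k ∈ Finset.Icc i j, sbW (w n) ω k) -
                ∫ ω', ∑ k ∈ Finset.Icc i j, sbW (w n) ω' k ∂sbMeasure n (w n)|}
        ≤ ENNReal.ofReal (A * Real.exp
            (-(y n) ^ 2 / (A * (y n * (n : ℝ) ^ ((1 : ℝ) / 3) + ((m n : ℝ) - (l n : ℝ)))))) := by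
  obtain ⟨A, hA, hthmA⟩ := SB.thmA hC
  obtain ⟨c0, hc0, C0, hC0, -, hf⟩ := SB.fact1 hC
  refine ⟨1, one_pos, max A 1, by positivity, ?_⟩
  intro l m y hlm hc2 hd hyd
  obtain ⟨K1, hK1, hK1'⟩ := hc2.a_sq_bigO.exists_pos
  obtain ⟨K2, hK2, hK2'⟩ := hyd.exists_pos
  have hK1e := hK1'.bound
  have hK2e := hK2'.bound
  obtain ⟨C1, hC1d⟩ : ∃ C1, C1 = max 1 (K1 * C0) := ⟨_, rfl⟩
  have hC1 : 1 ≤ C1 := by rw [hC1d]; exact le_max_left _ _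
  have hC1' : K1 * C0 ≤ C1 := by rw [hC1d]; exact le_max_right _ _
  obtain ⟨ε, hε, hevA⟩ := hthmA C1 hC1
  obtain ⟨e, hed⟩ : ∃ e, e = min ε 1 := ⟨_, rfl⟩
  have he0 : 0 < e := by rw [hed]; positivity
  have he1 : e ≤ 1 := by rw [hed]; exact min_le_right _ _
  have heε : e ≤ ε := by rw [hed]; exact min_le_left _ _
  have hCB : 1 ≤ C1 / e + 1 := by
    have : 0 < C1 / e := by positivity
    linarith
  have hevB := SB.thmB hC he0 he1 hCB
  obtain ⟨κ, hκd⟩ : ∃ κ, κ = min (e / 4) (1 / K2) := ⟨_, rfl⟩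
  have hκ0 : 0 < κ := by rw [hκd]; positivity
  have hκ1 : κ ≤ e / 4 := by rw [hκd]; exact min_le_left _ _
  have hκ2 : κ ≤ 1 / K2 := by rw [hκd]; exact min_le_right _ _
  have ho := hc2.a_lito.bound hκ0
  filter_upwards [hf, hevA, hevB, hK1e, hK2e, ho, hc2.exp_lt, hd.eventually_ge_atTop 1,
    hc2.b_top.eventually_ge_atTop 1, eventually_ge_atTop 1] with
    n hf hevA hevB hK1 hK2n ho hexp hd1 hy1 hn1
  obtain ⟨hl1, hl2⟩ := hlm n
  apply SB.reduce (hC.w_pos n) (l n) (m n) hl1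
  have hn0 : (1:ℝ) ≤ n := by exact_mod_cast hn1
  have hmr : (l n : ℝ) ≤ m n := by exact_mod_cast hl2
  have hm0 : (0:ℝ) ≤ m n := Nat.cast_nonneg _
  have hl0 : (1:ℝ) ≤ l n := by exact_mod_cast hl1
  generalize hdd : (m n : ℝ) - l n = d at *
  generalize y n = Y at *
  have hell : ell w n = ∑ i, w n i := rfl
  have hell0 : 0 ≤ ell w n := by rw [hell]; exact Finset.sum_nonneg fun i _ => (hC.w_pos n i).le
  have hd0 : 0 ≤ d := by linarith
  have hmd : 0 ≤ (m n : ℝ) * d := mul_nonneg hm0 hd0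
  have hmd1 : (m n : ℝ) * d ≤ C1 * Y * n := by
    rw [Real.norm_of_nonneg (by positivity), Real.sq_sqrt hmd,
      Real.norm_of_nonneg (mul_nonneg (by linarith) hell0)] at hK1
    calc (m n : ℝ) * d ≤ K1 * (Y * ell w n) := hK1
      _ ≤ K1 * (Y * (C0 * n)) := by
        rw [hell]
        have := hf.2.1
        gcongr
      _ = (K1 * C0) * (Y * n) := by ring
      _ ≤ C1 * (Y * n) := mul_le_mul_of_nonneg_right hC1' (by positivity)
      _ = _ := by ring
  have hdκ : d ≤ κ * n := by
    rw [Real.norm_of_nonneg (Real.sqrt_nonneg _), Real.norm_of_nonneg (by linarith)] at ho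
    refine le_trans (Real.le_sqrt_of_sq_le ?_) ho
    rw [sq]
    exact mul_le_mul_of_nonneg_right (by linarith) hd0
  have hYn : Y ≤ n := by
    rw [Real.norm_of_nonneg (by linarith), Real.norm_of_nonneg hd0] at hK2n
    calc Y ≤ K2 * d := hK2n
      _ ≤ K2 * (1 / K2 * n) := by
        have : κ * n ≤ 1 / K2 * n := mul_le_mul_of_nonneg_right hκ2 (by linarith)
        exact mul_le_mul_of_nonneg_left (by linarith) hK2.le
      _ = n := by field_simp
  have hroot : 0 < (n:ℝ) ^ ((1:ℝ) / 3) := by positivity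
  have hYroot : (n:ℝ) ^ ((1:ℝ) / 3) ≤ Y := by
    generalize (n:ℝ) ^ ((1:ℝ) / 3) = R at *
    have hden : 0 < 1 * (Y * R + √((m n : ℝ) * d)) := by
      have := Real.sqrt_nonneg ((m n : ℝ) * d)
      have : 0 < Y * R := mul_pos (by linarith) hroot
      linarith
    by_contra hcon
    push Not at hcon
    have h1 : -1 ≤ -Y ^ 2 / (1 * (Y * R + √((m n : ℝ) * d))) := by
      rw [le_div_iff₀ hden]
      have := Real.sqrt_nonneg ((m n : ℝ) * d)
      have : Y * Y ≤ Y * R := mul_le_mul_of_nonneg_left hcon.le (by linarith)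
      have : Y ^ 2 = Y * Y := sq Y
      linarith
    have h2 := Real.exp_le_exp.2 h1
    have h3 : (1:ℝ) / 4 < Real.exp (-1) := by
      have := Real.exp_neg_one_gt_d9
      linarith
    linarith
  have hden : 0 < Y * (n:ℝ) ^ ((1:ℝ) / 3) + d := by
    have : 0 < Y * (n:ℝ) ^ ((1:ℝ) / 3) := mul_pos (by linarith) hroot
    linarith
  by_cases hcase : (m n : ℝ) ≤ ε * n
  · refine le_trans (hevA (l n) (m n) Y hl1 hl2 hcase (by rw [hdd]; exact hmd1) (by rw [hdd]; exact hd1) hy1) ?_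
    rw [hdd]
    apply mul_le_mul (le_max_left _ _) _ (Real.exp_pos _).le (by positivity)
    apply Real.exp_le_exp.2
    rw [neg_div, neg_div, neg_le_neg_iff]
    apply div_le_div_of_nonneg_left (by positivity) (by positivity)
    exact mul_le_mul_of_nonneg_right (le_max_left _ _) hden.le
  · push Not at hcase
    have hem : e * n ≤ m n := le_trans (mul_le_mul_of_nonneg_right heε (by linarith)) hcase.le
    have hdY : d + 1 ≤ (C1 / e + 1) * Y := by
      have h1 : d * (e * n) ≤ C1 * Y * n := by
        refine le_trans (mul_le_mul_of_nonneg_left hem hd0) ?_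
        linarith
      have h2 : d * e ≤ C1 * Y := by
        have : (d * e) * n ≤ (C1 * Y) * n := by linarith
        exact le_of_mul_le_mul_right this (by linarith)
      have h3 : d ≤ C1 / e * Y := by
        rw [div_mul_eq_mul_div, le_div_iff₀ he0]; exact h2
      linarith
    refine le_trans (hevB (l n) (m n) Y hl1 hl2 hem (by rw [hdd]; exact hdY)
      (by rw [hdd]; exact le_trans hdκ (mul_le_mul_of_nonneg_right hκ1 (by linarith))) hYroot hYn) ?_
    have h1 : Real.exp (-(Y / (n:ℝ) ^ ((1:ℝ) / 3))) ≤
        Real.exp (-Y ^ 2 / (max A 1 * (Y * (n:ℝ) ^ ((1:ℝ) / 3) + d))) := by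
      apply Real.exp_le_exp.2
      rw [neg_div, neg_le_neg_iff, div_le_div_iff₀ (by positivity) hroot]
      have h2 : 1 * (Y * (n:ℝ) ^ ((1:ℝ) / 3) + d) ≤ max A 1 * (Y * (n:ℝ) ^ ((1:ℝ) / 3) + d) :=
        mul_le_mul_of_nonneg_right (le_max_right _ _) hden.le
      have h3 : Y * (Y * (n:ℝ) ^ ((1:ℝ) / 3)) ≤ Y * (max A 1 * (Y * (n:ℝ) ^ ((1:ℝ) / 3) + d)) :=
        mul_le_mul_of_nonneg_left (by linarith) (by linarith)
      linarith
    refine le_trans h1 ?_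
    exact le_mul_of_one_le_left (Real.exp_pos _).le (le_max_right _ _)
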